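/- arXiv:2210.04363 — 2 statements merged into one kernel-verified Lean document; each statement's English description precedes it below -/
import Mathlib

section
/- Let ω ⊂ ℝ^d be an open, bounded domain, k ≥ 1 and γ > 0, and suppose the following 'stage property' holds (with constants C depending only on d, k, ω): for all v ∈ C²(ω̄, ℝ^k), w ∈ C²(ω̄, ℝ^d), A ∈ C^{0,β}(ω̄, ℝ^{d×d}_sym) with deficit D = A − (½(∇v)ᵀ∇v + sym∇w) satisfying 0 < ‖D‖₀ ≤ 1, and all M ≥ max{‖v‖₂, ‖w‖₂, 1} and σ > σ₀ (where σ₀ > 1 depends only on ω and γ), there exist ṽ, w̃ ∈ C² satisfying ‖ṽ − v‖₁ ≤ C‖D‖₀^{1/2}, ‖w̃ − w‖₁ ≤ C‖D‖₀^{1/2}(1 + ‖∇v‖₀), ‖∇²ṽ‖₀ ≤ CMσ^γ, ‖∇²w̃‖₀ ≤ CMσ^γ(1 + ‖∇v‖₀), and ‖D̃‖₀ ≤ C(‖A‖_{0,β}M^{−β}‖D‖₀^{β/2} + ‖D‖₀/σ) for the new deficit D̃. Then, for every v ∈ C²(ω̄, ℝ^k), w ∈ C²(ω̄, ℝ^d),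 A ∈ C^{0,β}(ω̄, ℝ^{d×d}_sym) such that D = A − (½(∇v)ᵀ∇v + sym∇w) satisfies 0 < ‖D‖₀ ≤ 1, and for every exponent α with 0 < α < min{β/2, 1/(1+2γ)}, there exist ṽ ∈ C^{1,α}(ω̄, ℝ^k) and w̃ ∈ C^{1,α}(ω̄, ℝ^d) with ‖ṽ − v‖₁ ≤ C‖D‖₀^{1/2}, ‖w̃ − w‖₁ ≤ C‖D‖₀^{1/2}(1 + ‖∇v‖₀), and A − (½(∇ṽ)ᵀ∇ṽ + sym∇w̃) = 0 on ω̄, with constants C depending only on d, k and ω. -/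
noncomputable section
open MeasureTheory Real
open scoped BigOperators ENNReal NNReal

/-- Partial derivative of `f` in the `i`-th coordinate direction. -/
def pd {d : ℕ} {E : Type*} [NormedAddCommGroup E] [NormedSpace ℝ E]
    (i : Fin d) (f : (Fin d → ℝ) → E) (x : Fin d → ℝ) : E :=
  fderiv ℝ f x (Pi.single i 1)

/-- The matrix `(∇v)ᵀ∇v`, with entries `⟨∂ᵢv, ∂ⱼv⟩`. -/
def gradTgrad {d k : ℕ} (v : (Fin d → ℝ) → Fin k → ℝ) (x : Fin d → ℝ) :
    Fin d → Fin d → ℝ :=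
  fun i j => ∑ l, pd i (fun y => v y l) x * pd j (fun y => v y l) x

/-- The symmetrized gradient `sym∇w = ½(∇w + (∇w)ᵀ)`. -/
def symGrad {d : ℕ} (w : (Fin d → ℝ) → Fin d → ℝ) (x : Fin d → ℝ) :
    Fin d → Fin d → ℝ :=
  fun i j => (pd i (fun y => w y j) x + pd j (fun y => w y i) x) / 2

/-- The deficit `D = A − (½(∇v)ᵀ∇v + sym∇w)`. -/
def deficit {d k : ℕ} (A : (Fin d → ℝ) → Fin d → Fin d → ℝ)
    (v : (Fin d → ℝ) → Fin k → ℝ) (w : (Fin d → ℝ) → Fin d → ℝ)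
    (x : Fin d → ℝ) : Fin d → Fin d → ℝ :=
  fun i j => A x i j - ((1/2) * gradTgrad v x i j + symGrad w x i j)

/-- `C⁰` norm of `f` on the closure of `ω`. -/
def supNorm {d : ℕ} {E : Type*} [NormedAddCommGroup E]
    (ω : Set (Fin d → ℝ)) (f : (Fin d → ℝ) → E) : ℝ :=
  ⨆ x : closure ω, ‖f x.1‖

/-- `f` is (globally) `β`-Hölder, i.e. the restriction of a `C^{0,β}` map of `ℝ^d`. -/
def IsHolder {d : ℕ} {E : Type*} [NormedAddCommGroup E] (β : ℝ)
    (f : (Fin d → ℝ) → E) : Prop :=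
  ∃ C : ℝ≥0, HolderWith C β.toNNReal f

/-- `f` is of class `C^{1,α}`: it is `C¹` and its gradient is `α`-Hölder. -/
def IsC1Holder {d : ℕ} {E : Type*} [NormedAddCommGroup E] [NormedSpace ℝ E] (α : ℝ)
    (f : (Fin d → ℝ) → E) : Prop :=
  ContDiff ℝ 1 f ∧ IsHolder α (fderiv ℝ f)

/-- `M > c·Id` in the sense of quadratic forms. -/
def MatGt {d : ℕ} (M : Fin d → Fin d → ℝ) (c : ℝ) : Prop :=
  ∀ ξ : Fin d → ℝ, ξ ≠ 0 → c * ∑ i, ξ i ^ 2 < ∑ i, ∑ j, M i j * ξ i * ξ j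

/-- supremum norm of the gradient on the closure of `ω`. -/
def grad1Norm {d : ℕ} {E : Type*} [NormedAddCommGroup E] [NormedSpace ℝ E]
    (ω : Set (Fin d → ℝ)) (f : (Fin d → ℝ) → E) : ℝ :=
  ⨆ x : closure ω, ‖fderiv ℝ f x.1‖

/-- supremum norm of the Hessian on the closure of `ω`. -/
def grad2Norm {d : ℕ} {E : Type*} [NormedAddCommGroup E] [NormedSpace ℝ E]
    (ω : Set (Fin d → ℝ)) (f : (Fin d → ℝ) → E) : ℝ :=
  ⨆ x : closure ω, ‖fderiv ℝ (fderiv ℝ f) x.1‖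

/-- `C¹` norm on the closure of `ω`. -/
def C1Norm {d : ℕ} {E : Type*} [NormedAddCommGroup E] [NormedSpace ℝ E]
    (ω : Set (Fin d → ℝ)) (f : (Fin d → ℝ) → E) : ℝ :=
  supNorm ω f + grad1Norm ω f

/-- `C²` norm on the closure of `ω`. -/
def C2Norm {d : ℕ} {E : Type*} [NormedAddCommGroup E] [NormedSpace ℝ E]
    (ω : Set (Fin d → ℝ)) (f : (Fin d → ℝ) → E) : ℝ :=
  supNorm ω f + grad1Norm ω f + grad2Norm ω f

/-- Hölder `C^{0,β}` norm on the closure of `ω`. -/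
def holderNorm {d : ℕ} {E : Type*} [NormedAddCommGroup E] (β : ℝ)
    (ω : Set (Fin d → ℝ)) (f : (Fin d → ℝ) → E) : ℝ :=
  supNorm ω f +
    ⨆ p : (closure ω) × (closure ω),
      ‖f p.1.1 - f p.2.1‖ / ‖(p.1.1 : Fin d → ℝ) - (p.2.1 : Fin d → ℝ)‖ ^ β

section Norms

variable {d : ℕ} {E F : Type*} [NormedAddCommGroup E] [NormedAddCommGroup F]
  {ω : Set (Fin d → ℝ)}

lemma norm_le_supNorm (hb : Bornology.IsBounded ω) {f : (Fin d → ℝ) → E} (hf : Continuous f)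
    {x : Fin d → ℝ} (hx : x ∈ closure ω) : ‖f x‖ ≤ supNorm ω f := by
  have hc : IsCompact (closure ω) := hb.isCompact_closure
  obtain ⟨C, hC⟩ := hc.exists_bound_of_continuousOn hf.continuousOn
  exact le_ciSup (f := fun y : closure ω => ‖f y.1‖)
    ⟨C, by rintro _ ⟨y, rfl⟩; exact hC _ y.2⟩ ⟨x, hx⟩

lemma supNorm_le {f : (Fin d → ℝ) → E} {c : ℝ} (hc : 0 ≤ c)
    (h : ∀ x ∈ closure ω, ‖f x‖ ≤ c) : supNorm ω f ≤ c :=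
  Real.iSup_le (fun x => h x.1 x.2) hc

lemma supNorm_nonneg (f : (Fin d → ℝ) → E) : 0 ≤ supNorm ω f :=
  Real.iSup_nonneg fun _ => norm_nonneg _

variable [NormedSpace ℝ E]

lemma grad1Norm_nonneg (f : (Fin d → ℝ) → E) : 0 ≤ grad1Norm ω f :=
  Real.iSup_nonneg fun _ => norm_nonneg _

lemma C1Norm_nonneg (f : (Fin d → ℝ) → E) : 0 ≤ C1Norm ω f :=
  add_nonneg (supNorm_nonneg f) (grad1Norm_nonneg f)

lemma grad1Norm_le {f : (Fin d → ℝ) → E} {c : ℝ} (hc : 0 ≤ c)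
    (h : ∀ x ∈ closure ω, ‖fderiv ℝ f x‖ ≤ c) : grad1Norm ω f ≤ c :=
  Real.iSup_le (fun x => h x.1 x.2) hc

lemma norm_fderiv_le_grad1Norm (hb : Bornology.IsBounded ω) {f : (Fin d → ℝ) → E}
    (hf : ContDiff ℝ 1 f) {x : Fin d → ℝ} (hx : x ∈ closure ω) :
    ‖fderiv ℝ f x‖ ≤ grad1Norm ω f :=
  norm_le_supNorm hb (hf.continuous_fderiv one_ne_zero) hx

lemma norm_fderiv_fderiv_le_grad2Norm (hb : Bornology.IsBounded ω) {f : (Fin d → ℝ) → E}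
    (hf : ContDiff ℝ 2 f) {x : Fin d → ℝ} (hx : x ∈ closure ω) :
    ‖fderiv ℝ (fderiv ℝ f) x‖ ≤ grad2Norm ω f :=
  norm_le_supNorm hb
    ((hf.fderiv_right (m := 1) (by norm_num)).continuous_fderiv one_ne_zero) hx

lemma norm_le_C1Norm (hb : Bornology.IsBounded ω) {f : (Fin d → ℝ) → E} (hf : Continuous f)
    {x : Fin d → ℝ} (hx : x ∈ closure ω) : ‖f x‖ ≤ C1Norm ω f :=
  (norm_le_supNorm hb hf hx).trans (le_add_of_nonneg_right (grad1Norm_nonneg f))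

lemma norm_fderiv_le_C1Norm (hb : Bornology.IsBounded ω) {f : (Fin d → ℝ) → E}
    (hf : ContDiff ℝ 1 f) {x : Fin d → ℝ} (hx : x ∈ closure ω) :
    ‖fderiv ℝ f x‖ ≤ C1Norm ω f :=
  (norm_fderiv_le_grad1Norm hb hf hx).trans (le_add_of_nonneg_left (supNorm_nonneg f))

lemma C1Norm_le {f : (Fin d → ℝ) → E} {c c' : ℝ} (hc : 0 ≤ c) (hc' : 0 ≤ c')
    (h : ∀ x ∈ closure ω, ‖f x‖ ≤ c)
    (h' : ∀ x ∈ closure ω, ‖fderiv ℝ f x‖ ≤ c') : C1Norm ω f ≤ c + c' :=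
  add_le_add (supNorm_le hc h) (grad1Norm_le hc' h')

lemma grad1Norm_le_add (hb : Bornology.IsBounded ω) {f g : (Fin d → ℝ) → E}
    (hf : ContDiff ℝ 1 f) (hg : ContDiff ℝ 1 g) :
    grad1Norm ω f ≤ grad1Norm ω g + grad1Norm ω (fun x => f x - g x) := by
  refine grad1Norm_le (add_nonneg (grad1Norm_nonneg _) (grad1Norm_nonneg _)) fun x hx => ?_
  have h3 := norm_fderiv_le_grad1Norm hb hg hx
  have h4 := norm_fderiv_le_grad1Norm hb (hf.sub hg) hx
  have h5 : fderiv ℝ (f - g) x = fderiv ℝ f x - fderiv ℝ g x :=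
    fderiv_sub (hf.differentiable one_ne_zero x) (hg.differentiable one_ne_zero x)
  have := norm_add_le (fderiv ℝ g x) (fderiv ℝ (f - g) x)
  rw [h5, add_sub_cancel, ← h5] at this
  exact this.trans (add_le_add h3 h4)

lemma C1Norm_le_add (hb : Bornology.IsBounded ω) {f g : (Fin d → ℝ) → E}
    (hf : ContDiff ℝ 1 f) (hg : ContDiff ℝ 1 g) :
    C1Norm ω f ≤ C1Norm ω g + C1Norm ω (fun x => f x - g x) := by
  have h1 : supNorm ω f ≤ supNorm ω g + supNorm ω (fun x => f x - g x) := by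
    refine supNorm_le (add_nonneg (supNorm_nonneg _) (supNorm_nonneg _)) fun x hx => ?_
    have := norm_le_supNorm hb hg.continuous hx
    have := norm_le_supNorm hb (hf.sub hg).continuous hx
    have := norm_add_le (g x) (f x - g x)
    rw [add_sub_cancel] at this
    exact this.trans (by gcongr)
  have h2 := grad1Norm_le_add hb hf hg
  unfold C1Norm
  linarith

lemma grad1Norm_le_C1Norm (f : (Fin d → ℝ) → E) : grad1Norm ω f ≤ C1Norm ω f :=
  le_add_of_nonneg_left (supNorm_nonneg f)

end Norms

section Metric

variable {d k : ℕ}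

/-- The matrix `½ PᵀP + sym Q` attached to a pair of gradients `P`, `Q`. -/
def pullback (P : (Fin d → ℝ) →L[ℝ] (Fin k → ℝ)) (Q : (Fin d → ℝ) →L[ℝ] (Fin d → ℝ))
    (i j : Fin d) : ℝ :=
  (1/2) * ∑ l, P (Pi.single i 1) l * P (Pi.single j 1) l
    + (Q (Pi.single i 1) j + Q (Pi.single j 1) i) / 2

lemma pullback_symm (P : (Fin d → ℝ) →L[ℝ] (Fin k → ℝ)) (Q : (Fin d → ℝ) →L[ℝ] (Fin d → ℝ))
    (i j : Fin d) : pullback P Q i j = pullback P Q j i := by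
  unfold pullback
  rw [add_comm (Q _ j)]
  congr 2
  exact Finset.sum_congr rfl fun l _ => mul_comm _ _

lemma pd_apply {m : ℕ} {f : (Fin d → ℝ) → Fin m → ℝ} {x : Fin d → ℝ}
    (hf : DifferentiableAt ℝ f x) (i : Fin d) (l : Fin m) :
    pd i (fun y => f y l) x = fderiv ℝ f x (Pi.single i 1) l := by
  unfold pd
  rw [fderiv_apply hf]
  rfl

lemma deficit_eq {A : (Fin d → ℝ) → Fin d → Fin d → ℝ} {v : (Fin d → ℝ) → Fin k → ℝ}
    {w : (Fin d → ℝ) → Fin d → ℝ} {x : Fin d → ℝ} (hv : DifferentiableAt ℝ v x)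
    (hw : DifferentiableAt ℝ w x) (i j : Fin d) :
    deficit A v w x i j = A x i j - pullback (fderiv ℝ v x) (fderiv ℝ w x) i j := by
  simp only [deficit, pullback, gradTgrad, symGrad, pd_apply hv, pd_apply hw]

lemma continuous_pullback (i j : Fin d) :
    Continuous fun p : ((Fin d → ℝ) →L[ℝ] (Fin k → ℝ)) × ((Fin d → ℝ) →L[ℝ] (Fin d → ℝ)) =>
      pullback p.1 p.2 i j := by
  unfold pullback
  fun_prop

lemma norm_matrix_le {D : Fin d → Fin d → ℝ} {c : ℝ} (hc : 0 ≤ c) (h : ∀ i j, |D i j| ≤ c) :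
    ‖D‖ ≤ c :=
  (pi_norm_le_iff_of_nonneg hc).2 fun i => (pi_norm_le_iff_of_nonneg hc).2 fun j => h i j

lemma abs_entry_le (D : Fin d → Fin d → ℝ) (i j : Fin d) : |D i j| ≤ ‖D‖ :=
  (norm_le_pi_norm (D i) j).trans (norm_le_pi_norm D i)

lemma norm_single_one (i : Fin d) : ‖(Pi.single i (1:ℝ) : Fin d → ℝ)‖ = 1 := by
  rw [Pi.norm_single, norm_one]

lemma abs_clm_single_le {m : ℕ} (P : (Fin d → ℝ) →L[ℝ] (Fin m → ℝ)) (i : Fin d) (l : Fin m) :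
    |P (Pi.single i 1) l| ≤ ‖P‖ := by
  refine (norm_le_pi_norm (P (Pi.single i 1)) l).trans ?_
  simpa [norm_single_one] using P.le_opNorm (Pi.single i 1)

lemma continuous_deficit {A : (Fin d → ℝ) → Fin d → Fin d → ℝ} {v : (Fin d → ℝ) → Fin k → ℝ}
    {w : (Fin d → ℝ) → Fin d → ℝ} (hA : Continuous A) (hv : ContDiff ℝ 1 v)
    (hw : ContDiff ℝ 1 w) : Continuous (deficit A v w) := by
  refine continuous_pi fun i => continuous_pi fun j => ?_
  have : (fun x => deficit A v w x i j)
      = fun x => A x i j - pullback (fderiv ℝ v x) (fderiv ℝ w x) i j := by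
    funext x
    exact deficit_eq (hv.differentiable one_ne_zero x) (hw.differentiable one_ne_zero x) i j
  rw [this]
  have h1 := hv.continuous_fderiv one_ne_zero
  have h2 := hw.continuous_fderiv one_ne_zero
  have h3 : Continuous fun x => A x i j := (continuous_apply j).comp ((continuous_apply i).comp hA)
  exact h3.sub ((continuous_pullback i j).comp (h1.prodMk h2))

end Metric

section Corrugation

variable {d k : ℕ}

lemma exists_contDiff_near_on_compact {E F : Type*} [NormedAddCommGroup E] [NormedSpace ℝ E]
    [FiniteDimensional ℝ E] [NormedAddCommGroup F] [NormedSpace ℝ F] [CompleteSpace F]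
    {g : E → F} (hg : Continuous g) {K : Set E} (hK : IsCompact K) {ε : ℝ} (hε : 0 < ε) :
    ∃ G : E → F, ContDiff ℝ 2 G ∧ ∀ x ∈ K, ‖G x - g x‖ ≤ ε := by
  have huc : UniformContinuousOn g (Metric.cthickening 1 K) :=
    hK.cthickening.uniformContinuousOn_of_continuous hg.continuousOn
  obtain ⟨δ, hδ, hδg⟩ := Metric.uniformContinuousOn_iff.mp huc ε hε
  obtain ⟨G, hG, hGg⟩ := hg.exists_contDiff_dist_le_of_forall_mem_ball_dist_le
    (lt_min hδ one_pos)
  refine ⟨G, by exact_mod_cast contDiff_infty.1 hG 2, fun x hx => ?_⟩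
  rw [← dist_eq_norm]
  refine hGg x ε fun y hy => ?_
  have hy' := Metric.mem_ball.1 hy
  refine (hδg y ?_ x (Metric.self_subset_cthickening K hx)
    (hy'.trans_le (min_le_left _ _))).le
  exact Metric.mem_cthickening_of_dist_le y x 1 K hx (hy'.le.trans (min_le_right _ _))

lemma pullback_corrugation (P : (Fin d → ℝ) →L[ℝ] (Fin k → ℝ))
    (Q G' : (Fin d → ℝ) →L[ℝ] (Fin d → ℝ)) (L N : (Fin d → ℝ) →L[ℝ] ℝ) (l₀ : Fin k)
    (θ : ℝ) (g η : Fin d → ℝ) (p q : Fin d) :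
    pullback (P + L.smulRight (Pi.single l₀ (1:ℝ)))
        (Q - (θ • G' + L.smulRight g + N.smulRight η)) p q - pullback P Q p q
      = ((P (Pi.single p 1) l₀ - g p) * L (Pi.single q 1)
          + (P (Pi.single q 1) l₀ - g q) * L (Pi.single p 1)) / 2
        + L (Pi.single p 1) * L (Pi.single q 1) / 2
        - (N (Pi.single p 1) * η q + N (Pi.single q 1) * η p) / 2
        - θ * (G' (Pi.single p 1) q + G' (Pi.single q 1) p) / 2 := by
  have hsum : ∑ l, (P (Pi.single p 1) l + L (Pi.single p 1) * (Pi.single l₀ (1:ℝ) : Fin k → ℝ) l)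
        * (P (Pi.single q 1) l + L (Pi.single q 1) * (Pi.single l₀ (1:ℝ) : Fin k → ℝ) l)
      = ∑ l, P (Pi.single p 1) l * P (Pi.single q 1) l
        + (P (Pi.single p 1) l₀ * L (Pi.single q 1) + P (Pi.single q 1) l₀ * L (Pi.single p 1)
          + L (Pi.single p 1) * L (Pi.single q 1)) := by
    have : ∀ l, (P (Pi.single p 1) l + L (Pi.single p 1) * (Pi.single l₀ (1:ℝ) : Fin k → ℝ) l)
        * (P (Pi.single q 1) l + L (Pi.single q 1) * (Pi.single l₀ (1:ℝ) : Fin k → ℝ) l)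
        = P (Pi.single p 1) l * P (Pi.single q 1) l
          + if l = l₀ then P (Pi.single p 1) l₀ * L (Pi.single q 1)
              + P (Pi.single q 1) l₀ * L (Pi.single p 1)
              + L (Pi.single p 1) * L (Pi.single q 1) else 0 := by
      intro l
      by_cases h : l = l₀
      · subst h
        simp
        ring
      · simp [h]
    simp_rw [this, Finset.sum_add_distrib]
    simp
  simp only [pullback, add_apply, sub_apply,
    ContinuousLinearMap.smulRight_apply, smul_apply, Pi.add_apply,
    Pi.sub_apply, Pi.smul_apply, smul_eq_mul, hsum]
  ring

lemma corrugation_error_bound {Z r a c c₂ s s₂ ηp ηq ap aq : ℝ} (hr : 0 ≤ r) (hr1 : r ≤ 1)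
    (hZ : 1 ≤ Z) (ha : |a| ≤ Z) (hc : |c| ≤ 1) (hs : |s| ≤ 1) (hs₂ : |s₂| ≤ 1)
    (hc₂ : c₂ = 2 * c ^ 2 - 1) (hηp : |ηp| ≤ 2) (hηq : |ηq| ≤ 2)
    (hap : |ap| ≤ Z) (haq : |aq| ≤ Z) :
    |(a * c * ηp + r * s * ap) * (a * c * ηq + r * s * aq) / 2
      - ((a ^ 2 / 4 * c₂ * ηp + r * a * s₂ / 4 * ap) * ηq
        + (a ^ 2 / 4 * c₂ * ηq + r * a * s₂ / 4 * aq) * ηp) / 2 - a ^ 2 / 4 * (ηp * ηq)|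
      ≤ 4 * (Z ^ 2 * r) := by
  have e : (a * c * ηp + r * s * ap) * (a * c * ηq + r * s * aq) / 2
      - ((a ^ 2 / 4 * c₂ * ηp + r * a * s₂ / 4 * ap) * ηq
        + (a ^ 2 / 4 * c₂ * ηq + r * a * s₂ / 4 * aq) * ηp) / 2 - a ^ 2 / 4 * (ηp * ηq)
      = r * (a * (c * s) * (ηp * aq) / 2) + r * (a * (c * s) * (ap * ηq) / 2)
        + r * (r * (s * s) * (ap * aq) / 2)
        - r * (a * s₂ * (ap * ηq) / 8) - r * (a * s₂ * (aq * ηp) / 8) := by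
    rw [hc₂]; ring
  have hZ0 : 0 ≤ Z := by linarith
  have m : ∀ {x y X Y : ℝ}, |x| ≤ X → |y| ≤ Y → |x * y| ≤ X * Y := fun {x y X Y} hx hy => by
    rw [abs_mul]
    exact mul_le_mul hx hy (abs_nonneg _) ((abs_nonneg _).trans hx)
  have hr' : |r| ≤ 1 := by rwa [abs_of_nonneg hr]
  have h1 := abs_le.1 (m (m ha (m hc hs)) (m hηp haq))
  have h2 := abs_le.1 (m (m ha (m hc hs)) (m hap hηq))
  have h3 := abs_le.1 (m (m hr' (m hs hs)) (m hap haq))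
  have h4 := abs_le.1 (m (m ha hs₂) (m hap hηq))
  have h5 := abs_le.1 (m (m ha hs₂) (m haq hηp))
  rw [e]
  have key : |(a * (c * s) * (ηp * aq) / 2) + (a * (c * s) * (ap * ηq) / 2)
        + (r * (s * s) * (ap * aq) / 2)
        - (a * s₂ * (ap * ηq) / 8) - (a * s₂ * (aq * ηp) / 8)| ≤ 4 * Z ^ 2 := by
    rw [abs_le]
    constructor <;> nlinarith
  calc _ = r * |(a * (c * s) * (ηp * aq) / 2) + (a * (c * s) * (ap * ηq) / 2)
        + (r * (s * s) * (ap * aq) / 2)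
        - (a * s₂ * (ap * ηq) / 8) - (a * s₂ * (aq * ηp) / 8)| := by
        rw [← abs_of_nonneg hr, ← abs_mul, abs_of_nonneg hr]
        congr 1; ring
    _ ≤ r * (4 * Z ^ 2) := mul_le_mul_of_nonneg_left key hr
    _ = _ := by ring

/-- The linear form `x ↦ xᵢ + xⱼ`. -/
def sumForm (i j : Fin d) : (Fin d → ℝ) →L[ℝ] ℝ :=
  (ContinuousLinearMap.proj i : (Fin d → ℝ) →L[ℝ] ℝ) + ContinuousLinearMap.proj j

lemma abs_sumForm_le (i j : Fin d) (x : Fin d → ℝ) : |sumForm i j x| ≤ 2 * ‖x‖ := by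
  have h1 := norm_le_pi_norm x i
  have h2 := norm_le_pi_norm x j
  have h3 := norm_add_le (x i) (x j)
  change ‖x i + x j‖ ≤ _
  linarith

lemma norm_sumForm_le (i j : Fin d) : ‖sumForm i j‖ ≤ 2 :=
  ContinuousLinearMap.opNorm_le_bound _ zero_le_two (abs_sumForm_le i j)

lemma abs_sumForm_single_le (i j p : Fin d) : |sumForm i j (Pi.single p 1)| ≤ 2 := by
  simpa [norm_single_one] using abs_sumForm_le i j (Pi.single p 1)

theorem exists_corrugation {K : Set (Fin d → ℝ)} (hK : IsCompact K) (l₀ : Fin k) (i j : Fin d)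
    {v : (Fin d → ℝ) → Fin k → ℝ} {w : (Fin d → ℝ) → Fin d → ℝ} {a : (Fin d → ℝ) → ℝ}
    (hv : ContDiff ℝ 2 v) (hw : ContDiff ℝ 2 w) (ha : ContDiff ℝ 2 a) {a₀ : ℝ}
    (haa : ∀ x, |a x| ≤ a₀) {ε : ℝ} (hε : 0 < ε) :
    ∃ (v' : (Fin d → ℝ) → Fin k → ℝ) (w' : (Fin d → ℝ) → Fin d → ℝ),
      ContDiff ℝ 2 v' ∧ ContDiff ℝ 2 w' ∧ ∀ x ∈ K,
        ‖v' x - v x‖ ≤ ε ∧ ‖w' x - w x‖ ≤ ε ∧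
        ‖fderiv ℝ v' x - fderiv ℝ v x‖ ≤ 2 * a₀ + ε ∧
        ‖fderiv ℝ w' x - fderiv ℝ w x‖ ≤ 2 * a₀ * ‖fderiv ℝ v x‖ + a₀ ^ 2 + ε ∧
        ∀ p q, |pullback (fderiv ℝ v' x) (fderiv ℝ w' x) p q
            - pullback (fderiv ℝ v x) (fderiv ℝ w x) p q
            - a x ^ 2 / 4 * (sumForm i j (Pi.single p 1) * sumForm i j (Pi.single q 1))| ≤ ε := by
  have ha₀ : 0 ≤ a₀ := (abs_nonneg _).trans (haa 0)
  obtain ⟨ε₁, hε₁, hε₁'⟩ : ∃ ε₁ : ℝ, 0 < ε₁ ∧ ε₁ * (2 * a₀ + 1) ≤ ε / 4 :=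
    ⟨ε / 4 / (2 * a₀ + 1), by positivity, by rw [div_mul_cancel₀]; positivity⟩
  have hgc : Continuous fun x => (fun p => fderiv ℝ v x (Pi.single p 1) l₀ : Fin d → ℝ) := by
    have := hv.continuous_fderiv two_ne_zero
    fun_prop
  obtain ⟨G, hG, hGg⟩ := exists_contDiff_near_on_compact hgc hK hε₁
  obtain ⟨Z, hZ1, hZa, hZa', hZG, hZG'⟩ : ∃ Z : ℝ, 1 ≤ Z ∧ a₀ ≤ Z ∧
      (∀ x ∈ K, ‖fderiv ℝ a x‖ ≤ Z) ∧ (∀ x ∈ K, ‖G x‖ ≤ Z) ∧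
      (∀ x ∈ K, ‖fderiv ℝ G x‖ ≤ Z) := by
    obtain ⟨C1, h1⟩ := hK.exists_bound_of_continuousOn
      (ha.continuous_fderiv two_ne_zero).continuousOn
    obtain ⟨C2, h2⟩ := hK.exists_bound_of_continuousOn hG.continuous.continuousOn
    obtain ⟨C3, h3⟩ := hK.exists_bound_of_continuousOn
      (hG.continuous_fderiv two_ne_zero).continuousOn
    refine ⟨max (max 1 a₀) (max C1 (max C2 C3)), ?_, ?_, fun x hx => ?_, fun x hx => ?_,
      fun x hx => ?_⟩
    · simp
    · simp
    · exact (h1 x hx).trans (by simp)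
    · exact (h2 x hx).trans (by simp)
    · exact (h3 x hx).trans (by simp)
  obtain ⟨r, hr, hr1, hrZ⟩ : ∃ r : ℝ, 0 < r ∧ r ≤ 1 ∧ 16 * (Z ^ 2 * r) ≤ min ε 1 := by
    have hZ2 : 0 < 16 * Z ^ 2 := by positivity
    refine ⟨min ε 1 / (16 * Z ^ 2), by positivity, ?_, ?_⟩
    · rw [div_le_one hZ2]
      exact (min_le_right _ _).trans (by nlinarith)
    · rw [← mul_assoc, mul_div_cancel₀ _ hZ2.ne']
  have hrε : 16 * (Z ^ 2 * r) ≤ ε := hrZ.trans (min_le_left _ _)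
  have hrone : 16 * (Z ^ 2 * r) ≤ 1 := hrZ.trans (min_le_right _ _)
  have hZr : Z * r ≤ Z ^ 2 * r := mul_le_mul_of_nonneg_right (by nlinarith) hr.le
  have hZr0 : 0 ≤ Z * r := by positivity
  set t := sumForm i j with ht
  set η : Fin d → ℝ := fun p => t (Pi.single p 1) with hη
  have hη2 : ‖η‖ ≤ 2 := (pi_norm_le_iff_of_nonneg zero_le_two).2 fun p =>
    abs_sumForm_single_le i j p
  let θ : (Fin d → ℝ) → ℝ := fun x => r * (a x * sin (r⁻¹ * t x))
  let ζ : (Fin d → ℝ) → ℝ := fun x => r / 8 * (a x ^ 2 * sin (2 * (r⁻¹ * t x)))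
  let L : (Fin d → ℝ) → (Fin d → ℝ) →L[ℝ] ℝ := fun x =>
    (a x * cos (r⁻¹ * t x)) • t + (r * sin (r⁻¹ * t x)) • fderiv ℝ a x
  let N : (Fin d → ℝ) → (Fin d → ℝ) →L[ℝ] ℝ := fun x =>
    (a x ^ 2 / 4 * cos (2 * (r⁻¹ * t x))) • t
      + (r * a x * sin (2 * (r⁻¹ * t x)) / 4) • fderiv ℝ a x
  have hθc : ContDiff ℝ 2 θ := by fun_prop
  have hζc : ContDiff ℝ 2 ζ := by fun_prop
  have hda : ∀ x, HasFDerivAt a (fderiv ℝ a x) x := fun x =>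
    (ha.differentiable two_ne_zero x).hasFDerivAt
  have hθ' : ∀ x, HasFDerivAt θ (L x) x := fun x => by
    have h := (((hda x).mul (t.hasFDerivAt.const_mul r⁻¹).sin)).const_mul r
    refine h.congr_fderiv ?_
    ext y
    simp only [L, add_apply, smul_apply, smul_eq_mul]
    field_simp
  have hζ' : ∀ x, HasFDerivAt ζ (N x) x := fun x => by
    have h := (((hda x).pow 2).mul ((t.hasFDerivAt.const_mul r⁻¹).const_mul 2).sin).const_mul (r/8)
    refine h.congr_fderiv ?_
    ext y
    simp only [N, add_apply, smul_apply, smul_eq_mul,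
      nsmul_eq_mul]
    field_simp
    push_cast
    ring
  have hdv : ∀ x, HasFDerivAt v (fderiv ℝ v x) x := fun x =>
    (hv.differentiable two_ne_zero x).hasFDerivAt
  have hdw : ∀ x, HasFDerivAt w (fderiv ℝ w x) x := fun x =>
    (hw.differentiable two_ne_zero x).hasFDerivAt
  have hdG : ∀ x, HasFDerivAt G (fderiv ℝ G x) x := fun x =>
    (hG.differentiable two_ne_zero x).hasFDerivAt
  let e₀ : Fin k → ℝ := Pi.single l₀ 1
  have he₀ : ‖e₀‖ = 1 := by simp [e₀, Pi.norm_single]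
  have hV : ∀ x, fderiv ℝ (fun x => v x + θ x • e₀) x
      = fderiv ℝ v x + (L x).smulRight e₀ := fun x =>
    ((hdv x).add ((hθ' x).smul_const e₀)).fderiv
  have hW : ∀ x, fderiv ℝ (fun x => w x - (θ x • G x + ζ x • η)) x
      = fderiv ℝ w x - (θ x • fderiv ℝ G x + (L x).smulRight (G x) + (N x).smulRight η) :=
    fun x => ((hdw x).sub (((hθ' x).smul (hdG x)).add ((hζ' x).smul_const η))).fderiv
  refine ⟨fun x => v x + θ x • e₀, fun x => w x - (θ x • G x + ζ x • η), ?_, ?_, ?_⟩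
  · exact hv.add (hθc.smul contDiff_const)
  · exact hw.sub ((hθc.smul hG).add (hζc.smul contDiff_const))
  intro x hx
  have hax : |a x| ≤ Z := (haa x).trans hZa
  have hsin := abs_sin_le_one (r⁻¹ * t x)
  have hcos := abs_cos_le_one (r⁻¹ * t x)
  have hsin2 := abs_sin_le_one (2 * (r⁻¹ * t x))
  have hcos2 := abs_cos_le_one (2 * (r⁻¹ * t x))
  have m : ∀ {x y X Y : ℝ}, |x| ≤ X → |y| ≤ Y → |x * y| ≤ X * Y := fun {x y X Y} hx hy => by
    rw [abs_mul]
    exact mul_le_mul hx hy (abs_nonneg _) ((abs_nonneg _).trans hx)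
  have hrabs : |r| ≤ r := (abs_of_pos hr).le
  have hθx : |θ x| ≤ Z * r := (m hrabs (m hax hsin)).trans (by linarith)
  have hζx : |ζ x| ≤ Z ^ 2 * r / 8 := by
    have h1 : |r / 8| ≤ r / 8 := (abs_of_pos (by positivity)).le
    have h2 : |a x ^ 2| ≤ Z ^ 2 := by rw [abs_pow]; gcongr
    exact (m h1 (m h2 hsin2)).trans (by linarith)
  have hLx : ‖L x‖ ≤ 2 * a₀ + Z * r := by
    refine (norm_add_le _ _).trans ?_
    rw [norm_smul, norm_smul]
    have h1 : ‖a x * cos (r⁻¹ * t x)‖ ≤ a₀ * 1 := m (haa x) hcos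
    have h2 : ‖r * sin (r⁻¹ * t x)‖ ≤ r * 1 := m hrabs hsin
    have h3 := mul_le_mul h1 (norm_sumForm_le i j) (norm_nonneg _) (by linarith)
    have h4 := mul_le_mul h2 (hZa' x hx) (norm_nonneg _) (by linarith)
    linarith
  have hNx : ‖N x‖ ≤ a₀ ^ 2 / 2 + Z ^ 2 * r := by
    refine (norm_add_le _ _).trans ?_
    rw [norm_smul, norm_smul]
    have h0 : |a x ^ 2 / 4| ≤ a₀ ^ 2 / 4 := by
      rw [abs_div, abs_pow, abs_of_pos (by norm_num : (0:ℝ) < 4)]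
      have := haa x
      gcongr
    have h1 : ‖a x ^ 2 / 4 * cos (2 * (r⁻¹ * t x))‖ ≤ a₀ ^ 2 / 4 * 1 := m h0 hcos2
    have h2 : ‖r * a x * sin (2 * (r⁻¹ * t x)) / 4‖ ≤ r * Z * 1 := by
      rw [norm_div]
      refine (div_le_self (norm_nonneg _) (by norm_num)).trans ?_
      exact m (m hrabs hax) hsin2
    have h3 := mul_le_mul h1 (norm_sumForm_le i j) (norm_nonneg _) (by positivity)
    have h4 := mul_le_mul h2 (hZa' x hx) (norm_nonneg _) (by positivity)
    linarith
  have hGx : ‖G x‖ ≤ ‖fderiv ℝ v x‖ + ε₁ := by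
    have h1 := hGg x hx
    have h2 : ‖(fun p => fderiv ℝ v x (Pi.single p 1) l₀ : Fin d → ℝ)‖ ≤ ‖fderiv ℝ v x‖ :=
      (pi_norm_le_iff_of_nonneg (norm_nonneg _)).2 fun p => abs_clm_single_le _ _ _
    have h3 := norm_le_norm_add_norm_sub' (G x) (fun p => fderiv ℝ v x (Pi.single p 1) l₀)
    linarith
  rw [hV, hW]
  refine ⟨?_, ?_, ?_, ?_, fun p q => ?_⟩
  · rw [add_sub_cancel_left, norm_smul, he₀, mul_one]
    exact hθx.trans (by linarith)
  · rw [sub_sub_cancel_left, norm_neg]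
    refine (norm_add_le _ _).trans ?_
    rw [norm_smul, norm_smul]
    have h1 := mul_le_mul hθx (hZG x hx) (norm_nonneg _) hZr0
    have h2 := mul_le_mul hζx hη2 (norm_nonneg _) (by positivity)
    change |θ x| * _ + |ζ x| * _ ≤ _
    nlinarith
  · rw [add_sub_cancel_left, ContinuousLinearMap.norm_smulRight_apply, he₀, mul_one]
    exact hLx.trans (by linarith)
  · rw [sub_sub_cancel_left, norm_neg]
    refine (norm_add₃_le).trans ?_
    rw [norm_smul, ContinuousLinearMap.norm_smulRight_apply,
      ContinuousLinearMap.norm_smulRight_apply]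
    have h1 := mul_le_mul hθx (hZG' x hx) (norm_nonneg _) hZr0
    have h2 := mul_le_mul_of_nonneg_right hLx (norm_nonneg (G x))
    have h3 := mul_le_mul hNx hη2 (norm_nonneg _) (by positivity)
    have h4 := mul_le_mul_of_nonneg_left hGx (by linarith : 0 ≤ 2 * a₀)
    have h5 := mul_le_mul_of_nonneg_left (hZG x hx) hZr0
    change |θ x| * _ + _ + _ ≤ _
    nlinarith
  · have hd : ∀ p, |fderiv ℝ v x (Pi.single p 1) l₀ - G x p| ≤ ε₁ := fun p => by
      rw [abs_sub_comm]
      exact (norm_le_pi_norm (G x - fun p => fderiv ℝ v x (Pi.single p 1) l₀) p).trans (hGg x hx)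
    have hLp : ∀ p, |L x (Pi.single p 1)| ≤ 2 * a₀ + 1 := fun p => by
      have := (L x).le_opNorm (Pi.single p 1)
      rw [norm_single_one, mul_one] at this
      exact this.trans (by linarith)
    have hap : ∀ p, |fderiv ℝ a x (Pi.single p 1)| ≤ Z := fun p => by
      have := (fderiv ℝ a x).le_opNorm (Pi.single p 1)
      rw [norm_single_one, mul_one] at this
      exact this.trans (hZa' x hx)
    have hG' : ∀ p q, |fderiv ℝ G x (Pi.single p 1) q| ≤ Z := fun p q =>
      (abs_clm_single_le _ _ _).trans (hZG' x hx)
    have hmain := abs_le.1 (corrugation_error_bound hr.le hr1 hZ1 hax hcos hsin hsin2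
      (cos_two_mul _) (abs_sumForm_single_le i j p) (abs_sumForm_single_le i j q) (hap p) (hap q))
    have e1 := abs_le.1 (m (hd p) (hLp q))
    have e2 := abs_le.1 (m (hd q) (hLp p))
    have e3 := abs_le.1 (m hθx (hG' p q))
    have e4 := abs_le.1 (m hθx (hG' q p))
    have h := pullback_corrugation (fderiv ℝ v x) (fderiv ℝ w x) (fderiv ℝ G x) (L x) (N x) l₀
      (θ x) (G x) η p q
    have hLe : ∀ p, L x (Pi.single p 1) = a x * cos (r⁻¹ * t x) * t (Pi.single p 1)
        + r * sin (r⁻¹ * t x) * fderiv ℝ a x (Pi.single p 1) := fun p => rfl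
    have hNe : ∀ p, N x (Pi.single p 1)
        = a x ^ 2 / 4 * cos (2 * (r⁻¹ * t x)) * t (Pi.single p 1)
        + r * a x * sin (2 * (r⁻¹ * t x)) / 4 * fderiv ℝ a x (Pi.single p 1) := fun p => rfl
    have hηe : ∀ p, η p = t (Pi.single p 1) := fun p => rfl
    rw [← hLe, ← hLe, ← hNe, ← hNe] at hmain
    rw [hηe, hηe] at h
    change |pullback _ _ p q - pullback _ _ p q
      - a x ^ 2 / 4 * (t (Pi.single p 1) * t (Pi.single q 1))| ≤ _
    rw [h, abs_le]
    have e5 : Z * r * Z = Z ^ 2 * r := by ring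
    constructor <;> linarith [hmain.1, hmain.2, e1.1, e1.2, e2.1, e2.2, e3.1, e3.2, e4.1, e4.2]

end Corrugation

section Decomposition

variable {d k : ℕ}

theorem exists_corrugation_sum {K : Set (Fin d → ℝ)} (hK : IsCompact K) (l₀ : Fin k)
    {a : Fin d × Fin d → (Fin d → ℝ) → ℝ} (ha : ∀ ι, ContDiff ℝ 2 (a ι)) {a₀ : ℝ} (ha₀ : 0 ≤ a₀)
    (haa : ∀ ι x, |a ι x| ≤ a₀)
    {v : (Fin d → ℝ) → Fin k → ℝ} {w : (Fin d → ℝ) → Fin d → ℝ}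
    (hv : ContDiff ℝ 2 v) (hw : ContDiff ℝ 2 w) (s : Finset (Fin d × Fin d)) :
    ∀ ε : ℝ, 0 < ε → ε ≤ 1 →
    ∃ (v' : (Fin d → ℝ) → Fin k → ℝ) (w' : (Fin d → ℝ) → Fin d → ℝ),
      ContDiff ℝ 2 v' ∧ ContDiff ℝ 2 w' ∧ ∀ x ∈ K,
        ‖v' x - v x‖ ≤ ε ∧ ‖w' x - w x‖ ≤ ε ∧
        ‖fderiv ℝ v' x - fderiv ℝ v x‖ ≤ s.card * (2 * a₀) + ε ∧
        ‖fderiv ℝ w' x - fderiv ℝ w x‖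
          ≤ s.card * (2 * a₀ * (‖fderiv ℝ v x‖ + s.card * (2 * a₀) + 1) + a₀ ^ 2) + ε ∧
        ∀ p q, |pullback (fderiv ℝ v' x) (fderiv ℝ w' x) p q
            - pullback (fderiv ℝ v x) (fderiv ℝ w x) p q
            - ∑ ι ∈ s, a ι x ^ 2 / 4 * (sumForm ι.1 ι.2 (Pi.single p 1)
                * sumForm ι.1 ι.2 (Pi.single q 1))| ≤ ε := by
  classical
  induction s using Finset.induction_on with
  | empty =>
    intro ε hε _
    exact ⟨v, w, hv, hw, fun x _ => by simp [hε.le]⟩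
  | insert ι s hι ih =>
    intro ε hε hε1
    obtain ⟨v₁, w₁, hv₁, hw₁, h₁⟩ := ih (ε / 2) (by positivity) (by linarith)
    obtain ⟨v₂, w₂, hv₂, hw₂, h₂⟩ := exists_corrugation hK l₀ ι.1 ι.2 hv₁ hw₁ (ha ι) (haa ι)
      (half_pos hε)
    refine ⟨v₂, w₂, hv₂, hw₂, fun x hx => ?_⟩
    obtain ⟨e1, e2, e3, e4, e5⟩ := h₁ x hx
    obtain ⟨f1, f2, f3, f4, f5⟩ := h₂ x hx
    rw [Finset.card_insert_of_notMem hι]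
    push_cast
    have hs : (0:ℝ) ≤ s.card := Nat.cast_nonneg _
    refine ⟨?_, ?_, ?_, ?_, fun p q => ?_⟩
    · have := norm_sub_le_norm_sub_add_norm_sub (v₂ x) (v₁ x) (v x)
      linarith
    · have := norm_sub_le_norm_sub_add_norm_sub (w₂ x) (w₁ x) (w x)
      linarith
    · have := norm_sub_le_norm_sub_add_norm_sub (fderiv ℝ v₂ x) (fderiv ℝ v₁ x) (fderiv ℝ v x)
      linarith
    · have h6 := norm_sub_le_norm_sub_add_norm_sub (fderiv ℝ w₂ x) (fderiv ℝ w₁ x) (fderiv ℝ w x)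
      have h7 : ‖fderiv ℝ v₁ x‖ ≤ ‖fderiv ℝ v x‖ + s.card * (2 * a₀) + 1 := by
        have := norm_le_norm_add_norm_sub' (fderiv ℝ v₁ x) (fderiv ℝ v x)
        linarith
      have h8 := mul_le_mul_of_nonneg_left h7 (by linarith : 0 ≤ 2 * a₀)
      have h9 : 0 ≤ (s.card + 1) * (2 * a₀ * (2 * a₀)) := by positivity
      nlinarith
    · rw [Finset.sum_insert hι]
      have g1 := abs_le.1 (e5 p q)
      have g2 := abs_le.1 (f5 p q)
      rw [abs_le]
      constructor <;> linarith [g1.1, g1.2, g2.1, g2.2]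

/-- Coefficient of the symmetric matrix `P` on `(eᵢ + eⱼ) ⊗ (eᵢ + eⱼ)`. -/
def primitiveCoeff (P : Fin d → Fin d → ℝ) (ι : Fin d × Fin d) : ℝ :=
  P ι.1 ι.2 / 2 - if ι.1 = ι.2 then (∑ l, P ι.1 l) / 4 else 0

lemma sumForm_single (i j p : Fin d) : sumForm i j (Pi.single p 1)
    = (if i = p then 1 else 0) + (if j = p then 1 else 0) := by
  change (Pi.single p (1:ℝ) : Fin d → ℝ) i + (Pi.single p (1:ℝ) : Fin d → ℝ) j = _
  simp [Pi.single_apply]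

lemma sum_primitiveCoeff {P : Fin d → Fin d → ℝ} (hP : ∀ i j, P i j = P j i) (p q : Fin d) :
    ∑ ι : Fin d × Fin d, primitiveCoeff P ι
      * (sumForm ι.1 ι.2 (Pi.single p 1) * sumForm ι.1 ι.2 (Pi.single q 1)) = P p q := by
  have hterm : ∀ i j, primitiveCoeff P (i, j)
      * (sumForm i j (Pi.single p 1) * sumForm i j (Pi.single q 1))
      = (if i = p then (if p = q then P p j / 2 else 0) else 0)
        + (if j = p then (if p = q then P p i / 2 else 0) else 0)
        + (if i = p then (if j = q then P p q / 2 else 0) else 0)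
        + (if i = q then (if j = p then P p q / 2 else 0) else 0)
        - (if i = j then (if i = p then (if p = q then ∑ l, P p l else 0) else 0) else 0) := by
    intro i j
    simp only [primitiveCoeff, sumForm_single]
    have := hP i j
    have := hP q p
    by_cases h1 : i = p <;> by_cases h2 : i = q <;> by_cases h3 : j = p <;> by_cases h4 : j = q <;>
      grind
  rw [Fintype.sum_prod_type]
  simp only [hterm, Finset.sum_sub_distrib, Finset.sum_add_distrib, Finset.sum_ite_eq,
    Finset.sum_ite_eq', Finset.mem_univ, if_true]
  by_cases h : p = q
  · subst h
    simp [← Finset.sum_div]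
    ring
  · simp [h]

end Decomposition

section Approximation

variable {d k : ℕ}

/-- The linear map with matrix `3` off the diagonal and `10 d + 3` on it. -/
def shiftMap (d : ℕ) : (Fin d → ℝ) →L[ℝ] (Fin d → ℝ) :=
  ContinuousLinearMap.pi fun p =>
    3 • (∑ j, (ContinuousLinearMap.proj j : (Fin d → ℝ) →L[ℝ] ℝ))
      + (10 * (d:ℝ)) • (ContinuousLinearMap.proj p : (Fin d → ℝ) →L[ℝ] ℝ)

lemma shiftMap_apply (x : Fin d → ℝ) (p : Fin d) :
    shiftMap d x p = 3 * ∑ j, x j + 10 * d * x p := by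
  simp [shiftMap]

lemma norm_shiftMap_le : ‖shiftMap d‖ ≤ 13 * d := by
  refine ContinuousLinearMap.opNorm_le_bound _ (by positivity) fun x => ?_
  refine (pi_norm_le_iff_of_nonneg (by positivity)).2 fun p => ?_
  rw [shiftMap_apply]
  have h1 : ‖∑ j, x j‖ ≤ d * ‖x‖ := by
    refine (norm_sum_le _ _).trans ?_
    refine (Finset.sum_le_sum fun j _ => norm_le_pi_norm x j).trans ?_
    simp
  have h2 := norm_le_pi_norm x p
  refine (norm_add_le _ _).trans ?_
  rw [norm_mul, norm_mul, Real.norm_of_nonneg (by norm_num : (0:ℝ) ≤ 3),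
    Real.norm_of_nonneg (by positivity : (0:ℝ) ≤ 10 * d)]
  have h3 := mul_le_mul_of_nonneg_left h2 (by positivity : (0:ℝ) ≤ 10 * d)
  linarith

lemma shiftMap_single (p q : Fin d) :
    shiftMap d (Pi.single p 1) q = 3 + if q = p then 10 * (d:ℝ) else 0 := by
  rw [shiftMap_apply, Finset.sum_pi_single']
  simp [Pi.single_apply]

lemma pullback_sub_shift (P : (Fin d → ℝ) →L[ℝ] (Fin k → ℝ)) (Q : (Fin d → ℝ) →L[ℝ] (Fin d → ℝ))
    (δ : ℝ) (p q : Fin d) :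
    pullback P (Q - δ • shiftMap d) p q
      = pullback P Q p q - δ * (3 + if p = q then 10 * (d:ℝ) else 0) := by
  simp only [pullback, sub_apply, smul_apply, Pi.sub_apply, Pi.smul_apply, smul_eq_mul,
    shiftMap_single, eq_comm (a := q)]
  ring

lemma primitiveCoeff_shift_bounds (hd : 1 ≤ d) {D : Fin d → Fin d → ℝ} {δ : ℝ} (hδ : 0 < δ)
    (hD : ∀ p q, |D p q| ≤ 2 * δ) (ι : Fin d × Fin d) :
    0 < primitiveCoeff (fun p q => D p q + δ * (3 + if p = q then 10 * (d:ℝ) else 0)) ι ∧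
    primitiveCoeff (fun p q => D p q + δ * (3 + if p = q then 10 * (d:ℝ) else 0)) ι
      ≤ 8 * d * δ := by
  have hd' : (1:ℝ) ≤ d := by exact_mod_cast hd
  have hdδ : δ ≤ d * δ := le_mul_of_one_le_left hδ.le hd'
  obtain ⟨i, j⟩ := ι
  have hDij := abs_le.1 (hD i j)
  unfold primitiveCoeff
  by_cases h : i = j
  · subst h
    have hsum : |∑ l, D i l| ≤ d * (2 * δ) := by
      refine (Finset.abs_sum_le_sum_abs _ _).trans ?_
      refine (Finset.sum_le_sum fun j _ => hD i j).trans ?_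
      simp
    have hsum' := abs_le.1 hsum
    have : ∑ l, (D i l + δ * (3 + if i = l then 10 * (d:ℝ) else 0))
        = ∑ l, D i l + 13 * (d * δ) := by
      simp only [Finset.sum_add_distrib, mul_add, mul_ite, mul_zero, Finset.sum_const,
        Finset.sum_ite_eq, Finset.mem_univ, if_true, Finset.card_univ, Fintype.card_fin,
        nsmul_eq_mul]
      ring
    simp only [this, if_true]
    constructor <;> nlinarith [hsum'.1, hsum'.2, hDij.1, hDij.2]
  · simp only [h, if_false]
    constructor <;> nlinarith [hDij.1, hDij.2]

set_option maxHeartbeats 1000000 in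
theorem exists_approximate_solution (hd : 1 ≤ d) (l₀ : Fin k) :
    ∃ C : ℝ, 0 < C ∧ ∀ (K : Set (Fin d → ℝ)), IsCompact K →
      ∀ (v : (Fin d → ℝ) → Fin k → ℝ) (w : (Fin d → ℝ) → Fin d → ℝ)
        (D : (Fin d → ℝ) → Fin d → Fin d → ℝ) (δ ε : ℝ),
        ContDiff ℝ 2 v → ContDiff ℝ 2 w → UniformContinuous D →
        (∀ x i j, D x i j = D x j i) → (∀ x i j, |D x i j| ≤ δ) → 0 < δ → δ ≤ 1 → 0 < ε →
        ∃ (v' : (Fin d → ℝ) → Fin k → ℝ) (w' : (Fin d → ℝ) → Fin d → ℝ),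
          ContDiff ℝ 2 v' ∧ ContDiff ℝ 2 w' ∧ ∀ x ∈ K,
            ‖v' x - v x‖ ≤ C * √δ ∧ ‖w' x - w x‖ ≤ C * √δ * (1 + ‖x‖) ∧
            ‖fderiv ℝ v' x - fderiv ℝ v x‖ ≤ C * √δ ∧
            ‖fderiv ℝ w' x - fderiv ℝ w x‖ ≤ C * √δ * (1 + ‖fderiv ℝ v x‖) ∧
            ∀ p q, |pullback (fderiv ℝ v' x) (fderiv ℝ w' x) p q
              - (pullback (fderiv ℝ v x) (fderiv ℝ w x) p q + D x p q)| ≤ ε := by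
  obtain ⟨N, hN⟩ : ∃ N : ℝ, N = (Finset.univ : Finset (Fin d × Fin d)).card := ⟨_, rfl⟩
  have hN0 : 0 ≤ N := by rw [hN]; positivity
  obtain ⟨c, hc⟩ : ∃ c : ℝ, c = √(32 * d) := ⟨_, rfl⟩
  have hc0 : 0 ≤ c := by rw [hc]; positivity
  refine ⟨N * (2 * c) + 1 + (N * (2 * c * (2 * N * c + 2) + c ^ 2) + 13 * d), by positivity, ?_⟩
  intro K hK v w D δ ε hv hw hD hDs hDδ hδ hδ1 hε
  obtain ⟨D₀, hD₀, hD₀D⟩ := hD.exists_contDiff_dist_le (lt_min (half_pos hε) hδ)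
  have hD₀2 : ContDiff ℝ 2 D₀ := by exact_mod_cast contDiff_infty.1 hD₀ 2
  let D₁ : (Fin d → ℝ) → Fin d → Fin d → ℝ := fun x p q => (D₀ x p q + D₀ x q p) / 2
  have hent : ∀ p q, ContDiff ℝ 2 fun x => D₀ x p q := fun p q =>
    contDiff_pi.1 (contDiff_pi.1 hD₀2 p) q
  have hD₁c : ∀ p q, ContDiff ℝ 2 fun x => D₁ x p q := fun p q =>
    ((hent p q).add (hent q p)).div_const 2
  have hD₁D : ∀ x p q, |D₁ x p q - D x p q| ≤ min (ε / 2) δ := fun x p q => by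
    have h1 : ∀ p q, |D₀ x p q - D x p q| ≤ min (ε / 2) δ := fun p q =>
      (abs_entry_le (D₀ x - D x) p q).trans (by rw [← dist_eq_norm]; exact (hD₀D x).le)
    have h2 := abs_le.1 (h1 p q)
    have h3 := abs_le.1 (h1 q p)
    rw [hDs x q p] at h3
    simp only [D₁]
    rw [abs_le]
    constructor <;> linarith [h2.1, h2.2, h3.1, h3.2]
  have hD₁b : ∀ x p q, |D₁ x p q| ≤ 2 * δ := fun x p q => by
    have h2 := abs_le.1 ((hD₁D x p q).trans (min_le_right _ _))
    have h3 := abs_le.1 (hDδ x p q)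
    rw [abs_le]
    constructor <;> linarith [h2.1, h2.2, h3.1, h3.2]
  let P : (Fin d → ℝ) → Fin d → Fin d → ℝ := fun x p q =>
    D₁ x p q + δ * (3 + if p = q then 10 * (d:ℝ) else 0)
  have hPs : ∀ x p q, P x p q = P x q p := fun x p q => by
    simp only [P, D₁, eq_comm (a := p), add_comm (D₀ x p q)]
  let b : Fin d × Fin d → (Fin d → ℝ) → ℝ := fun ι x => primitiveCoeff (P x) ι
  have hb : ∀ ι x, 0 < b ι x ∧ b ι x ≤ 8 * d * δ := fun ι x =>
    primitiveCoeff_shift_bounds hd hδ (hD₁b x) ι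
  have hPc : ∀ p q, ContDiff ℝ 2 fun x => P x p q := fun p q => (hD₁c p q).add contDiff_const
  have hbc : ∀ ι, ContDiff ℝ 2 (b ι) := fun ι => by
    simp only [b, primitiveCoeff]
    refine ((hPc _ _).div_const 2).sub ?_
    split_ifs
    · exact (ContDiff.sum fun l _ => hPc _ _).div_const 4
    · exact contDiff_const
  let a : Fin d × Fin d → (Fin d → ℝ) → ℝ := fun ι x => √(4 * b ι x)
  have hac : ∀ ι, ContDiff ℝ 2 (a ι) := fun ι =>
    (contDiff_const.mul (hbc ι)).sqrt fun x => (mul_pos four_pos (hb ι x).1).ne'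
  have hab : ∀ ι x, |a ι x| ≤ c * √δ := fun ι x => by
    rw [abs_of_nonneg (Real.sqrt_nonneg _), hc, ← Real.sqrt_mul (by positivity)]
    exact Real.sqrt_le_sqrt (by linarith [(hb ι x).2])
  obtain ⟨ρ, hρ⟩ : ∃ ρ : ℝ, ρ = √δ := ⟨_, rfl⟩
  have hρ0 : 0 < ρ := by rw [hρ]; positivity
  have hρ1 : ρ ≤ 1 := by rw [hρ]; exact Real.sqrt_le_one.2 hδ1
  have hρ2 : ρ * ρ = δ := by rw [hρ]; exact Real.mul_self_sqrt hδ.le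
  have hw₀ : ContDiff ℝ 2 fun x => w x - (δ • shiftMap d) x :=
    hw.sub (δ • shiftMap d).contDiff
  rw [← hρ] at hab ⊢
  obtain ⟨v', w', hv', hw', h⟩ := exists_corrugation_sum hK l₀ hac (by positivity) hab hv hw₀
    Finset.univ (min (ε / 2) ρ) (lt_min (half_pos hε) hρ0) ((min_le_right _ _).trans hρ1)
  refine ⟨v', w', hv', hw', fun x hx => ?_⟩
  obtain ⟨h1, h2, h3, h4, h5⟩ := h x hx
  have hfw : fderiv ℝ (fun x => w x - (δ • shiftMap d) x) x = fderiv ℝ w x - δ • shiftMap d :=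
    ((hw.differentiable two_ne_zero x).hasFDerivAt.sub (δ • shiftMap d).hasFDerivAt).fderiv
  rw [hfw] at h4 h5
  rw [← hN] at h3 h4
  have hmin : min (ε / 2) ρ ≤ ρ := min_le_right _ _
  have hSn : ‖δ • shiftMap d‖ ≤ 13 * d * ρ := by
    rw [norm_smul, Real.norm_of_nonneg hδ.le]
    calc δ * ‖shiftMap d‖ ≤ ρ * (13 * d) :=
          mul_le_mul (by nlinarith) norm_shiftMap_le (norm_nonneg _) hρ0.le
      _ = _ := by ring
  have hB : 0 ≤ N * (2 * c * (2 * N * c + 2) + c ^ 2) := by positivity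
  have hA : 0 ≤ N * (2 * c) := by positivity
  have hd0 : (0:ℝ) ≤ d := Nat.cast_nonneg d
  refine ⟨?_, ?_, ?_, ?_, fun p q => ?_⟩
  · nlinarith [mul_nonneg hA hρ0.le, mul_nonneg hB hρ0.le, mul_nonneg hd0 hρ0.le]
  · have e1 := (δ • shiftMap d).le_opNorm x
    have e2 := mul_le_mul_of_nonneg_right hSn (norm_nonneg x)
    have e3 : ‖w' x - w x‖ ≤ ρ + 13 * d * ρ * ‖x‖ := by
      have e4 := norm_sub_le (w' x - (w x - (δ • shiftMap d) x)) ((δ • shiftMap d) x)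
      rw [show w' x - (w x - (δ • shiftMap d) x) - (δ • shiftMap d) x = w' x - w x by abel] at e4
      linarith
    refine e3.trans ?_
    have hx0 := norm_nonneg x
    have t1 := mul_nonneg (mul_nonneg hA hρ0.le) (by linarith : 0 ≤ 1 + ‖x‖)
    have t2 := mul_nonneg (mul_nonneg hB hρ0.le) (by linarith : 0 ≤ 1 + ‖x‖)
    have t3 := mul_nonneg hd0 hρ0.le
    have t4 := mul_nonneg hρ0.le hx0
    nlinarith
  · nlinarith [mul_nonneg hA hρ0.le, mul_nonneg hB hρ0.le, mul_nonneg hd0 hρ0.le]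
  · obtain ⟨g, hg⟩ : ∃ g, g = ‖fderiv ℝ v x‖ := ⟨_, rfl⟩
    have hg0 : 0 ≤ g := by rw [hg]; positivity
    rw [← hg] at h4 ⊢
    have e3 : ‖fderiv ℝ w' x - fderiv ℝ w x‖
        ≤ N * (2 * (c * ρ) * (g + N * (2 * (c * ρ)) + 1) + (c * ρ) ^ 2) + ρ + 13 * d * ρ := by
      have e4 := norm_sub_le (fderiv ℝ w' x - (fderiv ℝ w x - δ • shiftMap d)) (δ • shiftMap d)
      rw [show fderiv ℝ w' x - (fderiv ℝ w x - δ • shiftMap d) - δ • shiftMap d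
        = fderiv ℝ w' x - fderiv ℝ w x by abel] at e4
      linarith
    refine e3.trans ?_
    have t1 : (c * ρ) ^ 2 ≤ c ^ 2 * ρ := by
      rw [mul_pow]
      exact mul_le_mul_of_nonneg_left (by nlinarith) (by positivity)
    have t2 : 2 * (c * ρ) * (g + N * (2 * (c * ρ)) + 1) ≤ 2 * (c * ρ) * (g + N * (2 * c) + 1) := by
      gcongr
      exact mul_le_of_le_one_right hc0 hρ1
    have t3 : N * (2 * (c * ρ) * (g + N * (2 * (c * ρ)) + 1) + (c * ρ) ^ 2)
        ≤ N * (2 * (c * ρ) * (g + N * (2 * c) + 1) + c ^ 2 * ρ) :=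
      mul_le_mul_of_nonneg_left (add_le_add t2 t1) hN0
    have t4 : N * (2 * (c * ρ) * (g + N * (2 * c) + 1) + c ^ 2 * ρ)
        ≤ N * (2 * c * (2 * N * c + 2) + c ^ 2) * ρ * (1 + g) := by
      have : N * (2 * c * (2 * N * c + 2) + c ^ 2) * ρ * (1 + g)
          - N * (2 * (c * ρ) * (g + N * (2 * c) + 1) + c ^ 2 * ρ)
          = N * ρ * (2 * c * (1 + g + 2 * N * c * g) + c ^ 2 * g) := by ring
      have : 0 ≤ N * ρ * (2 * c * (1 + g + 2 * N * c * g) + c ^ 2 * g) := by positivity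
      linarith
    have t5 : 0 ≤ N * (2 * c) * ρ * (1 + g) := by positivity
    have t6 : 0 ≤ ρ * g := by positivity
    have t7 : 0 ≤ d * ρ * g := by positivity
    nlinarith
  · have hsum : ∑ ι, a ι x ^ 2 / 4 * (sumForm ι.1 ι.2 (Pi.single p 1)
        * sumForm ι.1 ι.2 (Pi.single q 1)) = P x p q := by
      rw [← sum_primitiveCoeff (hPs x) p q]
      refine Finset.sum_congr rfl fun ι _ => ?_
      congr 1
      simp only [a]
      rw [Real.sq_sqrt (mul_pos four_pos (hb ι x).1).le]
      ring
    have e1 := (h5 p q).trans (min_le_left _ _)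
    rw [hsum, pullback_sub_shift] at e1
    have e2 := (hD₁D x p q).trans (min_le_left _ _)
    have hfin : ∀ X Y s z y : ℝ, |X - (Y - s) - (z + s)| ≤ ε / 2 → |z - y| ≤ ε / 2 →
        |X - (Y + y)| ≤ ε := fun X Y s z y h1 h2 => by
      have h1 := abs_le.1 h1
      have h2 := abs_le.1 h2
      rw [abs_le]
      constructor <;> linarith [h1.1, h1.2, h2.1, h2.2]
    exact hfin _ _ _ _ _ e1 e2

end Approximation

section Holder

variable {d : ℕ} {E : Type*} [NormedAddCommGroup E]

lemma isHolder_of_norm_le {f : (Fin d → ℝ) → E} {α H : ℝ} (hα : 0 ≤ α)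
    (h : ∀ x y, ‖f x - f y‖ ≤ H * ‖x - y‖ ^ α) : IsHolder α f := by
  refine ⟨H.toNNReal, fun x y => ?_⟩
  have h1 : dist (f x) (f y) ≤ H.toNNReal * dist x y ^ α := by
    rw [dist_eq_norm, dist_eq_norm]
    refine (h x y).trans ?_
    gcongr
    exact Real.le_coe_toNNReal H
  rw [edist_dist, edist_dist, Real.coe_toNNReal α hα,
    ENNReal.ofReal_rpow_of_nonneg dist_nonneg hα, ← ENNReal.ofReal_coe_nnreal,
    ← ENNReal.ofReal_mul (NNReal.coe_nonneg _)]
  exact ENNReal.ofReal_le_ofReal h1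

lemma isHolder_of_bounded {f : (Fin d → ℝ) → E} {α H B : ℝ} (hα : 0 ≤ α) (hH : 0 ≤ H)
    (hB : ∀ x, ‖f x‖ ≤ B)
    (h : ∀ x y, ‖x - y‖ ≤ 1 → ‖f x - f y‖ ≤ H * ‖x - y‖ ^ α) : IsHolder α f := by
  have hB0 : 0 ≤ B := (norm_nonneg _).trans (hB 0)
  refine isHolder_of_norm_le (H := H + 2 * B) hα fun x y => ?_
  have hr : 0 ≤ ‖x - y‖ ^ α := by positivity
  rcases le_total ‖x - y‖ 1 with h1 | h1
  · nlinarith [h x y h1]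
  · have h2 : 1 ≤ ‖x - y‖ ^ α := Real.one_le_rpow h1 hα
    have := (norm_sub_le (f x) (f y)).trans (add_le_add (hB x) (hB y))
    nlinarith

lemma IsHolder.exists_norm_le {f : (Fin d → ℝ) → E} {α : ℝ} (hα : 0 ≤ α) (hf : IsHolder α f) :
    ∃ H : ℝ, 0 ≤ H ∧ ∀ x y, ‖f x - f y‖ ≤ H * ‖x - y‖ ^ α := by
  obtain ⟨C, hC⟩ := hf
  refine ⟨C, C.2, fun x y => ?_⟩
  have := hC.dist_le x y
  rwa [dist_eq_norm, dist_eq_norm, Real.coe_toNNReal α hα] at this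

lemma IsHolder.uniformContinuous {f : (Fin d → ℝ) → E} {α : ℝ} (hα : 0 < α)
    (hf : IsHolder α f) : UniformContinuous f := by
  obtain ⟨C, hC⟩ := hf
  exact hC.uniformContinuous (Real.toNNReal_pos.2 hα)

lemma le_rpow_mul_rpow {t a b α : ℝ} (hα : 0 ≤ α) (hα1 : α ≤ 1) (ht : 0 ≤ t) (ha : t ≤ a)
    (hb : t ≤ b) : t ≤ a ^ (1 - α) * b ^ α := by
  rcases ht.eq_or_lt with rfl | ht
  · exact mul_nonneg (Real.rpow_nonneg ha _) (Real.rpow_nonneg hb _)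
  have ha0 : 0 ≤ a := ht.le.trans ha
  calc t = t ^ (1 - α) * t ^ α := by rw [← Real.rpow_add ht]; simp
    _ ≤ a ^ (1 - α) * b ^ α := by
      gcongr

end Holder

section Limit

open Filter Topology Metric

variable {d : ℕ} {F : Type*} [NormedAddCommGroup F] [NormedSpace ℝ F] [CompleteSpace F]

lemma exists_limit_on_ball {f : ℕ → (Fin d → ℝ) → F} {c : Fin d → ℝ} {ρ a h M m α : ℝ}
    (hρ : 0 < ρ) (ha : 0 ≤ a) (hM : 0 ≤ M) (hh : 0 < h) (hh1 : h ≤ 1 / 2) (hm : 1 ≤ m)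
    (hα : 0 < α) (hα1 : α < 1) (hq : h ^ (1 - α) * m ^ α < 1)
    (hf : ∀ n, ContDiff ℝ 2 (f n))
    (h0 : ∀ n, ∀ x ∈ closedBall c ρ, ‖f (n + 1) x - f n x‖ ≤ a * h ^ n)
    (h1 : ∀ n, ∀ x ∈ closedBall c ρ, ‖fderiv ℝ (f (n + 1)) x - fderiv ℝ (f n) x‖ ≤ a * h ^ n)
    (h2 : ∀ n, ∀ x ∈ closedBall c ρ, ‖fderiv ℝ (fderiv ℝ (f n)) x‖ ≤ M * m ^ n) :
    ∃ (g : (Fin d → ℝ) → F) (P : (Fin d → ℝ) → (Fin d → ℝ) →L[ℝ] F) (H B : ℝ), 0 ≤ H ∧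
      (∀ x ∈ closedBall c ρ, Tendsto (fun n => f n x) atTop (𝓝 (g x))) ∧
      (∀ x ∈ closedBall c ρ, Tendsto (fun n => fderiv ℝ (f n) x) atTop (𝓝 (P x))) ∧
      (∀ x ∈ ball c ρ, HasFDerivAt g (P x) x) ∧
      (∀ x ∈ closedBall c ρ, ‖P x‖ ≤ B) ∧
      ∀ x ∈ closedBall c ρ, ∀ y ∈ closedBall c ρ, ‖P x - P y‖ ≤ H * ‖x - y‖ ^ α := by
  have hlt : h < 1 := by linarith
  have hd0 : ∀ x ∈ closedBall c ρ, ∀ n, dist (f n x) (f (n + 1) x) ≤ a * h ^ n :=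
    fun x hx n => by rw [dist_comm, dist_eq_norm]; exact h0 n x hx
  have hd1 : ∀ x ∈ closedBall c ρ, ∀ n,
      dist (fderiv ℝ (f n) x) (fderiv ℝ (f (n + 1)) x) ≤ a * h ^ n :=
    fun x hx n => by rw [dist_comm, dist_eq_norm]; exact h1 n x hx
  have e0 : ∀ x ∈ closedBall c ρ, ∃ l, Tendsto (fun n => f n x) atTop (𝓝 l) := fun x hx =>
    cauchySeq_tendsto_of_complete (cauchySeq_of_le_geometric h a hlt (hd0 x hx))
  have e1 : ∀ x ∈ closedBall c ρ, ∃ l, Tendsto (fun n => fderiv ℝ (f n) x) atTop (𝓝 l) :=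
    fun x hx => cauchySeq_tendsto_of_complete (cauchySeq_of_le_geometric h a hlt (hd1 x hx))
  choose! g hg using e0
  choose! P hP using e1
  have hdiff : ∀ n, Differentiable ℝ (fderiv ℝ (f n)) := fun n =>
    ((hf n).fderiv_right (m := 1) (by norm_num)).differentiable one_ne_zero
  have hlip : ∀ n, ∀ x ∈ closedBall c ρ, ∀ y ∈ closedBall c ρ,
      ‖fderiv ℝ (f n) x - fderiv ℝ (f n) y‖ ≤ M * m ^ n * ‖x - y‖ := fun n x hx y hy =>
    (convex_closedBall c ρ).norm_image_sub_le_of_norm_fderiv_le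
      (fun z _ => hdiff n z) (h2 n) hy hx
  obtain ⟨B₀, hB₀⟩ := (isCompact_closedBall c ρ).exists_bound_of_continuousOn
    ((hf 0).continuous_fderiv two_ne_zero).continuousOn
  set q := h ^ (1 - α) * m ^ α with hqdef
  have hm0 : 0 < m := by linarith
  have hq0 : 0 < q := by positivity
  set S := (2 * a) ^ (1 - α) * (2 * M * m) ^ α with hS
  have hS0 : 0 ≤ S := by positivity
  refine ⟨g, P, M * (2 * ρ) ^ (1 - α) + S / (1 - q), B₀ + a / (1 - h), ?_, hg, hP, ?_, ?_, ?_⟩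
  · have : 0 < 1 - q := by linarith
    positivity
  · intro x hx
    have hgeom : Tendsto (fun n => a * h ^ n / (1 - h)) atTop (𝓝 0) := by
      have := ((tendsto_pow_atTop_nhds_zero_of_lt_one hh.le hlt).const_mul a).div_const (1 - h)
      simpa using this
    refine hasFDerivAt_of_tendstoUniformlyOn (f := f) (f' := fun n x => fderiv ℝ (f n) x)
      isOpen_ball ?_ (fun n y _ => ((hf n).differentiable two_ne_zero y).hasFDerivAt)
      (fun y hy => hg y (ball_subset_closedBall hy)) hx
    rw [Metric.tendstoUniformlyOn_iff]
    intro ε hε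
    filter_upwards [hgeom.eventually (gt_mem_nhds hε)] with n hn y hy
    rw [dist_comm]
    exact (dist_le_of_le_geometric_of_tendsto h a hlt (hd1 y (ball_subset_closedBall hy))
      (hP y (ball_subset_closedBall hy)) n).trans_lt hn
  · intro x hx
    have := dist_le_of_le_geometric_of_tendsto₀ h a hlt (hd1 x hx) (hP x hx)
    rw [dist_comm, dist_eq_norm] at this
    have h3 := norm_add_le (fderiv ℝ (f 0) x) (P x - fderiv ℝ (f 0) x)
    rw [add_sub_cancel] at h3
    linarith [hB₀ x hx]
  · intro x hx y hy
    have hr : 0 ≤ ‖x - y‖ := norm_nonneg _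
    have hr2 : ‖x - y‖ ≤ 2 * ρ := by
      rw [← dist_eq_norm]
      linarith [dist_triangle_right x y c, mem_closedBall.1 hx, mem_closedBall.1 hy]
    have hstep : ∀ n, dist (fderiv ℝ (f n) x - fderiv ℝ (f n) y)
        (fderiv ℝ (f (n + 1)) x - fderiv ℝ (f (n + 1)) y) ≤ S * ‖x - y‖ ^ α * q ^ n := by
      intro n
      rw [dist_comm, dist_eq_norm]
      have b1 : ‖fderiv ℝ (f (n + 1)) x - fderiv ℝ (f (n + 1)) y
          - (fderiv ℝ (f n) x - fderiv ℝ (f n) y)‖ ≤ 2 * a * h ^ n := by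
        have := norm_sub_le (fderiv ℝ (f (n + 1)) x - fderiv ℝ (f n) x)
          (fderiv ℝ (f (n + 1)) y - fderiv ℝ (f n) y)
        rw [sub_sub_sub_comm]
        linarith [h1 n x hx, h1 n y hy]
      have b2 : ‖fderiv ℝ (f (n + 1)) x - fderiv ℝ (f (n + 1)) y
          - (fderiv ℝ (f n) x - fderiv ℝ (f n) y)‖ ≤ 2 * M * m * m ^ n * ‖x - y‖ := by
        have b3 := norm_sub_le (fderiv ℝ (f (n + 1)) x - fderiv ℝ (f (n + 1)) y)
          (fderiv ℝ (f n) x - fderiv ℝ (f n) y)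
        have b4 := hlip (n + 1) x hx y hy
        have b5 := hlip n x hx y hy
        have b6 : M * m ^ n * ‖x - y‖ ≤ M * m ^ (n + 1) * ‖x - y‖ := by
          gcongr
          omega
        have b7 : M * m ^ (n + 1) * ‖x - y‖ = M * m * m ^ n * ‖x - y‖ := by ring
        linarith
      refine (le_rpow_mul_rpow hα.le hα1.le (norm_nonneg _) b1 b2).trans_eq ?_
      have c1 : (2 * a * h ^ n) ^ (1 - α) = (2 * a) ^ (1 - α) * (h ^ (1 - α)) ^ n := by
        rw [Real.mul_rpow (by positivity) (by positivity), Real.rpow_pow_comm hh.le]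
      have c2 : (2 * M * m * m ^ n * ‖x - y‖) ^ α
          = (2 * M * m) ^ α * (m ^ α) ^ n * ‖x - y‖ ^ α := by
        rw [Real.mul_rpow (by positivity) hr, Real.mul_rpow (by positivity) (by positivity),
          Real.rpow_pow_comm hm0.le]
      rw [c1, c2, hS, hqdef, mul_pow]
      ring
    have hlim := dist_le_of_le_geometric_of_tendsto₀ q (S * ‖x - y‖ ^ α) hq hstep
      ((hP x hx).sub (hP y hy))
    rw [dist_comm, dist_eq_norm] at hlim
    have h3 := norm_add_le (fderiv ℝ (f 0) x - fderiv ℝ (f 0) y)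
      (P x - P y - (fderiv ℝ (f 0) x - fderiv ℝ (f 0) y))
    rw [add_sub_cancel] at h3
    have h4 := hlip 0 x hx y hy
    have h5 : ‖x - y‖ ≤ (2 * ρ) ^ (1 - α) * ‖x - y‖ ^ α :=
      le_rpow_mul_rpow hα.le hα1.le hr hr2 le_rfl
    have h6 : M * ‖x - y‖ ≤ M * ((2 * ρ) ^ (1 - α) * ‖x - y‖ ^ α) := by gcongr
    rw [pow_zero, mul_one] at h4
    have h7 : S * ‖x - y‖ ^ α / (1 - q) = S / (1 - q) * ‖x - y‖ ^ α := by ring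
    rw [h7] at hlim
    nlinarith

/-- A smooth map squeezing the whole space into `ball c ρ`, equal to the identity near
`closedBall c (ρ / 2)`. -/
lemma exists_squeeze (c : Fin d → ℝ) {ρ : ℝ} (hρ : 0 < ρ) :
    ∃ (ψ : (Fin d → ℝ) → Fin d → ℝ) (L : ℝ), 0 ≤ L ∧ ContDiff ℝ 2 ψ ∧ (∀ x, ψ x ∈ ball c ρ) ∧
      (∀ x ∈ closedBall c (ρ / 2), ψ =ᶠ[𝓝 x] id) ∧ (∀ x, ‖fderiv ℝ ψ x‖ ≤ L) ∧
      (∀ x y, ‖ψ x - ψ y‖ ≤ L * ‖x - y‖) ∧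
      ∀ x y, ‖fderiv ℝ ψ x - fderiv ℝ ψ y‖ ≤ L * ‖x - y‖ := by
  let χ : ContDiffBump c := ⟨3 * ρ / 4, ρ, by positivity, by linarith⟩
  let θ : (Fin d → ℝ) → Fin d → ℝ := fun x => χ x • (x - c)
  have hθ : ContDiff ℝ 2 θ := χ.contDiff.smul (contDiff_id.sub contDiff_const)
  have hθc : HasCompactSupport θ := χ.hasCompactSupport.smul_right
  have hθ' : ContDiff ℝ 1 (fderiv ℝ θ) := hθ.fderiv_right (by norm_num)
  obtain ⟨L₁, hL₁⟩ := (hθ.of_le one_le_two).lipschitzWith_of_hasCompactSupport hθc one_ne_zero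
  obtain ⟨L₂, hL₂⟩ := hθ'.lipschitzWith_of_hasCompactSupport (hθc.fderiv ℝ) one_ne_zero
  have hfd : ∀ x, fderiv ℝ (fun x => c + θ x) x = fderiv ℝ θ x := fun x => fderiv_const_add c
  refine ⟨fun x => c + θ x, max L₁ L₂, le_max_of_le_left L₁.2, contDiff_const.add hθ, ?_, ?_, ?_,
    ?_, ?_⟩
  · intro x
    rw [mem_ball_iff_norm, add_sub_cancel_left, norm_smul, Real.norm_eq_abs,
      abs_of_nonneg χ.nonneg]
    by_cases hx : x ∈ ball c ρ
    · rw [mem_ball_iff_norm] at hx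
      nlinarith [χ.le_one (x := x), norm_nonneg (x - c), χ.nonneg (x := x)]
    · have : χ x = 0 := χ.zero_of_le_dist (by simpa using hx)
      rw [this, zero_mul]
      exact hρ
  · intro x hx
    have : x ∈ ball c χ.rIn := by
      rw [mem_closedBall] at hx
      rw [mem_ball]
      change _ < 3 * ρ / 4
      linarith
    filter_upwards [χ.eventuallyEq_one_of_mem_ball this] with y hy
    simp [θ, hy]
  · intro x
    rw [hfd]
    exact (norm_fderiv_le_of_lipschitz ℝ hL₁).trans (le_max_left _ _)
  · intro x y
    rw [add_sub_add_left_eq_sub]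
    refine (hL₁.norm_sub_le x y).trans ?_
    gcongr
    exact le_max_left _ _
  · intro x y
    rw [hfd, hfd]
    refine (hL₂.norm_sub_le x y).trans ?_
    gcongr
    exact le_max_right _ _

lemma exists_isC1Holder_limit {f : ℕ → (Fin d → ℝ) → F} {c : Fin d → ℝ} {ρ a h M m α : ℝ}
    (hρ : 0 < ρ) (ha : 0 ≤ a) (hM : 0 ≤ M) (hh : 0 < h) (hh1 : h ≤ 1 / 2) (hm : 1 ≤ m)
    (hα : 0 < α) (hα1 : α < 1) (hq : h ^ (1 - α) * m ^ α < 1)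
    (hf : ∀ n, ContDiff ℝ 2 (f n))
    (h0 : ∀ n, ∀ x ∈ closedBall c ρ, ‖f (n + 1) x - f n x‖ ≤ a * h ^ n)
    (h1 : ∀ n, ∀ x ∈ closedBall c ρ, ‖fderiv ℝ (f (n + 1)) x - fderiv ℝ (f n) x‖ ≤ a * h ^ n)
    (h2 : ∀ n, ∀ x ∈ closedBall c ρ, ‖fderiv ℝ (fderiv ℝ (f n)) x‖ ≤ M * m ^ n) :
    ∃ g : (Fin d → ℝ) → F, IsC1Holder α g ∧ ∀ x ∈ closedBall c (ρ / 2),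
      Tendsto (fun n => f n x) atTop (𝓝 (g x)) ∧
      Tendsto (fun n => fderiv ℝ (f n) x) atTop (𝓝 (fderiv ℝ g x)) ∧
      ‖g x - f 0 x‖ ≤ 2 * a ∧ ‖fderiv ℝ g x - fderiv ℝ (f 0) x‖ ≤ 2 * a := by
  obtain ⟨g, P, H, B, hH, hg, hP, hgP, hB, hPH⟩ :=
    exists_limit_on_ball hρ ha hM hh hh1 hm hα hα1 hq hf h0 h1 h2
  obtain ⟨ψ, L, hL, hψ, hψb, hψid, hψL, hψlip, hψlip'⟩ := exists_squeeze c hρ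
  have hψc : ∀ x, ψ x ∈ closedBall c ρ := fun x => ball_subset_closedBall (hψb x)
  have hder : ∀ x, HasFDerivAt (g ∘ ψ) ((P (ψ x)).comp (fderiv ℝ ψ x)) x := fun x =>
    (hgP _ (hψb x)).comp x (hψ.differentiable two_ne_zero x).hasFDerivAt
  have hfd : fderiv ℝ (g ∘ ψ) = fun x => (P (ψ x)).comp (fderiv ℝ ψ x) :=
    funext fun x => (hder x).fderiv
  have hB0 : 0 ≤ B := (norm_nonneg _).trans (hB _ (hψc c))
  have hHol : IsHolder α (fderiv ℝ (g ∘ ψ)) := by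
    rw [hfd]
    refine isHolder_of_bounded (H := H * L ^ α * L + B * L) (B := B * L) hα.le (by positivity)
      (fun x => ?_) fun x y hxy => ?_
    · exact (ContinuousLinearMap.opNorm_comp_le _ _).trans
        (mul_le_mul (hB _ (hψc x)) (hψL x) (norm_nonneg _) hB0)
    · have e : (P (ψ x)).comp (fderiv ℝ ψ x) - (P (ψ y)).comp (fderiv ℝ ψ y)
          = (P (ψ x) - P (ψ y)).comp (fderiv ℝ ψ x)
            + (P (ψ y)).comp (fderiv ℝ ψ x - fderiv ℝ ψ y) := by
        rw [ContinuousLinearMap.sub_comp, ContinuousLinearMap.comp_sub]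
        abel
      have hrα : ‖x - y‖ ≤ ‖x - y‖ ^ α := by
        simpa using le_rpow_mul_rpow hα.le hα1.le (norm_nonneg (x - y)) hxy le_rfl
      have e1 : ‖P (ψ x) - P (ψ y)‖ ≤ H * L ^ α * ‖x - y‖ ^ α := by
        refine (hPH _ (hψc x) _ (hψc y)).trans ?_
        rw [mul_assoc, ← Real.mul_rpow hL (norm_nonneg _)]
        gcongr
        exact hψlip x y
      have e2 : ‖fderiv ℝ ψ x - fderiv ℝ ψ y‖ ≤ L * ‖x - y‖ ^ α :=
        (hψlip' x y).trans (by gcongr)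
      rw [e]
      refine (norm_add_le _ _).trans ?_
      have e3 := (ContinuousLinearMap.opNorm_comp_le (P (ψ x) - P (ψ y)) (fderiv ℝ ψ x)).trans
        (mul_le_mul e1 (hψL x) (norm_nonneg _) (by positivity))
      have e4 := (ContinuousLinearMap.opNorm_comp_le (P (ψ y))
        (fderiv ℝ ψ x - fderiv ℝ ψ y)).trans
        (mul_le_mul (hB _ (hψc y)) e2 (norm_nonneg _) hB0)
      linarith
  have hsub : closedBall c (ρ / 2) ⊆ closedBall c ρ := closedBall_subset_closedBall (by linarith)
  refine ⟨g ∘ ψ, ⟨contDiff_one_iff_hasFDerivAt.2 ⟨_, ?_, hder⟩, hHol⟩, fun x hx => ?_⟩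
  · rw [← hfd]
    exact (hHol.uniformContinuous hα).continuous
  have hid := hψid x hx
  have hx1 : ψ x = x := hid.eq_of_nhds
  have hx2 : fderiv ℝ (g ∘ ψ) x = P x := by
    rw [hfd]
    simp only [hx1, hid.fderiv_eq, fderiv_id]
    rfl
  have hlt : h < 1 := by linarith
  have hfin : a / (1 - h) ≤ 2 * a := by
    rw [div_le_iff₀ (by linarith)]
    nlinarith
  have hxρ := hsub hx
  rw [Function.comp_apply, hx1, hx2]
  refine ⟨hg x hxρ, hP x hxρ, ?_, ?_⟩
  · have := dist_le_of_le_geometric_of_tendsto₀ h a hlt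
      (fun n => by rw [dist_comm, dist_eq_norm]; exact h0 n x hxρ) (hg x hxρ)
    rw [dist_comm, dist_eq_norm] at this
    exact this.trans hfin
  · have := dist_le_of_le_geometric_of_tendsto₀ h a hlt
      (fun n => by rw [dist_comm, dist_eq_norm]; exact h1 n x hxρ) (hP x hxρ)
    rw [dist_comm, dist_eq_norm] at this
    exact this.trans hfin

end Limit

section Stage

open Filter Topology

variable {d k : ℕ} {ω : Set (Fin d → ℝ)}

/-- The stage property on `ω`, with exponent `γ`, threshold `σ₀` and constant `C`. -/
def StageProperty (k : ℕ) (ω : Set (Fin d → ℝ)) (γ σ₀ C : ℝ) : Prop :=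
  ∀ (v : (Fin d → ℝ) → Fin k → ℝ) (w : (Fin d → ℝ) → Fin d → ℝ)
    (A : (Fin d → ℝ) → Fin d → Fin d → ℝ) (β : ℝ),
    0 < β → β ≤ 1 →
    ContDiff ℝ 2 v → ContDiff ℝ 2 w →
    IsHolder β A → (∀ x i j, A x i j = A x j i) →
    0 < supNorm ω (deficit A v w) → supNorm ω (deficit A v w) ≤ 1 →
    ∀ M σ : ℝ,
      max (max (C2Norm ω v) (C2Norm ω w)) 1 ≤ M → σ₀ < σ →
      ∃ (vt : (Fin d → ℝ) → Fin k → ℝ) (wt : (Fin d → ℝ) → Fin d → ℝ),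
        ContDiff ℝ 2 vt ∧ ContDiff ℝ 2 wt ∧
        C1Norm ω (fun x => vt x - v x)
            ≤ C * supNorm ω (deficit A v w) ^ (1/2 : ℝ) ∧
        C1Norm ω (fun x => wt x - w x)
            ≤ C * supNorm ω (deficit A v w) ^ (1/2 : ℝ) * (1 + grad1Norm ω v) ∧
        grad2Norm ω vt ≤ C * M * σ ^ γ ∧
        grad2Norm ω wt ≤ C * M * σ ^ γ * (1 + grad1Norm ω v) ∧
        supNorm ω (deficit A vt wt)
            ≤ C * (holderNorm β ω A * M ^ (-β)
                    * supNorm ω (deficit A v w) ^ (β / 2)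
                  + supNorm ω (deficit A v w) / σ)

lemma holderNorm_nonneg {E : Type*} [NormedAddCommGroup E] (β : ℝ) (f : (Fin d → ℝ) → E) :
    0 ≤ holderNorm β ω f :=
  add_nonneg (supNorm_nonneg f) (Real.iSup_nonneg fun _ => by positivity)

lemma C1Norm_sub_self {E : Type*} [NormedAddCommGroup E] [NormedSpace ℝ E]
    (f : (Fin d → ℝ) → E) : C1Norm ω (fun x => f x - f x) = 0 := by
  simp [C1Norm, supNorm, grad1Norm]

lemma StageProperty.mono {γ σ₀ C C' : ℝ} (hS : StageProperty k ω γ σ₀ C) (hσ₀ : 0 ≤ σ₀)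
    (hC : C ≤ C') : StageProperty k ω γ σ₀ C' := by
  intro v w A β hβ hβ1 hv hw hA hAs h0 h1 M σ hM hσ
  obtain ⟨vt, wt, hvt, hwt, e1, e2, e3, e4, e5⟩ :=
    hS v w A β hβ hβ1 hv hw hA hAs h0 h1 M σ hM hσ
  have hM0 : 0 ≤ M := zero_le_one.trans ((le_max_right _ _).trans hM)
  have hσ0 : 0 ≤ σ := hσ₀.trans hσ.le
  have hg := grad1Norm_nonneg (ω := ω) v
  have hH := holderNorm_nonneg (ω := ω) β A
  exact ⟨vt, wt, hvt, hwt, e1.trans (by gcongr), e2.trans (by gcongr), e3.trans (by gcongr),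
    e4.trans (by gcongr), e5.trans (by gcongr)⟩

/-- A stage in which only an upper bound of the deficit is prescribed. -/
lemma StageProperty.exists_step {γ σ₀ C : ℝ} (hS : StageProperty k ω γ σ₀ C) (hγ : 0 < γ)
    (hC : 1 ≤ C) {v : (Fin d → ℝ) → Fin k → ℝ} {w : (Fin d → ℝ) → Fin d → ℝ}
    {A : (Fin d → ℝ) → Fin d → Fin d → ℝ} {β δ M σ : ℝ} (hβ : 0 < β) (hβ1 : β ≤ 1)
    (hv : ContDiff ℝ 2 v) (hw : ContDiff ℝ 2 w) (hA : IsHolder β A)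
    (hAs : ∀ x i j, A x i j = A x j i) (hδ : 0 ≤ δ) (hδ1 : δ ≤ 1)
    (hdef : supNorm ω (deficit A v w) ≤ δ) (hMv : C2Norm ω v ≤ M) (hMw : C2Norm ω w ≤ M)
    (hM : 1 ≤ M) (hσ₀ : σ₀ < σ) (hσ : 1 ≤ σ) :
    ∃ (vt : (Fin d → ℝ) → Fin k → ℝ) (wt : (Fin d → ℝ) → Fin d → ℝ),
      ContDiff ℝ 2 vt ∧ ContDiff ℝ 2 wt ∧
      C1Norm ω (fun x => vt x - v x) ≤ C * √δ ∧
      C1Norm ω (fun x => wt x - w x) ≤ C * √δ * (1 + grad1Norm ω v) ∧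
      grad2Norm ω vt ≤ C * M * σ ^ γ * (1 + grad1Norm ω v) ∧
      grad2Norm ω wt ≤ C * M * σ ^ γ * (1 + grad1Norm ω v) ∧
      supNorm ω (deficit A vt wt)
        ≤ C * (holderNorm β ω A * M ^ (-β) * δ ^ (β / 2) + δ / σ) := by
  have hg : 0 ≤ grad1Norm ω v := grad1Norm_nonneg v
  have hH := holderNorm_nonneg (ω := ω) β A
  have hσγ : 1 ≤ σ ^ γ := Real.one_le_rpow hσ hγ.le
  have hM0 : 0 ≤ M := by linarith
  have hC0 : 0 ≤ C := by linarith
  rcases (supNorm_nonneg (ω := ω) (deficit A v w)).eq_or_lt with h0 | h0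
  · have hgrow : M ≤ C * M * σ ^ γ * (1 + grad1Norm ω v) := by
      have h1 : M ≤ C * M := le_mul_of_one_le_left hM0 hC
      have h2 : C * M ≤ C * M * σ ^ γ := le_mul_of_one_le_right (by positivity) hσγ
      have h3 := le_mul_of_one_le_right (b := 1 + grad1Norm ω v)
        (by positivity : 0 ≤ C * M * σ ^ γ) (by linarith)
      linarith
    refine ⟨v, w, hv, hw, ?_, ?_, ?_, ?_, ?_⟩
    · rw [C1Norm_sub_self]
      positivity
    · rw [C1Norm_sub_self]
      positivity
    · have := C1Norm_nonneg (ω := ω) v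
      unfold C1Norm at this
      unfold C2Norm at hMv
      linarith
    · have := C1Norm_nonneg (ω := ω) w
      unfold C1Norm at this
      unfold C2Norm at hMw
      linarith
    · rw [← h0]
      positivity
  · obtain ⟨vt, wt, hvt, hwt, h1, h2, h3, h4, h5⟩ := hS v w A β hβ hβ1 hv hw hA hAs h0
      (hdef.trans hδ1) M σ (max_le (max_le hMv hMw) hM) hσ₀
    rw [← Real.sqrt_eq_rpow] at h1 h2
    have hsq : √(supNorm ω (deficit A v w)) ≤ √δ := Real.sqrt_le_sqrt hdef
    refine ⟨vt, wt, hvt, hwt, h1.trans (by gcongr), h2.trans (by gcongr), h3.trans ?_, h4,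
      h5.trans (by gcongr)⟩
    exact le_mul_of_one_le_right (by positivity) (by linarith)

lemma exists_frequency {β γ α C K σ₀ : ℝ} (hβ : 0 < β) (hβ1 : β ≤ 1) (hγ : 0 < γ)
    (hα : α < min (β / 2) (1 / (1 + 2 * γ))) (hC : 1 ≤ C) (hK : 1 ≤ K) :
    ∃ σ h : ℝ, σ₀ < σ ∧ 1 ≤ σ ∧ 0 < h ∧ h ≤ 1 / 2 ∧ 2 * C / σ ≤ h ^ 2 ∧
      h ^ (1 - α) * (K * σ ^ γ) ^ α < 1 ∧ 1 ≤ (K * σ ^ γ) ^ β * (h ^ 2) ^ (1 - β / 2) := by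
  set κ := min (β / 2) (1 / (1 + 2 * γ)) with hκ
  have hκβ : κ ≤ β / 2 := min_le_left _ _
  have hκγ : κ * (1 + 2 * γ) ≤ 1 := by
    rw [← le_div_iff₀ (by linarith)]
    exact min_le_right _ _
  have hκ0 : 0 < κ := lt_min (by linarith) (by positivity)
  have hκ1 : 0 < 1 - κ := by linarith
  set s := 2 * γ * κ / (1 - κ) with hs
  have hsκ : s * (1 - κ) = 2 * γ * κ := div_mul_cancel₀ _ hκ1.ne'
  have hs0 : 0 < s := by positivity
  have hs1 : s ≤ 1 := by
    rw [hs, div_le_one hκ1]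
    linarith
  set B := √(2 * C) with hB
  have hB0 : 0 < B := Real.sqrt_pos.2 (by linarith)
  have hB2 : B ^ 2 = 2 * C := Real.sq_sqrt (by linarith)
  have hexp : 0 < s / 2 * (1 - α) - γ * α := by
    have : 0 < (s / 2 * (1 - α) - γ * α) * (1 - κ) := by
      have : (s / 2 * (1 - α) - γ * α) * (1 - κ) = γ * (κ - α) := by
        linear_combination (1 - α) / 2 * hsκ
      rw [this]
      exact mul_pos hγ (by linarith)
    exact pos_of_mul_pos_left this hκ1.le
  have hexp2 : 0 ≤ γ * β - s * (1 - β / 2) := by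
    have : 0 ≤ (γ * β - s * (1 - β / 2)) * (1 - κ) := by
      have : (γ * β - s * (1 - β / 2)) * (1 - κ) = 2 * γ * (β / 2 - κ) := by
        linear_combination - (1 - β / 2) * hsκ
      rw [this]
      exact mul_nonneg (by linarith) (by linarith)
    exact nonneg_of_mul_nonneg_left this hκ1
  have t1 : Tendsto (fun σ : ℝ => B * σ ^ (-(s / 2))) atTop (𝓝 0) := by
    simpa using (tendsto_rpow_neg_atTop (by positivity : 0 < s / 2)).const_mul B
  have t2 : Tendsto (fun σ : ℝ => B ^ (1 - α) * K ^ α * σ ^ (-(s / 2 * (1 - α) - γ * α)))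
      atTop (𝓝 0) := by
    simpa using (tendsto_rpow_neg_atTop hexp).const_mul (B ^ (1 - α) * K ^ α)
  obtain ⟨σ, h1, h2, h3, h4⟩ := ((t1.eventually (gt_mem_nhds one_half_pos)).and
    ((t2.eventually (gt_mem_nhds one_pos)).and
      ((eventually_gt_atTop σ₀).and (eventually_ge_atTop 1)))).exists
  have hσ0 : 0 < σ := by linarith
  have hK0 : 0 < K := by linarith
  have hsq : (B * σ ^ (-(s / 2))) ^ 2 = 2 * C * σ ^ (-s) := by
    rw [mul_pow, hB2, ← Real.rpow_mul_natCast hσ0.le]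
    congr 2
    push_cast
    ring
  refine ⟨σ, B * σ ^ (-(s / 2)), h3, h4, by positivity, h1.le, ?_, ?_, ?_⟩
  · rw [hsq, div_eq_mul_inv, ← Real.rpow_neg_one]
    gcongr
  · refine lt_of_eq_of_lt ?_ h2
    rw [Real.mul_rpow hB0.le (by positivity), Real.mul_rpow hK0.le (by positivity),
      ← Real.rpow_mul hσ0.le, ← Real.rpow_mul hσ0.le, mul_mul_mul_comm,
      ← Real.rpow_add hσ0]
    congr 2
    ring
  · rw [hsq, Real.mul_rpow hK0.le (by positivity), Real.mul_rpow (by linarith) (by positivity),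
      ← Real.rpow_mul hσ0.le, ← Real.rpow_mul hσ0.le, mul_mul_mul_comm, ← Real.rpow_add hσ0]
    have e1 : 1 ≤ K ^ β := Real.one_le_rpow hK hβ.le
    have e2 : 1 ≤ (2 * C) ^ (1 - β / 2) := Real.one_le_rpow (by linarith) (by linarith)
    have e3 : 1 ≤ σ ^ (γ * β + -s * (1 - β / 2)) := Real.one_le_rpow h4 (by linarith)
    exact one_le_mul_of_one_le_of_one_le (one_le_mul_of_one_le_of_one_le e1 e2) e3

/-- The bounds propagated along the iteration of stages. -/
structure StageBounds (ω : Set (Fin d → ℝ)) (A : (Fin d → ℝ) → Fin d → Fin d → ℝ)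
    (C g₀ b δ h M m : ℝ) (n : ℕ)
    (p : ((Fin d → ℝ) → Fin k → ℝ) × ((Fin d → ℝ) → Fin d → ℝ)) : Prop where
  contDiff_fst : ContDiff ℝ 2 p.1
  contDiff_snd : ContDiff ℝ 2 p.2
  deficit_le : supNorm ω (deficit A p.1 p.2) ≤ δ * (h ^ n) ^ 2
  C2Norm_fst_le : C2Norm ω p.1 ≤ M * m ^ n
  C2Norm_snd_le : C2Norm ω p.2 ≤ M * m ^ n
  grad1Norm_le : grad1Norm ω p.1 ≤ g₀ + 2 * C * (1 - (1 / 2) ^ n)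
  C1Norm_fst_le : C1Norm ω p.1 ≤ b + 2 * C * (1 + g₀ + 2 * C) * (1 - (1 / 2) ^ n)
  C1Norm_snd_le : C1Norm ω p.2 ≤ b + 2 * C * (1 + g₀ + 2 * C) * (1 - (1 / 2) ^ n)

lemma C2Norm_eq {E : Type*} [NormedAddCommGroup E] [NormedSpace ℝ E]
    (f : (Fin d → ℝ) → E) : C2Norm ω f = C1Norm ω f + grad2Norm ω f := rfl

lemma stage_deficit_le {C H M m δ h σ β : ℝ} (hM : 0 < M) (hm : 0 < m)
    (hh : 0 < h) (hδ : 0 < δ) (hhσ : 2 * C / σ ≤ h ^ 2)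
    (hmh : 1 ≤ m ^ β * (h ^ 2) ^ (1 - β / 2))
    (hHM : 2 * C * H ≤ h ^ 2 * (M ^ β * δ ^ (1 - β / 2))) (n : ℕ) :
    C * (H * (M * m ^ n) ^ (-β) * (δ * (h ^ n) ^ 2) ^ (β / 2) + δ * (h ^ n) ^ 2 / σ)
      ≤ δ * (h ^ (n + 1)) ^ 2 := by
  have j1 : δ * (h ^ n) ^ 2 / σ * (2 * C) ≤ δ * (h ^ n) ^ 2 * h ^ 2 := by
    calc _ = δ * (h ^ n) ^ 2 * (2 * C / σ) := by ring
      _ ≤ _ := by gcongr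
  have j2 : 2 * C * H ≤ h ^ 2 * ((M * m ^ n) ^ β * (δ * (h ^ n) ^ 2) ^ (1 - β / 2)) := by
    refine hHM.trans ?_
    have i1 : (M * m ^ n) ^ β * (δ * (h ^ n) ^ 2) ^ (1 - β / 2)
        = M ^ β * δ ^ (1 - β / 2) * (m ^ β * (h ^ 2) ^ (1 - β / 2)) ^ n := by
      rw [Real.mul_rpow hM.le (by positivity), Real.mul_rpow hδ.le (by positivity),
        mul_pow, Real.rpow_pow_comm hm.le, Real.rpow_pow_comm (by positivity), pow_right_comm]
      ring
    rw [i1]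
    refine mul_le_mul_of_nonneg_left ?_ (by positivity)
    exact le_mul_of_one_le_right (by positivity) (one_le_pow₀ hmh)
  have hX : 0 < M * m ^ n := by positivity
  have hY : 0 < δ * (h ^ n) ^ 2 := by positivity
  have j3 : 2 * C * (H * (M * m ^ n) ^ (-β) * (δ * (h ^ n) ^ 2) ^ (β / 2))
      ≤ h ^ 2 * (δ * (h ^ n) ^ 2) := by
    calc _ = 2 * C * H * ((M * m ^ n) ^ (-β) * (δ * (h ^ n) ^ 2) ^ (β / 2)) := by ring
      _ ≤ h ^ 2 * ((M * m ^ n) ^ β * (δ * (h ^ n) ^ 2) ^ (1 - β / 2))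
          * ((M * m ^ n) ^ (-β) * (δ * (h ^ n) ^ 2) ^ (β / 2)) := by gcongr
      _ = h ^ 2 * (((M * m ^ n) ^ β * (M * m ^ n) ^ (-β))
          * ((δ * (h ^ n) ^ 2) ^ (1 - β / 2) * (δ * (h ^ n) ^ 2) ^ (β / 2))) := by ring
      _ = _ := by
        rw [← Real.rpow_add hX, ← Real.rpow_add hY]
        simp
  have j4 : (h ^ (n + 1)) ^ 2 = (h ^ n) ^ 2 * h ^ 2 := by ring
  rw [j4]
  linarith

lemma StageProperty.exists_bounds_succ {γ σ₀ C : ℝ} (hS : StageProperty k ω γ σ₀ C) (hγ : 0 < γ)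
    (hb : Bornology.IsBounded ω) (hC : 1 ≤ C) {A : (Fin d → ℝ) → Fin d → Fin d → ℝ}
    {β δ M σ g₀ b h : ℝ} (hβ : 0 < β) (hβ1 : β ≤ 1)
    (hA : IsHolder β A) (hAs : ∀ x i j, A x i j = A x j i) (hδ : 0 < δ) (hδ1 : δ ≤ 1)
    (hM : 1 ≤ M) (hσ₀ : σ₀ < σ) (hσ : 1 ≤ σ) (hg₀ : 0 ≤ g₀)
    (hh : 0 < h) (hh1 : h ≤ 1 / 2) (hhσ : 2 * C / σ ≤ h ^ 2)
    (hbM : b + 2 * C * (1 + g₀ + 2 * C) ≤ M) {K m : ℝ} (hK : K = 1 + C * (1 + g₀ + 2 * C))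
    (hm : m = K * σ ^ γ) (hmh : 1 ≤ m ^ β * (h ^ 2) ^ (1 - β / 2))
    (hHM : 2 * C * holderNorm β ω A ≤ h ^ 2 * (M ^ β * δ ^ (1 - β / 2))) (n : ℕ)
    (p : ((Fin d → ℝ) → Fin k → ℝ) × ((Fin d → ℝ) → Fin d → ℝ))
    (hp : StageBounds ω A C g₀ b δ h M m n p) :
    ∃ q : ((Fin d → ℝ) → Fin k → ℝ) × ((Fin d → ℝ) → Fin d → ℝ),
      StageBounds ω A C g₀ b δ h M m (n + 1) q ∧
      C1Norm ω (fun x => q.1 x - p.1 x) ≤ C * √δ * h ^ n ∧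
      C1Norm ω (fun x => q.2 x - p.2 x) ≤ C * (1 + g₀ + 2 * C) * √δ * h ^ n := by
  have hC0 : 0 < C := by linarith
  have hσγ : 1 ≤ σ ^ γ := Real.one_le_rpow hσ hγ.le
  have hK1 : 1 ≤ K := by
    rw [hK]
    have : 0 ≤ C * (1 + g₀ + 2 * C) := by positivity
    linarith
  have hm1 : 1 ≤ m := hm ▸ one_le_mul_of_one_le_of_one_le hK1 hσγ
  have hmn : 1 ≤ m ^ n := one_le_pow₀ hm1
  have hhn : h ^ n ≤ (1 / 2) ^ n := pow_le_pow_left₀ hh.le hh1 n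
  have hhalf : (0:ℝ) ≤ (1 / 2) ^ n := by positivity
  have hhalf1 : (1 / 2 : ℝ) ^ (n + 1) = (1 / 2) ^ n / 2 := by rw [pow_succ]; ring
  have hhn1 : h ^ n ≤ 1 := pow_le_one₀ hh.le (by linarith)
  have hhn0 : 0 < h ^ n := by positivity
  have hδn : δ * (h ^ n) ^ 2 ≤ 1 := by nlinarith
  have hsqrt : √(δ * (h ^ n) ^ 2) = √δ * h ^ n := by
    rw [Real.sqrt_mul hδ.le, Real.sqrt_sq hhn0.le]
  have hsδ : √δ ≤ 1 := Real.sqrt_le_one.2 hδ1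
  have hsδ0 : 0 ≤ √δ := Real.sqrt_nonneg δ
  have hMn : 1 ≤ M * m ^ n := one_le_mul_of_one_le_of_one_le hM hmn
  obtain ⟨vt, wt, hvt, hwt, h1, h2, h3, h4, h5⟩ := hS.exists_step hγ hC hβ hβ1
    hp.contDiff_fst hp.contDiff_snd hA hAs (by positivity) hδn hp.deficit_le hp.C2Norm_fst_le
    hp.C2Norm_snd_le hMn hσ₀ hσ
  rw [hsqrt] at h1 h2
  have hG : 1 + grad1Norm ω p.1 ≤ 1 + g₀ + 2 * C := by
    have := hp.grad1Norm_le
    nlinarith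
  have hinc : √δ * h ^ n ≤ (1 / 2) ^ n := by nlinarith
  have hG1 : 1 ≤ 1 + g₀ + 2 * C := by linarith
  have e1 : C1Norm ω (fun x => vt x - p.1 x) ≤ C * (1 / 2) ^ n := h1.trans (by gcongr)
  have e2 : C1Norm ω (fun x => wt x - p.2 x) ≤ C * (1 + g₀ + 2 * C) * (1 / 2) ^ n :=
    h2.trans <| calc
      C * (√δ * h ^ n) * (1 + grad1Norm ω p.1)
        ≤ C * (1 / 2) ^ n * (1 + g₀ + 2 * C) := by
          have := grad1Norm_nonneg (ω := ω) p.1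
          gcongr
      _ = _ := by ring
  have a1 : ∀ {E : Type} [NormedAddCommGroup E] [NormedSpace ℝ E] {f : (Fin d → ℝ) → E},
      ContDiff ℝ 2 f → ContDiff ℝ 1 f := fun hf => hf.of_le one_le_two
  have f1 : C1Norm ω vt ≤ b + 2 * C * (1 + g₀ + 2 * C) * (1 - (1 / 2) ^ (n + 1)) := by
    have := C1Norm_le_add hb (a1 hvt) (a1 hp.contDiff_fst)
    have h6 := hp.C1Norm_fst_le
    have h7 : C * (1 / 2) ^ n ≤ C * (1 + g₀ + 2 * C) * (1 / 2) ^ n := by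
      gcongr
      exact le_mul_of_one_le_right hC0.le hG1
    rw [hhalf1]
    linarith
  have f2 : C1Norm ω wt ≤ b + 2 * C * (1 + g₀ + 2 * C) * (1 - (1 / 2) ^ (n + 1)) := by
    have := C1Norm_le_add hb (a1 hwt) (a1 hp.contDiff_snd)
    have h6 := hp.C1Norm_snd_le
    rw [hhalf1]
    linarith
  have f3 : b + 2 * C * (1 + g₀ + 2 * C) * (1 - (1 / 2) ^ (n + 1)) ≤ M := by
    have : 0 ≤ 2 * C * (1 + g₀ + 2 * C) * (1 / 2) ^ (n + 1) := by positivity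
    linarith
  have f4 : C * (M * m ^ n) * σ ^ γ * (1 + grad1Norm ω p.1)
      ≤ C * (1 + g₀ + 2 * C) * σ ^ γ * (M * m ^ n) := calc
    _ ≤ C * (M * m ^ n) * σ ^ γ * (1 + g₀ + 2 * C) := by gcongr
    _ = _ := by ring
  have f5 : M + C * (1 + g₀ + 2 * C) * σ ^ γ * (M * m ^ n) ≤ M * m ^ (n + 1) := by
    have i1 : M ≤ M * m ^ n := le_mul_of_one_le_right (by linarith) hmn
    have i2 : M * m ^ n ≤ σ ^ γ * (M * m ^ n) := le_mul_of_one_le_left (by linarith) hσγ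
    have i3 : M * m ^ (n + 1) = (1 + C * (1 + g₀ + 2 * C)) * σ ^ γ * (M * m ^ n) := by
      rw [pow_succ, hm, hK]
      ring
    rw [i3]
    linarith
  have hm0 : 0 < m := by linarith
  refine ⟨(vt, wt), ⟨hvt, hwt, h5.trans ?_, ?_, ?_, ?_, f1, f2⟩, ?_, ?_⟩
  · exact stage_deficit_le (by linarith) hm0 hh hδ hhσ hmh hHM n
  · have : grad2Norm ω vt ≤ _ := h3.trans f4
    rw [C2Norm_eq]
    linarith
  · have : grad2Norm ω wt ≤ _ := h4.trans f4
    rw [C2Norm_eq]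
    linarith
  · have i1 := grad1Norm_le_add hb (a1 hvt) (a1 hp.contDiff_fst)
    have i2 := grad1Norm_le_C1Norm (ω := ω) (fun x => vt x - p.1 x)
    have i3 := hp.grad1Norm_le
    change grad1Norm ω vt ≤ _
    rw [hhalf1]
    linarith
  · exact h1.trans_eq (by ring)
  · refine h2.trans <| calc
      C * (√δ * h ^ n) * (1 + grad1Norm ω p.1)
        ≤ C * (√δ * h ^ n) * (1 + g₀ + 2 * C) := by gcongr
      _ = _ := by ring

lemma StageProperty.exists_iteration {γ σ₀ C : ℝ} (hS : StageProperty k ω γ σ₀ C) (hγ : 0 < γ)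
    (hb : Bornology.IsBounded ω) (hC : 1 ≤ C) {v : (Fin d → ℝ) → Fin k → ℝ}
    {w : (Fin d → ℝ) → Fin d → ℝ} {A : (Fin d → ℝ) → Fin d → Fin d → ℝ}
    {α β δ : ℝ} (hβ : 0 < β) (hβ1 : β ≤ 1)
    (hv : ContDiff ℝ 2 v) (hw : ContDiff ℝ 2 w)
    (hA : IsHolder β A) (hAs : ∀ x i j, A x i j = A x j i) (hδ : 0 < δ) (hδ1 : δ ≤ 1)
    (hdef : supNorm ω (deficit A v w) ≤ δ)
    (hα : α < min (β / 2) (1 / (1 + 2 * γ))) :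
    ∃ (V : ℕ → (Fin d → ℝ) → Fin k → ℝ) (W : ℕ → (Fin d → ℝ) → Fin d → ℝ) (h M m : ℝ),
      0 < h ∧ h ≤ 1 / 2 ∧ 0 ≤ M ∧ 1 ≤ m ∧ h ^ (1 - α) * m ^ α < 1 ∧ V 0 = v ∧ W 0 = w ∧
      ∀ n, ContDiff ℝ 2 (V n) ∧ ContDiff ℝ 2 (W n) ∧
        supNorm ω (deficit A (V n) (W n)) ≤ δ * (h ^ n) ^ 2 ∧
        grad2Norm ω (V n) ≤ M * m ^ n ∧ grad2Norm ω (W n) ≤ M * m ^ n ∧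
        C1Norm ω (fun x => V (n + 1) x - V n x) ≤ C * √δ * h ^ n ∧
        C1Norm ω (fun x => W (n + 1) x - W n x)
          ≤ C * (1 + grad1Norm ω v + 2 * C) * √δ * h ^ n := by
  have hg₀ := grad1Norm_nonneg (ω := ω) v
  have hK : 1 ≤ 1 + C * (1 + grad1Norm ω v + 2 * C) := by
    have : 0 ≤ C * (1 + grad1Norm ω v + 2 * C) := by positivity
    linarith
  obtain ⟨σ, h, hσ₀, hσ, hh, hh1, hhσ, hq, hmh⟩ :=
    exists_frequency (σ₀ := σ₀) hβ hβ1 hγ hα hC hK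
  set m := (1 + C * (1 + grad1Norm ω v + 2 * C)) * σ ^ γ with hm
  have hm1 : 1 ≤ m := one_le_mul_of_one_le_of_one_le hK (Real.one_le_rpow hσ hγ.le)
  set b := C1Norm ω v + C1Norm ω w with hbdef
  have t : Tendsto (fun M : ℝ => h ^ 2 * (M ^ β * δ ^ (1 - β / 2))) atTop atTop :=
    ((tendsto_rpow_atTop hβ).atTop_mul_const (by positivity)).const_mul_atTop (by positivity)
  obtain ⟨M, hM1, hM2, hM3, hM4, hM5⟩ := ((eventually_ge_atTop 1).and
    ((eventually_ge_atTop (C2Norm ω v)).and ((eventually_ge_atTop (C2Norm ω w)).and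
    ((eventually_ge_atTop (b + 2 * C * (1 + grad1Norm ω v + 2 * C))).and
    (t.eventually_ge_atTop (2 * C * holderNorm β ω A)))))).exists
  have step := hS.exists_bounds_succ hγ hb hC hβ hβ1 hA hAs hδ hδ1 hM1 hσ₀ hσ hg₀ hh hh1 hhσ
    hM4 rfl hm hmh hM5
  choose! next hnext using step
  let P : ℕ → ((Fin d → ℝ) → Fin k → ℝ) × ((Fin d → ℝ) → Fin d → ℝ) :=
    fun n => Nat.rec (v, w) next n
  have hP : ∀ n, StageBounds ω A C (grad1Norm ω v) b δ h M m n (P n) := by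
    intro n
    induction n with
    | zero =>
      refine ⟨hv, hw, ?_, ?_, ?_, ?_, ?_, ?_⟩
      · simpa [P] using hdef
      · simpa [P] using hM2
      · simpa [P] using hM3
      · simp [P]
      · simpa [P, hbdef] using C1Norm_nonneg w
      · simpa [P, hbdef] using C1Norm_nonneg v
    | succ n ih => exact (hnext n (P n) ih).1
  refine ⟨fun n => (P n).1, fun n => (P n).2, h, M, m, hh, hh1, by linarith, hm1, hq, rfl, rfl,
    fun n => ?_⟩
  have hn := hP n
  refine ⟨hn.contDiff_fst, hn.contDiff_snd, hn.deficit_le, ?_, ?_, (hnext n _ hn).2.1,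
    (hnext n _ hn).2.2⟩
  · have := hn.C2Norm_fst_le
    rw [C2Norm_eq] at this
    linarith [C1Norm_nonneg (ω := ω) (P n).1]
  · have := hn.C2Norm_snd_le
    rw [C2Norm_eq] at this
    linarith [C1Norm_nonneg (ω := ω) (P n).2]

end Stage

section Exact

open Filter Topology Metric

variable {d k : ℕ} {ω : Set (Fin d → ℝ)}

lemma tendsto_pullback {P : ℕ → (Fin d → ℝ) →L[ℝ] (Fin k → ℝ)}
    {Q : ℕ → (Fin d → ℝ) →L[ℝ] (Fin d → ℝ)} {p : (Fin d → ℝ) →L[ℝ] (Fin k → ℝ)}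
    {q : (Fin d → ℝ) →L[ℝ] (Fin d → ℝ)} (hP : Tendsto P atTop (𝓝 p)) (hQ : Tendsto Q atTop (𝓝 q))
    (i j : Fin d) : Tendsto (fun n => pullback (P n) (Q n) i j) atTop (𝓝 (pullback p q i j)) := by
  have h := (continuous_pullback (k := k) i j).continuousAt (x := (p, q))
  exact Tendsto.comp (f := fun n => (P n, Q n)) h (hP.prodMk_nhds hQ)

lemma StageProperty.exists_exact_on_ball {γ σ₀ C : ℝ} (hS : StageProperty k ω γ σ₀ C)
    (hγ : 0 < γ) (hb : Bornology.IsBounded ω) (hC : 1 ≤ C) {c : Fin d → ℝ} {ρ : ℝ} (hρ : 0 < ρ)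
    (hcω : closedBall c ρ ⊆ closure ω) {v : (Fin d → ℝ) → Fin k → ℝ}
    {w : (Fin d → ℝ) → Fin d → ℝ} {A : (Fin d → ℝ) → Fin d → Fin d → ℝ}
    {α β ε : ℝ} (hβ : 0 < β) (hβ1 : β ≤ 1) (hv : ContDiff ℝ 2 v) (hw : ContDiff ℝ 2 w)
    (hA : IsHolder β A) (hAs : ∀ x i j, A x i j = A x j i) (hε : 0 < ε) (hε1 : ε ≤ 1)
    (hdef : supNorm ω (deficit A v w) ≤ ε)
    (hα : 0 < α) (hα1 : α < min (β / 2) (1 / (1 + 2 * γ))) :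
    ∃ (vt : (Fin d → ℝ) → Fin k → ℝ) (wt : (Fin d → ℝ) → Fin d → ℝ),
      IsC1Holder α vt ∧ IsC1Holder α wt ∧ ∀ x ∈ closedBall c (ρ / 2),
        ‖vt x - v x‖ ≤ 2 * (C * √ε) ∧
        ‖fderiv ℝ vt x - fderiv ℝ v x‖ ≤ 2 * (C * √ε) ∧
        ‖wt x - w x‖ ≤ 2 * (C * (1 + grad1Norm ω v + 2 * C) * √ε) ∧
        ‖fderiv ℝ wt x - fderiv ℝ w x‖ ≤ 2 * (C * (1 + grad1Norm ω v + 2 * C) * √ε) ∧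
        ∀ i j, deficit A vt wt x i j = 0 := by
  have hα2 : α < 1 := by
    have := hα1.trans_le (min_le_left _ _)
    linarith
  have hg := grad1Norm_nonneg (ω := ω) v
  obtain ⟨V, W, h, M, m, hh, hh1, hM, hm, hq, rfl, rfl, hVW⟩ :=
    hS.exists_iteration hγ hb hC hβ hβ1 hv hw hA hAs hε hε1 hdef hα1
  have hV2 : ∀ n, ContDiff ℝ 2 (V n) := fun n => (hVW n).1
  have hW2 : ∀ n, ContDiff ℝ 2 (W n) := fun n => (hVW n).2.1
  have hV1 : ∀ n, ContDiff ℝ 1 (V n) := fun n => (hV2 n).of_le one_le_two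
  have hW1 : ∀ n, ContDiff ℝ 1 (W n) := fun n => (hW2 n).of_le one_le_two
  have hVd : ∀ n x, DifferentiableAt ℝ (V n) x := fun n x => (hV1 n).differentiable one_ne_zero x
  have hWd : ∀ n x, DifferentiableAt ℝ (W n) x := fun n x => (hW1 n).differentiable one_ne_zero x
  obtain ⟨vt, hvt, hvt'⟩ := exists_isC1Holder_limit (f := V) (a := C * √ε) hρ (by positivity) hM
    hh hh1 hm hα hα2 hq hV2
    (fun n x hx => (norm_le_C1Norm hb ((hV1 (n + 1)).sub (hV1 n)).continuous (hcω hx)).trans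
      (hVW n).2.2.2.2.2.1)
    (fun n x hx => by
      have := norm_fderiv_le_C1Norm hb ((hV1 (n + 1)).sub (hV1 n)) (hcω hx)
      rw [fderiv_fun_sub (hVd _ x) (hVd _ x)] at this
      exact this.trans (hVW n).2.2.2.2.2.1)
    (fun n x hx => (norm_fderiv_fderiv_le_grad2Norm hb (hV2 n) (hcω hx)).trans
      (hVW n).2.2.2.1)
  obtain ⟨wt, hwt, hwt'⟩ := exists_isC1Holder_limit (f := W)
    (a := C * (1 + grad1Norm ω (V 0) + 2 * C) * √ε) hρ (by positivity) hM
    hh hh1 hm hα hα2 hq hW2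
    (fun n x hx => (norm_le_C1Norm hb ((hW1 (n + 1)).sub (hW1 n)).continuous (hcω hx)).trans
      (hVW n).2.2.2.2.2.2)
    (fun n x hx => by
      have := norm_fderiv_le_C1Norm hb ((hW1 (n + 1)).sub (hW1 n)) (hcω hx)
      rw [fderiv_fun_sub (hWd _ x) (hWd _ x)] at this
      exact this.trans (hVW n).2.2.2.2.2.2)
    (fun n x hx => (norm_fderiv_fderiv_le_grad2Norm hb (hW2 n) (hcω hx)).trans
      (hVW n).2.2.2.2.1)
  refine ⟨vt, wt, hvt, hwt, fun x hx => ?_⟩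
  obtain ⟨-, v1, v2, v3⟩ := hvt' x hx
  obtain ⟨-, w1, w2, w3⟩ := hwt' x hx
  refine ⟨v2, v3, w2, w3, fun i j => ?_⟩
  have hxω : x ∈ closure ω := hcω (closedBall_subset_closedBall (by linarith) hx)
  have l1 : Tendsto (fun n => deficit A (V n) (W n) x i j) atTop
      (𝓝 (deficit A vt wt x i j)) := by
    rw [deficit_eq (hvt.1.differentiable one_ne_zero x) (hwt.1.differentiable one_ne_zero x)]
    refine Tendsto.congr (fun n => (deficit_eq (hVd n x) (hWd n x) i j).symm) ?_
    exact (tendsto_pullback v1 w1 i j).const_sub (A x i j)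
  have l2 : Tendsto (fun n => ε * (h ^ n) ^ 2) atTop (𝓝 0) := by
    have := ((tendsto_pow_atTop_nhds_zero_of_lt_one hh.le (by linarith)).pow 2).const_mul ε
    simpa using this
  refine tendsto_nhds_unique l1 (squeeze_zero_norm (fun n => ?_) l2)
  have hAc : Continuous A := (hA.uniformContinuous hβ).continuous
  exact ((abs_entry_le _ i j).trans
    (norm_le_supNorm hb (continuous_deficit hAc (hV1 n) (hW1 n)) hxω)).trans (hVW n).2.2.1

end Exact

section Clamp

variable {d k : ℕ}

lemma contDiff_pullback {n : WithTop ℕ∞} (i j : Fin d) :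
    ContDiff ℝ n fun p : ((Fin d → ℝ) →L[ℝ] (Fin k → ℝ)) × ((Fin d → ℝ) →L[ℝ] (Fin d → ℝ)) =>
      pullback p.1 p.2 i j := by
  unfold pullback
  fun_prop

lemma isHolder_of_hasCompactSupport {E : Type*} [NormedAddCommGroup E] [NormedSpace ℝ E]
    {f : (Fin d → ℝ) → E} (hf : ContDiff ℝ 1 f) (hc : HasCompactSupport f) {β : ℝ}
    (hβ : 0 ≤ β) (hβ1 : β ≤ 1) : IsHolder β f := by
  obtain ⟨L, hL⟩ := hf.lipschitzWith_of_hasCompactSupport hc one_ne_zero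
  obtain ⟨B, hB⟩ := hf.continuous.bounded_above_of_compact_support hc
  refine isHolder_of_bounded hβ L.2 hB fun x y hxy => (hL.norm_sub_le x y).trans ?_
  have : ‖x - y‖ ≤ ‖x - y‖ ^ β := by
    simpa using le_rpow_mul_rpow hβ hβ1 (norm_nonneg (x - y)) hxy le_rfl
  exact mul_le_mul_of_nonneg_left this L.2

/-- Entrywise truncation of a matrix at height `δ`. -/
def clamp (δ : ℝ) (D : Fin d → Fin d → ℝ) : Fin d → Fin d → ℝ :=
  fun i j => max (-δ) (min δ (D i j))

lemma abs_clamp_le {δ : ℝ} (hδ : 0 ≤ δ) (D : Fin d → Fin d → ℝ) (i j : Fin d) :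
    |clamp δ D i j| ≤ δ :=
  abs_le.2 ⟨le_max_left _ _, max_le (by linarith) (min_le_left _ _)⟩

lemma clamp_eq_self {δ : ℝ} {D : Fin d → Fin d → ℝ} (h : ∀ i j, |D i j| ≤ δ) :
    clamp δ D = D := by
  funext i j
  obtain ⟨h1, h2⟩ := abs_le.1 (h i j)
  simp [clamp, h1, h2]

lemma norm_clamp_sub_clamp_le (δ : ℝ) (D D' : Fin d → Fin d → ℝ) :
    ‖clamp δ D - clamp δ D'‖ ≤ ‖D - D'‖ := by
  refine norm_matrix_le (norm_nonneg _) fun i j => ?_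
  refine le_trans ?_ (abs_entry_le (D - D') i j)
  refine (abs_max_sub_max_le_max _ _ _ _).trans ?_
  rw [sub_self, abs_zero]
  refine max_le (abs_nonneg _) ((abs_min_sub_min_le_max _ _ _ _).trans ?_)
  rw [sub_self, abs_zero]
  exact max_le (abs_nonneg _) le_rfl

lemma exists_cutoff {m : ℕ} {ω : Set (Fin d → ℝ)} (hb : Bornology.IsBounded ω)
    {v : (Fin d → ℝ) → Fin m → ℝ} (hv : ContDiff ℝ 2 v) :
    ∃ u : (Fin d → ℝ) → Fin m → ℝ, ContDiff ℝ 2 u ∧ HasCompactSupport u ∧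
      ∀ x ∈ closure ω, u x = v x ∧ fderiv ℝ u x = fderiv ℝ v x := by
  obtain ⟨R, hR⟩ := hb.closure.subset_ball 0
  let χ : ContDiffBump (0 : Fin d → ℝ) := ⟨max R 1, max R 1 + 1, by positivity, by linarith⟩
  refine ⟨fun x => χ x • v x, χ.contDiff.smul hv, χ.hasCompactSupport.smul_right, fun x hx => ?_⟩
  have hx' : x ∈ Metric.ball (0 : Fin d → ℝ) χ.rIn :=
    Metric.ball_subset_ball (le_max_left R 1) (hR hx)
  have : (fun x => χ x • v x) =ᶠ[nhds x] v := by
    filter_upwards [χ.eventuallyEq_one_of_mem_ball hx'] with y hy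
    simp [hy]
  exact ⟨this.eq_of_nhds, this.fderiv_eq⟩

/-- The fields can be corrected on a compact set so that the deficit is as small as desired, with
respect to a Hölder field that coincides with the given one on `closure ω`. -/
lemma exists_small_deficit (hd : 1 ≤ d) (l₀ : Fin k) : ∃ C : ℝ, 0 < C ∧
    ∀ (ω : Set (Fin d → ℝ)) (K : Set (Fin d → ℝ)), Bornology.IsBounded ω → IsCompact K →
    closure ω ⊆ K → ∀ (v : (Fin d → ℝ) → Fin k → ℝ) (w : (Fin d → ℝ) → Fin d → ℝ)
      (A : (Fin d → ℝ) → Fin d → Fin d → ℝ) (β δ : ℝ), 0 < β → β ≤ 1 → ContDiff ℝ 2 v →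
      ContDiff ℝ 2 w → IsHolder β A → (∀ x i j, A x i j = A x j i) → 0 < δ → δ ≤ 1 →
      supNorm ω (deficit A v w) ≤ δ →
      ∃ (A' : (Fin d → ℝ) → Fin d → Fin d → ℝ) (L : ℝ), IsHolder β A' ∧
        (∀ x i j, A' x i j = A' x j i) ∧ (∀ x ∈ closure ω, A' x = A x) ∧ 0 ≤ L ∧
        ∀ ε : ℝ, 0 < ε → ∃ (v' : (Fin d → ℝ) → Fin k → ℝ) (w' : (Fin d → ℝ) → Fin d → ℝ),
          ContDiff ℝ 2 v' ∧ ContDiff ℝ 2 w' ∧ (∀ x ∈ K, ‖fderiv ℝ v' x‖ ≤ L) ∧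
          (∀ x ∈ K, ∀ i j,
            |A' x i j - pullback (fderiv ℝ v' x) (fderiv ℝ w' x) i j| ≤ ε) ∧
          ∀ x ∈ closure ω, ‖v' x - v x‖ ≤ C * √δ ∧ ‖w' x - w x‖ ≤ C * √δ * (1 + ‖x‖) ∧
            ‖fderiv ℝ v' x - fderiv ℝ v x‖ ≤ C * √δ ∧
            ‖fderiv ℝ w' x - fderiv ℝ w x‖ ≤ C * √δ * (1 + ‖fderiv ℝ v x‖) := by
  obtain ⟨C, hC, happ⟩ := exists_approximate_solution (d := d) hd l₀
  refine ⟨C, hC, fun ω K hb hK hωK v w A β δ hβ hβ1 hv hw hA hAs hδ hδ1 hdef => ?_⟩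
  obtain ⟨u, hu, huc, huv⟩ := exists_cutoff hb hv
  obtain ⟨z, hz, hzc, hzw⟩ := exists_cutoff hb hw
  set P : (Fin d → ℝ) → Fin d → Fin d → ℝ := fun x => pullback (fderiv ℝ u x) (fderiv ℝ z x)
    with hP
  have hP1 : ContDiff ℝ 1 P := by
    refine contDiff_pi.2 fun i => contDiff_pi.2 fun j => ?_
    exact (contDiff_pullback i j).comp
      ((hu.fderiv_right (m := 1) (by norm_num)).prodMk (hz.fderiv_right (by norm_num)))
  have hPc : HasCompactSupport P := by
    refine HasCompactSupport.intro (huc.isCompact.union hzc.isCompact) fun x hx => ?_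
    rw [Set.mem_union, not_or] at hx
    funext i j
    simp [hP, pullback, fderiv_of_notMem_tsupport ℝ hx.1, fderiv_of_notMem_tsupport ℝ hx.2]
  have hPH := isHolder_of_hasCompactSupport hP1 hPc hβ.le hβ1
  obtain ⟨H₁, hH₁, hP2⟩ := hPH.exists_norm_le hβ.le
  obtain ⟨H₂, hH₂, hA2⟩ := hA.exists_norm_le hβ.le
  set D : (Fin d → ℝ) → Fin d → Fin d → ℝ := fun x => clamp δ (A x - P x) with hD
  have hD2 : ∀ x y, ‖D x - D y‖ ≤ (H₁ + H₂) * ‖x - y‖ ^ β := by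
    intro x y
    refine (norm_clamp_sub_clamp_le δ _ _).trans ?_
    rw [sub_sub_sub_comm]
    have := norm_sub_le (A x - A y) (P x - P y)
    linarith [hP2 x y, hA2 x y]
  have hDH : IsHolder β D := isHolder_of_norm_le hβ.le hD2
  have hPs : ∀ x i j, P x i j = P x j i := fun x i j => pullback_symm _ _ i j
  have hDs : ∀ x i j, D x i j = D x j i := by
    intro x i j
    simp only [hD, clamp, Pi.sub_apply, hAs x i j, hPs x i j]
  obtain ⟨B, hB⟩ := hK.exists_bound_of_continuousOn
    (hu.continuous_fderiv two_ne_zero).continuousOn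
  refine ⟨fun x => P x + D x, max B 0 + C * √δ, ?_, ?_, ?_, by positivity, fun ε hε => ?_⟩
  · refine isHolder_of_norm_le (H := H₁ + (H₁ + H₂)) hβ.le fun x y => ?_
    rw [add_sub_add_comm]
    have := norm_add_le (P x - P y) (D x - D y)
    linarith [hP2 x y, hD2 x y]
  · intro x i j
    simp only [Pi.add_apply, hPs x i j, hDs x i j]
  · intro x hx
    have : D x = A x - P x := by
      refine clamp_eq_self fun i j => ?_
      have e : A x - P x = deficit A v w x := by
        funext i j
        rw [deficit_eq (hv.differentiable two_ne_zero x) (hw.differentiable two_ne_zero x)]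
        simp only [hP, Pi.sub_apply, (huv x hx).2, (hzw x hx).2]
      rw [e]
      have hc := continuous_deficit (hA.uniformContinuous hβ).continuous
        (hv.of_le one_le_two) (hw.of_le one_le_two)
      exact (abs_entry_le _ i j).trans ((norm_le_supNorm hb hc hx).trans hdef)
    simp [this]
  · obtain ⟨v', w', hv', hw', h⟩ := happ K hK u z D δ ε hu hz (hDH.uniformContinuous hβ) hDs
      (fun x i j => abs_clamp_le hδ.le _ i j) hδ hδ1 hε
    refine ⟨v', w', hv', hw', fun x hx => ?_, fun x hx i j => ?_, fun x hx => ?_⟩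
    · have h1 := (h x hx).2.2.1
      have h2 := norm_add_le (fderiv ℝ u x) (fderiv ℝ v' x - fderiv ℝ u x)
      rw [add_sub_cancel] at h2
      linarith [hB x hx, le_max_left B 0]
    · rw [abs_sub_comm]
      exact (h x hx).2.2.2.2 i j
    · obtain ⟨h1, h2, h3, h4, -⟩ := h x (hωK hx)
      rw [(huv x hx).1] at h1
      rw [(huv x hx).2] at h3 h4
      rw [(hzw x hx).1] at h2
      rw [(hzw x hx).2] at h4
      exact ⟨h1, h2, h3, h4⟩

end Clamp

section Rescale

variable {d : ℕ} {E : Type*} [NormedAddCommGroup E] [NormedSpace ℝ E]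

/-- The affine change of variables `x ↦ b + s x`, normalized so that gradients are preserved. -/
def rescale (b : Fin d → ℝ) (s : ℝ) (f : (Fin d → ℝ) → E) (x : Fin d → ℝ) : E :=
  s⁻¹ • f (b + s • x)

lemma fderiv_rescale (b : Fin d → ℝ) {s : ℝ} (hs : s ≠ 0) {f : (Fin d → ℝ) → E}
    (hf : Differentiable ℝ f) (x : Fin d → ℝ) :
    fderiv ℝ (rescale b s f) x = fderiv ℝ f (b + s • x) := by
  have h1 : HasFDerivAt (fun x : Fin d → ℝ => b + s • x)
      (s • ContinuousLinearMap.id ℝ (Fin d → ℝ)) x :=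
    ((hasFDerivAt_id x).const_smul s).const_add b
  have h2 := ((hf (b + s • x)).hasFDerivAt.comp x h1).const_smul s⁻¹
  have h3 : s⁻¹ • (fderiv ℝ f (b + s • x)).comp (s • ContinuousLinearMap.id ℝ (Fin d → ℝ))
      = fderiv ℝ f (b + s • x) := by
    ext y
    simp [smul_smul, hs]
  rw [h3] at h2
  exact h2.fderiv

lemma ContDiff.rescale {n : WithTop ℕ∞} {f : (Fin d → ℝ) → E} (hf : ContDiff ℝ n f)
    (b : Fin d → ℝ) (s : ℝ) : ContDiff ℝ n (rescale b s f) :=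
  (hf.comp (contDiff_const.add (contDiff_id.const_smul s))).const_smul s⁻¹

lemma IsHolder.comp_affine {F : Type*} [NormedAddCommGroup F] {f : (Fin d → ℝ) → F} {α : ℝ}
    (hα : 0 ≤ α) (hf : IsHolder α f) (b : Fin d → ℝ) (s : ℝ) :
    IsHolder α fun x => f (b + s • x) := by
  obtain ⟨H, hH, h⟩ := hf.exists_norm_le hα
  refine isHolder_of_norm_le (H := H * |s| ^ α) hα fun x y => (h _ _).trans_eq ?_
  rw [add_sub_add_left_eq_sub, ← smul_sub, norm_smul, Real.norm_eq_abs,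
    Real.mul_rpow (abs_nonneg _) (norm_nonneg _), mul_assoc]

lemma IsC1Holder.rescale {f : (Fin d → ℝ) → E} {α : ℝ} (hα : 0 ≤ α) (hf : IsC1Holder α f)
    (b : Fin d → ℝ) {s : ℝ} (hs : s ≠ 0) : IsC1Holder α (rescale b s f) := by
  refine ⟨hf.1.rescale b s, ?_⟩
  rw [funext (fderiv_rescale b hs (hf.1.differentiable one_ne_zero))]
  exact hf.2.comp_affine hα b s

end Rescale

section Assembly

open Metric

variable {d k : ℕ} {ω : Set (Fin d → ℝ)}

lemma StageProperty.exists_exact {γ σ₀ C₀ : ℝ} (hS : StageProperty k ω γ σ₀ C₀) (hγ : 0 < γ)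
    (hσ₀ : 0 ≤ σ₀) (hd : 1 ≤ d) (hk : 1 ≤ k) (hω : IsOpen ω) (hb : Bornology.IsBounded ω)
    (hne : ω.Nonempty) :
    ∃ C : ℝ, 0 < C ∧ ∀ (v : (Fin d → ℝ) → Fin k → ℝ) (w : (Fin d → ℝ) → Fin d → ℝ)
      (A : (Fin d → ℝ) → Fin d → Fin d → ℝ) (β δ : ℝ), 0 < β → β ≤ 1 → ContDiff ℝ 2 v →
      ContDiff ℝ 2 w → IsHolder β A → (∀ x i j, A x i j = A x j i) → 0 < δ → δ ≤ 1 →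
      supNorm ω (deficit A v w) ≤ δ →
      ∀ α : ℝ, 0 < α → α < min (β / 2) (1 / (1 + 2 * γ)) →
      ∃ (vt : (Fin d → ℝ) → Fin k → ℝ) (wt : (Fin d → ℝ) → Fin d → ℝ),
        IsC1Holder α vt ∧ IsC1Holder α wt ∧
        C1Norm ω (fun x => vt x - v x) ≤ C * √δ ∧
        C1Norm ω (fun x => wt x - w x) ≤ C * √δ * (1 + grad1Norm ω v) ∧
        ∀ x ∈ closure ω, ∀ i j, deficit A vt wt x i j = 0 := by
  obtain ⟨C₁, hC₁, hprep⟩ := exists_small_deficit (d := d) hd (⟨0, hk⟩ : Fin k)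
  obtain ⟨c, hc⟩ := hne
  obtain ⟨ρ, hρ, hcρ⟩ := Metric.isOpen_iff.1 hω c hc
  have hcω : closedBall c (ρ / 2) ⊆ closure ω :=
    ((closedBall_subset_ball (by linarith)).trans hcρ).trans subset_closure
  obtain ⟨R₀, hR₀⟩ := hb.closure.subset_ball 0
  set R := max R₀ 1 with hR
  have hR1 : 0 < R := lt_max_of_lt_right one_pos
  have hωR : ∀ x ∈ closure ω, ‖x‖ ≤ R := fun x hx => by
    have := mem_ball_zero_iff.1 (hR₀ hx)
    exact this.le.trans (le_max_left _ _)
  set s := ρ / (4 * R) with hs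
  have hs0 : 0 < s := by positivity
  set C := max C₀ 1 with hC
  have hC1 : 1 ≤ C := le_max_right _ _
  have hSC := hS.mono hσ₀ (le_max_left C₀ 1)
  set b : Fin d → ℝ := -(s⁻¹ • c) with hbdef
  set K := closure ω ∪ (fun x => b + s⁻¹ • x) '' closure ω with hK
  have hKc : IsCompact K := hb.isCompact_closure.union
    (hb.isCompact_closure.image (by fun_prop))
  have hinv : ∀ x, b + s⁻¹ • (c + s • x) = x := fun x => by
    rw [hbdef, smul_add, smul_smul, inv_mul_cancel₀ hs0.ne', one_smul, neg_add_cancel_left]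
  refine ⟨2 * (C * (1 + 2 * C)) * (s⁻¹ + 1) + C₁ * (2 + R), by positivity, ?_⟩
  intro v w A β δ hβ hβ1 hv hw hA hAs hδ hδ1 hdef α hα hα1
  obtain ⟨A', L, hA', hAs', hAA', hL, hsmall⟩ := hprep ω K hb hKc Set.subset_union_left v w A β δ
    hβ hβ1 hv hw hA hAs hδ hδ1 hdef
  have hL1 : 1 ≤ 1 + L := by linarith
  set ε := δ / (1 + L) ^ 2 with hε
  have hε0 : 0 < ε := by positivity
  have hεδ : ε ≤ δ := div_le_self hδ.le (one_le_pow₀ hL1)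
  have hsqrt : √ε * (1 + L) = √δ := by
    rw [hε, Real.sqrt_div hδ.le, Real.sqrt_sq (by linarith), div_mul_cancel₀ _ (by linarith)]
  obtain ⟨v₁, w₁, hv₁, hw₁, hL₁, hε₁, hvw₁⟩ := hsmall ε hε0
  have hv₁d : Differentiable ℝ v₁ := hv₁.differentiable two_ne_zero
  have hw₁d : Differentiable ℝ w₁ := hw₁.differentiable two_ne_zero
  have hfv := fderiv_rescale b (inv_ne_zero hs0.ne') hv₁d
  have hfw := fderiv_rescale b (inv_ne_zero hs0.ne') hw₁d
  have hv₂ := hv₁.rescale b s⁻¹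
  have hw₂ := hw₁.rescale b s⁻¹
  have hmemK : ∀ x ∈ closure ω, b + s⁻¹ • x ∈ K := fun x hx => Or.inr ⟨x, hx, rfl⟩
  have hgrad : grad1Norm ω (rescale b s⁻¹ v₁) ≤ L :=
    grad1Norm_le hL fun x hx => by
      rw [hfv]
      exact hL₁ _ (hmemK x hx)
  have hdef₂ : supNorm ω (deficit (fun x => A' (b + s⁻¹ • x)) (rescale b s⁻¹ v₁)
      (rescale b s⁻¹ w₁)) ≤ ε := by
    refine supNorm_le hε0.le fun x hx => norm_matrix_le hε0.le fun i j => ?_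
    rw [deficit_eq (hv₂.differentiable two_ne_zero x) (hw₂.differentiable two_ne_zero x), hfv, hfw]
    exact hε₁ _ (hmemK x hx) i j
  obtain ⟨v₃, w₃, hv₃, hw₃, hvw₃⟩ := hSC.exists_exact_on_ball hγ hb hC1 (half_pos hρ) hcω hβ hβ1
    hv₂ hw₂ (hA'.comp_affine hβ.le b s⁻¹) (fun x => hAs' _) hε0 (hεδ.trans hδ1) hdef₂ hα hα1
  have hv₄ := hv₃.rescale hα.le c hs0.ne'
  have hw₄ := hw₃.rescale hα.le c hs0.ne'
  have hfv₄ := fderiv_rescale c hs0.ne' (hv₃.1.differentiable one_ne_zero)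
  have hfw₄ := fderiv_rescale c hs0.ne' (hw₃.1.differentiable one_ne_zero)
  have hball : ∀ x ∈ closure ω, c + s • x ∈ closedBall c (ρ / 2 / 2) := fun x hx => by
    rw [mem_closedBall_iff_norm, add_sub_cancel_left, norm_smul, Real.norm_of_nonneg hs0.le]
    calc s * ‖x‖ ≤ s * R := by gcongr; exact hωR x hx
      _ = ρ / 2 / 2 := by rw [hs]; field_simp; norm_num
  have hval : ∀ {m : ℕ} (f : (Fin d → ℝ) → Fin m → ℝ) (x : Fin d → ℝ),
      s⁻¹ • rescale b s⁻¹ f (c + s • x) = f x := fun f x => by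
    rw [rescale, hinv, inv_inv, smul_smul, inv_mul_cancel₀ hs0.ne', one_smul]
  have hg := grad1Norm_nonneg (ω := ω) v
  have hC0 : 0 < C := by linarith
  have hεsqrt : √ε ≤ √δ := Real.sqrt_le_sqrt hεδ
  have hCv : 2 * (C * √ε) ≤ 2 * (C * (1 + 2 * C)) * √δ := by
    have h1 : C * √ε ≤ C * (1 + 2 * C) * √δ := by
      gcongr
      exact le_mul_of_one_le_right hC0.le (by linarith)
    linarith
  have hCw : 2 * (C * (1 + grad1Norm ω (rescale b s⁻¹ v₁) + 2 * C) * √ε)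
      ≤ 2 * (C * (1 + 2 * C)) * √δ := by
    have h1 : 1 + grad1Norm ω (rescale b s⁻¹ v₁) + 2 * C ≤ (1 + 2 * C) * (1 + L) := by
      nlinarith
    calc _ ≤ 2 * (C * ((1 + 2 * C) * (1 + L)) * √ε) := by gcongr
      _ = 2 * (C * (1 + 2 * C)) * (√ε * (1 + L)) := by ring
      _ = _ := by rw [hsqrt]
  set T := 2 * (C * (1 + 2 * C)) with hT
  have hT0 : 0 ≤ T := by positivity
  have hδ0 : 0 ≤ √δ := Real.sqrt_nonneg δ
  refine ⟨rescale c s v₃, rescale c s w₃, hv₄, hw₄, ?_, ?_, fun x hx i j => ?_⟩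
  · refine (C1Norm_le (c := s⁻¹ * (T * √δ) + C₁ * √δ) (c' := T * √δ + C₁ * √δ) (by positivity)
      (by positivity) (fun x hx => ?_) (fun x hx => ?_)).trans ?_
    · have e : rescale c s v₃ x - v x
          = s⁻¹ • (v₃ (c + s • x) - rescale b s⁻¹ v₁ (c + s • x)) + (v₁ x - v x) := by
        rw [smul_sub, hval, rescale]
        abel
      rw [e]
      refine (norm_add_le _ _).trans (add_le_add ?_ (hvw₁ x hx).1)
      rw [norm_smul, Real.norm_of_nonneg (inv_nonneg.2 hs0.le)]
      gcongr
      exact ((hvw₃ _ (hball x hx)).1).trans hCv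
    · rw [fderiv_fun_sub (hv₄.1.differentiable one_ne_zero x) (hv.differentiable two_ne_zero x),
        hfv₄, ← sub_add_sub_cancel _ (fderiv ℝ v₁ x)]
      refine (norm_add_le _ _).trans (add_le_add ?_ (hvw₁ x hx).2.2.1)
      have := (hvw₃ _ (hball x hx)).2.1
      rw [hfv, hinv] at this
      exact this.trans hCv
    · have : 0 ≤ C₁ * R * √δ := by positivity
      linarith
  · have hG1 : 1 ≤ 1 + grad1Norm ω v := by linarith
    refine (C1Norm_le (c := s⁻¹ * (T * √δ) + C₁ * √δ * (1 + R))
      (c' := T * √δ + C₁ * √δ * (1 + grad1Norm ω v)) (by positivity)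
      (by positivity) (fun x hx => ?_) (fun x hx => ?_)).trans ?_
    · have e : rescale c s w₃ x - w x
          = s⁻¹ • (w₃ (c + s • x) - rescale b s⁻¹ w₁ (c + s • x)) + (w₁ x - w x) := by
        rw [smul_sub, hval, rescale]
        abel
      rw [e]
      refine (norm_add_le _ _).trans (add_le_add ?_ ((hvw₁ x hx).2.1.trans ?_))
      · rw [norm_smul, Real.norm_of_nonneg (inv_nonneg.2 hs0.le)]
        gcongr
        exact ((hvw₃ _ (hball x hx)).2.2.1).trans hCw
      · gcongr
        exact hωR x hx
    · rw [fderiv_fun_sub (hw₄.1.differentiable one_ne_zero x) (hw.differentiable two_ne_zero x),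
        hfw₄, ← sub_add_sub_cancel _ (fderiv ℝ w₁ x)]
      refine (norm_add_le _ _).trans (add_le_add ?_ ((hvw₁ x hx).2.2.2.trans ?_))
      · have := (hvw₃ _ (hball x hx)).2.2.2.1
        rw [hfw, hinv] at this
        exact this.trans hCw
      · gcongr
        exact norm_fderiv_le_grad1Norm hb (hv.of_le one_le_two) hx
    · have h1 : s⁻¹ * (T * √δ) + T * √δ + C₁ * √δ * (1 + R)
          ≤ (s⁻¹ * (T * √δ) + T * √δ + C₁ * √δ * (1 + R)) * (1 + grad1Norm ω v) :=
        le_mul_of_one_le_right (by positivity) hG1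
      linarith
  · have h1 := (hvw₃ _ (hball x hx)).2.2.2.2 i j
    rw [deficit_eq (hv₃.1.differentiable one_ne_zero _) (hw₃.1.differentiable one_ne_zero _),
      hinv, hAA' x hx] at h1
    rw [deficit_eq (hv₄.1.differentiable one_ne_zero x) (hw₄.1.differentiable one_ne_zero x),
      hfv₄, hfw₄]
    exact h1

end Assembly

/-- Theorem 4.1: the Nash–Kuiper scheme in `C^{1,α}`. If the "stage property"
holds with exponent `γ`, then subsolutions may be corrected to exact solutions of
class `C^{1,α}` for any `0 < α < min{β/2, 1/(1+2γ)}`, with `C¹` error control. -/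
theorem NashKuiper_scheme
    {d k : ℕ} (hd : 1 ≤ d) (hk : 1 ≤ k)
    (ω : Set (Fin d → ℝ)) (hω : IsOpen ω) (hωbd : Bornology.IsBounded ω)
    (hωne : ω.Nonempty) (γ : ℝ) (hγ : 0 < γ)
    (Hstage : ∃ σ₀ : ℝ, 1 < σ₀ ∧ ∃ C : ℝ, 0 < C ∧
      ∀ (v : (Fin d → ℝ) → Fin k → ℝ) (w : (Fin d → ℝ) → Fin d → ℝ)
        (A : (Fin d → ℝ) → Fin d → Fin d → ℝ) (β : ℝ),
        0 < β → β ≤ 1 →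
        ContDiff ℝ 2 v → ContDiff ℝ 2 w →
        IsHolder β A → (∀ x i j, A x i j = A x j i) →
        0 < supNorm ω (deficit A v w) → supNorm ω (deficit A v w) ≤ 1 →
        ∀ M σ : ℝ,
          max (max (C2Norm ω v) (C2Norm ω w)) 1 ≤ M → σ₀ < σ →
          ∃ (vt : (Fin d → ℝ) → Fin k → ℝ) (wt : (Fin d → ℝ) → Fin d → ℝ),
            ContDiff ℝ 2 vt ∧ ContDiff ℝ 2 wt ∧
            C1Norm ω (fun x => vt x - v x)
                ≤ C * supNorm ω (deficit A v w) ^ (1/2 : ℝ) ∧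
            C1Norm ω (fun x => wt x - w x)
                ≤ C * supNorm ω (deficit A v w) ^ (1/2 : ℝ) * (1 + grad1Norm ω v) ∧
            grad2Norm ω vt ≤ C * M * σ ^ γ ∧
            grad2Norm ω wt ≤ C * M * σ ^ γ * (1 + grad1Norm ω v) ∧
            supNorm ω (deficit A vt wt)
                ≤ C * (holderNorm β ω A * M ^ (-β)
                        * supNorm ω (deficit A v w) ^ (β / 2)
                      + supNorm ω (deficit A v w) / σ)) :
    ∃ C : ℝ, 0 < C ∧
      ∀ (v : (Fin d → ℝ) → Fin k → ℝ) (w : (Fin d → ℝ) → Fin d → ℝ)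
        (A : (Fin d → ℝ) → Fin d → Fin d → ℝ) (β : ℝ),
        0 < β → β ≤ 1 →
        ContDiff ℝ 2 v → ContDiff ℝ 2 w →
        IsHolder β A → (∀ x i j, A x i j = A x j i) →
        0 < supNorm ω (deficit A v w) → supNorm ω (deficit A v w) ≤ 1 →
        ∀ α : ℝ, 0 < α → α < min (β / 2) (1 / (1 + 2 * γ)) →
        ∃ (vt : (Fin d → ℝ) → Fin k → ℝ) (wt : (Fin d → ℝ) → Fin d → ℝ),
          IsC1Holder α vt ∧ IsC1Holder α wt ∧
          C1Norm ω (fun x => vt x - v x)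
              ≤ C * supNorm ω (deficit A v w) ^ (1/2 : ℝ) ∧
          C1Norm ω (fun x => wt x - w x)
              ≤ C * supNorm ω (deficit A v w) ^ (1/2 : ℝ) * (1 + grad1Norm ω v) ∧
          ∀ x ∈ closure ω, ∀ i j, deficit A vt wt x i j = 0 := by
  obtain ⟨σ₀, hσ₀, C₀, -, hS⟩ := Hstage
  have hS' : StageProperty k ω γ σ₀ C₀ := hS
  obtain ⟨C, hC, h⟩ := hS'.exists_exact hγ (by linarith) hd hk hω hωbd hωne
  refine ⟨C, hC, fun v w A β hβ hβ1 hv hw hA hAs hpos hle α hα hα1 => ?_⟩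
  rw [← Real.sqrt_eq_rpow]
  exact h v w A β _ hβ hβ1 hv hw hA hAs hpos hle le_rfl α hα hα1
end
end

section
/- Let ω ⊂ ℝ^d be an open, bounded domain and k ≥ 1. Given v ∈ C^∞(ω̄, ℝ^k), w ∈ C^∞(ω̄, ℝ^d) and A ∈ C^∞(ω̄, ℝ^{d×d}_sym), assume the deficit D = A − (½(∇v)ᵀ∇v + sym∇w) satisfies D > c·Id_d on ω̄ for some c > 0. Fix ε > 0. Then there exist ṽ ∈ C^∞(ω̄, ℝ^k) and w̃ ∈ C^∞(ω̄, ℝ^d) such that, with D̃ = A − (½(∇ṽ)ᵀ∇ṽ + sym∇w̃), the following hold with constants C depending only on d, k and ω: (1) ‖ṽ − v‖₀ ≤ ε and ‖w̃ − w‖₀ ≤ ε; (2) ‖∇(ṽ − v)‖₀ ≤ C‖D‖₀^{1/2} and ‖∇(w̃ − w)‖₀ ≤ C‖D‖₀^{1/2}(‖D‖₀^{1/2} + ‖∇v‖₀); (3) ‖D̃‖₀ ≤ ε and D̃ > c̃·Id_d on ω̄ for some c̃ > 0. -/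
noncomputable section
open MeasureTheory Real
open scoped BigOperators ENNReal NNReal

/-! ### Elementary smooth functions -/

lemma exists_smooth_sqrt {κ : ℝ} (hκ : 0 < κ) :
    ∃ g : ℝ → ℝ, ContDiff ℝ (⊤ : ℕ∞) g ∧ ∀ t, κ ≤ t → g t = √t := by
  refine ⟨fun t => smoothTransition (2 * t / κ - 1) * √t, ?_, ?_⟩
  · rw [contDiff_iff_contDiffAt]
    intro t
    rcases lt_or_ge t (κ / 2) with ht | ht
    · have : (fun t => smoothTransition (2 * t / κ - 1) * √t) =ᶠ[nhds t] fun _ => 0 := by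
        filter_upwards [eventually_lt_nhds ht] with s hs
        rw [smoothTransition.zero_of_nonpos, zero_mul]
        rw [sub_nonpos, div_le_one hκ]
        linarith
      exact contDiffAt_const.congr_of_eventuallyEq this
    · have h0 : t ≠ 0 := by linarith
      refine ContDiffAt.mul ?_ (contDiffAt_id.sqrt h0)
      exact (smoothTransition.contDiffAt).comp t (by fun_prop)
  · intro t ht
    simp only
    rw [smoothTransition.one_of_one_le, one_mul]
    rw [le_sub_iff_add_le, le_div_iff₀ hκ]
    linarith

/-- A smooth bump supported in `[-1, 1]` whose squared integer translates sum to one. -/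
def cosBump (t : ℝ) : ℝ :=
  sin (π / 2 * smoothTransition (t + 1)) * cos (π / 2 * smoothTransition t)

/-- The smooth step `sin² (π s / 2)`. -/
def sinSqStep (t : ℝ) : ℝ := sin (π / 2 * smoothTransition t) ^ 2

lemma contDiff_cosBump : ContDiff ℝ (⊤ : ℕ∞) cosBump := by
  unfold cosBump
  have h : ContDiff ℝ (⊤ : ℕ∞) smoothTransition := smoothTransition.contDiff
  have h1 : ContDiff ℝ (⊤ : ℕ∞) fun t : ℝ => smoothTransition (t + 1) :=
    h.comp (by fun_prop)
  fun_prop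

lemma cosBump_nonneg (t : ℝ) : 0 ≤ cosBump t := by
  unfold cosBump
  have hp := pi_pos
  refine mul_nonneg (sin_nonneg_of_nonneg_of_le_pi ?_ ?_)
    (cos_nonneg_of_neg_pi_div_two_le_of_le ?_ ?_)
  all_goals
    nlinarith [smoothTransition.nonneg t, smoothTransition.le_one t,
      smoothTransition.nonneg (t + 1), smoothTransition.le_one (t + 1)]

lemma cosBump_le_one (t : ℝ) : cosBump t ≤ 1 := by
  have h := abs_mul (sin (π / 2 * smoothTransition (t + 1))) (cos (π / 2 * smoothTransition t))
  exact (le_abs_self _).trans (h.le.trans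
    (mul_le_one₀ (abs_sin_le_one _) (abs_nonneg _) (abs_cos_le_one _)))

lemma abs_lt_one_of_cosBump_ne_zero {t : ℝ} (h : cosBump t ≠ 0) : |t| < 1 := by
  rw [abs_lt]
  constructor
  · by_contra! ht
    exact h (by simp [cosBump, smoothTransition.zero_of_nonpos (show t + 1 ≤ 0 by linarith)])
  · by_contra! ht
    exact h (by simp [cosBump, smoothTransition.one_of_one_le ht])

lemma cosBump_sq (t : ℝ) : cosBump t ^ 2 = sinSqStep (t + 1) - sinSqStep t := by
  unfold cosBump sinSqStep
  rcases le_total t 0 with ht | ht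
  · simp [smoothTransition.zero_of_nonpos ht]
  · rw [smoothTransition.one_of_one_le (show 1 ≤ t + 1 by linarith)]
    simp [cos_sq']

lemma cosBump_le (t : ℝ) :
    cosBump t ≤ smoothTransition (t + 2) - smoothTransition (t - 1) := by
  by_cases h : cosBump t = 0
  · rw [h, sub_nonneg]
    rcases le_total t 1 with ht | ht
    · rw [smoothTransition.zero_of_nonpos (x := t - 1) (by linarith)]
      exact smoothTransition.nonneg _
    · rw [smoothTransition.one_of_one_le (x := t + 2) (by linarith)]
      exact smoothTransition.le_one _
  · have := abs_lt.1 (abs_lt_one_of_cosBump_ne_zero h)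
    rw [smoothTransition.one_of_one_le (x := t + 2) (by linarith),
      smoothTransition.zero_of_nonpos (x := t - 1) (by linarith), sub_zero]
    exact cosBump_le_one t

lemma sum_cosBump_sq {u : ℝ} {M : ℕ} (h0 : 0 ≤ u) (hM : u + 1 ≤ M) :
    ∑ m ∈ Finset.range M, cosBump (u - m) ^ 2 = 1 := by
  have h : ∀ m : ℕ, cosBump (u - m) ^ 2
      = sinSqStep (u + 1 - m) - sinSqStep (u + 1 - (m + 1 : ℕ)) := by
    intro m
    rw [cosBump_sq]
    push_cast
    congr 2 <;> ring
  simp_rw [h]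
  rw [Finset.sum_range_sub']
  simp [sinSqStep, smoothTransition.one_of_one_le (x := u + 1) (by linarith),
    smoothTransition.zero_of_nonpos (x := u + 1 - M) (by linarith)]

lemma sum_cosBump_le (u : ℝ) (M : ℕ) :
    ∑ m ∈ Finset.range M, cosBump (u - m) ≤ 3 := by
  have key : ∀ z : ℝ, ∑ m ∈ Finset.range M,
      (smoothTransition (z - m) - smoothTransition (z - (m + 1 : ℕ))) ≤ 1 := by
    intro z
    rw [Finset.sum_range_sub' (fun m : ℕ => smoothTransition (z - m))]
    have := smoothTransition.le_one (z - (0 : ℕ))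
    have := smoothTransition.nonneg (z - M)
    linarith
  calc _ ≤ ∑ m ∈ Finset.range M,
        ((smoothTransition (u + 2 - m) - smoothTransition (u + 2 - (m + 1 : ℕ)))
        + (smoothTransition (u + 1 - m) - smoothTransition (u + 1 - (m + 1 : ℕ)))
        + (smoothTransition (u - m) - smoothTransition (u - (m + 1 : ℕ)))) := by
        refine Finset.sum_le_sum fun m _ => (cosBump_le _).trans (le_of_eq ?_)
        push_cast
        rw [show u + 2 - ((m : ℝ) + 1) = u + 1 - m by ring,
          show u + 1 - ((m : ℝ) + 1) = u - m by ring,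
          show u - m + 2 = u + 2 - (m : ℝ) by ring,
          show u - m - 1 = u - ((m : ℝ) + 1) by ring]
        ring
    _ ≤ 3 := by
        rw [Finset.sum_add_distrib, Finset.sum_add_distrib]
        linarith [key (u + 2), key (u + 1), key u]

lemma exists_smooth_sq_partition_real (R : ℝ) {ρ : ℝ} (hρ : 0 < ρ) :
    ∃ (M : ℕ) (θ : Fin M → ℝ → ℝ), (∀ m, ContDiff ℝ (⊤ : ℕ∞) (θ m)) ∧ (∀ m t, 0 ≤ θ m t) ∧
      (∀ t, |t| ≤ R → ∑ m, θ m t ^ 2 = 1) ∧ (∀ t, ∑ m, θ m t ≤ 3) ∧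
      ∀ m s t, θ m s ≠ 0 → θ m t ≠ 0 → |s - t| < ρ := by
  obtain ⟨M, hM⟩ := exists_nat_ge ((R + R) * (2 / ρ) + 1)
  have h2 : 0 < 2 / ρ := by positivity
  refine ⟨M, fun m t => cosBump ((t + R) * (2 / ρ) - (m : ℕ)), fun m => ?_,
    fun m t => cosBump_nonneg _, fun t ht => ?_, fun t => ?_, fun m s t hs ht => ?_⟩
  · exact contDiff_cosBump.comp (by fun_prop)
  · rw [Fin.sum_univ_eq_sum_range (fun m : ℕ => cosBump ((t + R) * (2 / ρ) - m) ^ 2)]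
    rw [abs_le] at ht
    exact sum_cosBump_sq (mul_nonneg (by linarith) h2.le) (by nlinarith)
  · rw [Fin.sum_univ_eq_sum_range (fun m : ℕ => cosBump ((t + R) * (2 / ρ) - m))]
    exact sum_cosBump_le _ _
  · have h1 := abs_lt.1 (abs_lt_one_of_cosBump_ne_zero hs)
    have h3 := abs_lt.1 (abs_lt_one_of_cosBump_ne_zero ht)
    have h4 : |(s - t) * (2 / ρ)| < 2 := by
      rw [abs_lt]; constructor <;> linarith
    rw [abs_mul, abs_of_pos h2, mul_div_assoc', div_lt_iff₀ hρ] at h4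
    linarith

lemma exists_smooth_sq_partition (d : ℕ) (R : ℝ) {ρ : ℝ} (hρ : 0 < ρ) :
    ∃ (M : ℕ) (χ : (Fin d → Fin M) → (Fin d → ℝ) → ℝ),
      (∀ j, ContDiff ℝ (⊤ : ℕ∞) (χ j)) ∧ (∀ j x, 0 ≤ χ j x) ∧
      (∀ x, ‖x‖ ≤ R → ∑ j, χ j x ^ 2 = 1) ∧ (∀ x, ∑ j, χ j x ≤ 3 ^ d) ∧
      ∀ j x y, χ j x ≠ 0 → χ j y ≠ 0 → dist x y < ρ := by
  obtain ⟨M, θ, hs, h0, h1, h3, hd⟩ := exists_smooth_sq_partition_real R hρ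
  refine ⟨M, fun j x => ∏ i, θ (j i) (x i), fun j => ?_, fun j x => ?_, fun x hx => ?_,
    fun x => ?_, fun j x y hx hy => ?_⟩
  · exact contDiff_prod fun i _ => (hs _).comp (contDiff_apply ℝ ℝ i)
  · exact Finset.prod_nonneg fun i _ => h0 _ _
  · simp_rw [← Finset.prod_pow]
    rw [← Fintype.prod_sum (fun i m => θ m (x i) ^ 2)]
    exact Finset.prod_eq_one fun i _ => h1 _ ((norm_le_pi_norm x i).trans hx)
  · rw [← Fintype.prod_sum (fun (i : Fin d) (m : Fin M) => θ m (x i))]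
    calc ∏ i, ∑ m, θ m (x i) ≤ ∏ _i : Fin d, (3 : ℝ) :=
          Finset.prod_le_prod (fun i _ => Finset.sum_nonneg fun m _ => h0 _ _) fun i _ => h3 _
      _ = 3 ^ d := by simp
  · rw [dist_pi_lt_iff hρ]
    exact fun i => hd _ _ _ (Finset.prod_ne_zero_iff.1 hx i (Finset.mem_univ i))
      (Finset.prod_ne_zero_iff.1 hy i (Finset.mem_univ i))

/-! ### Corrugation -/

/-- The fast oscillation `μ b(x) sin (n μ⁻¹ L x)`. -/
def fastOsc {d : ℕ} (μ n : ℝ) (L : (Fin d → ℝ) →L[ℝ] ℝ) (b : (Fin d → ℝ) → ℝ)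
    (x : Fin d → ℝ) : ℝ :=
  μ * (b x * sin (n / μ * L x))

lemma contDiff_fastOsc {d : ℕ} (μ n : ℝ) (L : (Fin d → ℝ) →L[ℝ] ℝ) {b : (Fin d → ℝ) → ℝ}
    (hb : ContDiff ℝ (⊤ : ℕ∞) b) : ContDiff ℝ (⊤ : ℕ∞) (fastOsc μ n L b) := by
  unfold fastOsc
  fun_prop

lemma abs_fastOsc_le {d : ℕ} {μ : ℝ} (hμ : 0 ≤ μ) (n : ℝ) (L : (Fin d → ℝ) →L[ℝ] ℝ)
    (b : (Fin d → ℝ) → ℝ) (x : Fin d → ℝ) : |fastOsc μ n L b x| ≤ μ * |b x| := by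
  rw [fastOsc, abs_mul, abs_mul, abs_of_nonneg hμ]
  gcongr
  exact mul_le_of_le_one_right (abs_nonneg _) (abs_sin_le_one _)

lemma hasFDerivAt_fastOsc {d : ℕ} {μ : ℝ} (hμ : μ ≠ 0) (n : ℝ) (L : (Fin d → ℝ) →L[ℝ] ℝ)
    {b : (Fin d → ℝ) → ℝ} {x : Fin d → ℝ} (hb : DifferentiableAt ℝ b x) :
    HasFDerivAt (fastOsc μ n L b)
      ((n * b x * cos (n / μ * L x)) • L + (μ * sin (n / μ * L x)) • fderiv ℝ b x) x := by
  have h := ((hb.hasFDerivAt).mul ((L.hasFDerivAt (x := x)).const_mul (n / μ)).sin).const_mul μ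
  refine h.congr_fderiv ?_
  ext y
  simp
  field_simp

lemma norm_fderiv_pi_le {d : ℕ} {ι : Type*} [Fintype ι] {f : (Fin d → ℝ) → ι → ℝ}
    {f' : ι → (Fin d → ℝ) →L[ℝ] ℝ} {x : Fin d → ℝ} {C : ℝ} (hC : 0 ≤ C)
    (hf : ∀ l, HasFDerivAt (fun y => f y l) (f' l) x) (hb : ∀ l, ‖f' l‖ ≤ C) :
    ‖fderiv ℝ f x‖ ≤ C := by
  rw [(hasFDerivAt_pi.2 hf).fderiv]
  refine ContinuousLinearMap.opNorm_le_bound _ hC fun y => ?_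
  rw [pi_norm_le_iff_of_nonneg (by positivity)]
  intro l
  exact ((f' l).le_opNorm y).trans (by gcongr; exact hb l)

lemma norm_fderiv_apply_le {d : ℕ} {ι : Type*} [Fintype ι] {f : (Fin d → ℝ) → ι → ℝ}
    {x : Fin d → ℝ} (hf : DifferentiableAt ℝ f x) (l : ι) :
    ‖fderiv ℝ (fun y => f y l) x‖ ≤ ‖fderiv ℝ f x‖ := by
  rw [(hasFDerivAt_pi'.1 hf.hasFDerivAt l).fderiv]
  refine ContinuousLinearMap.opNorm_le_bound _ (norm_nonneg _) fun y => ?_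
  exact (norm_le_pi_norm (fderiv ℝ f x y) l).trans ((fderiv ℝ f x).le_opNorm y)

lemma abs_apply_single_le {d : ℕ} (L : (Fin d → ℝ) →L[ℝ] ℝ) (i : Fin d) :
    |L (Pi.single i 1)| ≤ ‖L‖ := by
  simpa [Pi.norm_single] using L.le_opNorm (Pi.single i 1)

lemma contDiff_pd {d : ℕ} {f : (Fin d → ℝ) → ℝ} (hf : ContDiff ℝ (⊤ : ℕ∞) f) (i : Fin d) :
    ContDiff ℝ (⊤ : ℕ∞) (pd i f) := by
  unfold pd
  exact (hf.fderiv_right (m := ((⊤ : ℕ∞) : WithTop ℕ∞)) (by simp)).clm_apply contDiff_const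

lemma contDiff_deficit_apply {d k : ℕ} {A : (Fin d → ℝ) → Fin d → Fin d → ℝ}
    {v : (Fin d → ℝ) → Fin k → ℝ} {w : (Fin d → ℝ) → Fin d → ℝ}
    (hA : ContDiff ℝ (⊤ : ℕ∞) A) (hv : ContDiff ℝ (⊤ : ℕ∞) v) (hw : ContDiff ℝ (⊤ : ℕ∞) w)
    (i j : Fin d) : ContDiff ℝ (⊤ : ℕ∞) fun x => deficit A v w x i j := by
  have hA' : ContDiff ℝ (⊤ : ℕ∞) fun x => A x i j := contDiff_pi.1 (contDiff_pi.1 hA i) j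
  have hv' := fun (i : Fin d) l => contDiff_pd (contDiff_pi.1 hv l) i
  have hw' := fun (i : Fin d) l => contDiff_pd (contDiff_pi.1 hw l) i
  unfold deficit gradTgrad symGrad
  refine hA'.sub (((contDiff_const).mul (ContDiff.sum fun l _ => (hv' i l).mul (hv' j l))).add ?_)
  exact ((hw' i j).add (hw' j i)).div_const 2

lemma deficit_symm {d k : ℕ} {A : (Fin d → ℝ) → Fin d → Fin d → ℝ}
    (hA : ∀ x i j, A x i j = A x j i) (v : (Fin d → ℝ) → Fin k → ℝ)
    (w : (Fin d → ℝ) → Fin d → ℝ) (x : Fin d → ℝ) (i j : Fin d) :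
    deficit A v w x i j = deficit A v w x j i := by
  simp only [deficit, gradTgrad, symGrad, hA x i j, mul_comm, add_comm]

/-- The pointwise algebra behind the cancellation in a corrugation step. -/
lemma corrugation_identity (p₁ p₂ a e₁ e₂ s c s₂ c₂ μ r₁ r₂ D B b₁₂ b₂₁ q₁ q₂ : ℝ)
    (hc : c₂ = 2 * c ^ 2 - 1) (hB : 1 ≤ B) (hμ : 0 ≤ μ) (hμ1 : μ ≤ 1)
    (hp₁ : |p₁| ≤ B) (hp₂ : |p₂| ≤ B) (ha : |a| ≤ B) (he₁ : |e₁| ≤ B) (he₂ : |e₂| ≤ B)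
    (hs : |s| ≤ 1) (hc1 : |c| ≤ 1) (hs₂ : |s₂| ≤ 1) (hr₁ : |r₁| ≤ 2 * B) (hr₂ : |r₂| ≤ 2 * B)
    (hb₁ : |b₁₂| ≤ B) (hb₂ : |b₂₁| ≤ B) (hq₁ : |q₁| ≤ B) (hq₂ : |q₂| ≤ B) :
    |(D - ((1 / 2) * ((p₁ + (2 * a * c * e₁ + μ * s * r₁)) * (p₂ + (2 * a * c * e₂ + μ * s * r₂))
        - p₁ * p₂)
      + ((-(2 * a * p₂ * c * e₁ + μ * s * b₁₂) - (2 * (a ^ 2 * e₂ / 2) * c₂ * e₁ + μ * s₂ * q₁))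
      + (-(2 * a * p₁ * c * e₂ + μ * s * b₂₁)
        - (2 * (a ^ 2 * e₁ / 2) * c₂ * e₂ + μ * s₂ * q₂))) / 2))
      - (D - a ^ 2 * (e₁ * e₂))| ≤ μ * (10 * B ^ 3) := by
  have hid : (D - ((1 / 2) * ((p₁ + (2 * a * c * e₁ + μ * s * r₁))
        * (p₂ + (2 * a * c * e₂ + μ * s * r₂))
        - p₁ * p₂)
      + ((-(2 * a * p₂ * c * e₁ + μ * s * b₁₂) - (2 * (a ^ 2 * e₂ / 2) * c₂ * e₁ + μ * s₂ * q₁))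
      + (-(2 * a * p₁ * c * e₂ + μ * s * b₂₁)
        - (2 * (a ^ 2 * e₁ / 2) * c₂ * e₂ + μ * s₂ * q₂))) / 2))
      - (D - a ^ 2 * (e₁ * e₂)) =
      μ * (-(1 / 2) * ((p₁ + 2 * a * c * e₁) * (s * r₂) + (s * r₁) * (p₂ + 2 * a * c * e₂)
        + μ * (s * r₁) * (s * r₂)) + (s * b₁₂ + s₂ * q₁ + s * b₂₁ + s₂ * q₂) / 2) := by
    rw [hc]; ring
  rw [hid, abs_mul, abs_of_nonneg hμ]
  have hB0 : 0 ≤ B := by linarith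
  have hm : ∀ {x y X Y : ℝ}, |x| ≤ X → |y| ≤ Y → |x * y| ≤ X * Y := fun hx hy => by
    rw [abs_mul]; exact mul_le_mul hx hy (abs_nonneg _) ((abs_nonneg _).trans hx)
  have ha2 : |2 * a| ≤ 2 * B := by rw [abs_mul, abs_two]; linarith
  have hμ' : |μ| ≤ 1 := by rwa [abs_of_nonneg hμ]
  have h1 := abs_le.1 (hm (hm (hm ha2 hc1) he₁) (hm hs hr₂))
  have h2 := abs_le.1 (hm (hm hs hr₁) (hm (hm ha2 hc1) he₂))
  have h3 := abs_le.1 (hm hp₁ (hm hs hr₂))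
  have h4 := abs_le.1 (hm (hm hs hr₁) hp₂)
  have h5 := abs_le.1 (hm (hm hμ' (hm hs hr₁)) (hm hs hr₂))
  have h6 := abs_le.1 (hm hs hb₁)
  have h7 := abs_le.1 (hm hs hb₂)
  have h8 := abs_le.1 (hm hs₂ hq₁)
  have h9 := abs_le.1 (hm hs₂ hq₂)
  have hB2 : B ≤ B ^ 2 := by nlinarith
  have hB3 : B ^ 2 ≤ B ^ 3 := by nlinarith [sq_nonneg B]
  gcongr
  rw [abs_le]
  constructor <;> linarith

lemma corrugation_step {d k : ℕ} {K : Set (Fin d → ℝ)} (hK : IsCompact K) (l₀ : Fin k)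
    (A : (Fin d → ℝ) → Fin d → Fin d → ℝ)
    {v : (Fin d → ℝ) → Fin k → ℝ} {w : (Fin d → ℝ) → Fin d → ℝ}
    (hv : ContDiff ℝ (⊤ : ℕ∞) v) (hw : ContDiff ℝ (⊤ : ℕ∞) w)
    {a : (Fin d → ℝ) → ℝ} (ha : ContDiff ℝ (⊤ : ℕ∞) a) (L : (Fin d → ℝ) →L[ℝ] ℝ)
    {τ : ℝ} (hτ : 0 < τ) :
    ∃ (vt : (Fin d → ℝ) → Fin k → ℝ) (wt : (Fin d → ℝ) → Fin d → ℝ),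
      ContDiff ℝ (⊤ : ℕ∞) vt ∧ ContDiff ℝ (⊤ : ℕ∞) wt ∧ ∀ x ∈ K,
        ‖vt x - v x‖ ≤ τ ∧ ‖wt x - w x‖ ≤ τ ∧
        ‖fderiv ℝ (fun y => vt y - v y) x‖ ≤ 2 * |a x| * ‖L‖ + τ ∧
        ‖fderiv ℝ (fun y => wt y - w y) x‖
          ≤ 2 * |a x| * ‖L‖ * (‖fderiv ℝ v x‖ + 2 * |a x| * ‖L‖) + τ ∧
        ∀ i j, |deficit A vt wt x i j - (deficit A v w x i j
          - a x ^ 2 * (L (Pi.single i 1) * L (Pi.single j 1)))| ≤ τ := by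
  set P : Fin d → (Fin d → ℝ) → ℝ := fun i => pd i fun y => v y l₀ with hP
  have hvl : ∀ l, ContDiff ℝ (⊤ : ℕ∞) fun y => v y l := contDiff_pi.1 hv
  have hwl : ∀ l, ContDiff ℝ (⊤ : ℕ∞) fun y => w y l := contDiff_pi.1 hw
  have hPs : ∀ i, ContDiff ℝ (⊤ : ℕ∞) (P i) := fun i => contDiff_pd (hvl l₀) i
  set α : (Fin d → ℝ) → ℝ := fun x => 2 * a x with hα
  set β : Fin d → (Fin d → ℝ) → ℝ := fun i x => 2 * a x * P i x with hβ
  set γ : Fin d → (Fin d → ℝ) → ℝ := fun i x => a x ^ 2 * L (Pi.single i 1) / 2 with hγ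
  have hαs : ContDiff ℝ (⊤ : ℕ∞) α := contDiff_const.mul ha
  have hβs : ∀ i, ContDiff ℝ (⊤ : ℕ∞) (β i) := fun i => hαs.mul (hPs i)
  have hγs : ∀ i, ContDiff ℝ (⊤ : ℕ∞) (γ i) := fun i =>
    ((ha.pow 2).mul contDiff_const).div_const 2
  have hfd : ∀ {f : (Fin d → ℝ) → ℝ}, ContDiff ℝ (⊤ : ℕ∞) f → Continuous (fderiv ℝ f) :=
    fun hf => hf.continuous_fderiv (by simp)
  obtain ⟨B, hB1, hB⟩ : ∃ B : ℝ, 1 ≤ B ∧ ∀ x ∈ K, |a x| ≤ B ∧ ‖fderiv ℝ α x‖ ≤ B ∧ ‖L‖ ≤ B ∧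
      ∀ i, |P i x| ≤ B ∧ |β i x| ≤ B ∧ |γ i x| ≤ B ∧ ‖fderiv ℝ (β i) x‖ ≤ B ∧
        ‖fderiv ℝ (γ i) x‖ ≤ B := by
    set G : (Fin d → ℝ) → ℝ := fun x => 1 + |a x| + ‖fderiv ℝ α x‖ + ‖L‖ +
      ∑ i, (|P i x| + |β i x| + |γ i x| + ‖fderiv ℝ (β i) x‖ + ‖fderiv ℝ (γ i) x‖) with hG
    have hGc : Continuous G := by
      have h1 := ha.continuous
      have h2 := hfd hαs
      have h3 := fun i => (hPs i).continuous
      have h4 := fun i => (hβs i).continuous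
      have h5 := fun i => (hγs i).continuous
      have h6 := fun i => hfd (hβs i)
      have h7 := fun i => hfd (hγs i)
      fun_prop
    obtain ⟨B, hB⟩ := hK.exists_bound_of_continuousOn hGc.continuousOn
    refine ⟨max B 1, le_max_right _ _, fun x hx => ?_⟩
    have hGx : G x ≤ max B 1 := (le_abs_self _).trans ((hB x hx).trans (le_max_left _ _))
    have hnn : ∀ i, 0 ≤ |P i x| + |β i x| + |γ i x| + ‖fderiv ℝ (β i) x‖
      + ‖fderiv ℝ (γ i) x‖ := fun i => by positivity
    have hsum := Finset.sum_nonneg fun i (_ : i ∈ Finset.univ) => hnn i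
    have n1 := abs_nonneg (a x)
    have n2 := norm_nonneg (fderiv ℝ α x)
    have n3 := norm_nonneg L
    simp only [hG] at hGx
    refine ⟨by linarith, by linarith, by linarith, fun i => ?_⟩
    have hi := Finset.single_le_sum (fun i _ => hnn i) (Finset.mem_univ i)
    have m1 := abs_nonneg (P i x)
    have m2 := abs_nonneg (β i x)
    have m3 := abs_nonneg (γ i x)
    have m4 := norm_nonneg (fderiv ℝ (β i) x)
    have m5 := norm_nonneg (fderiv ℝ (γ i) x)
    refine ⟨?_, ?_, ?_, ?_, ?_⟩ <;> linarith
  have hB0 : 0 < B := by linarith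
  set μ := min 1 (τ / (10 * B ^ 3)) with hμ
  have hμ0 : 0 < μ := lt_min one_pos (by positivity)
  have hμ1 : μ ≤ 1 := min_le_left _ _
  have hμτ : μ * (10 * B ^ 3) ≤ τ := by
    rw [← le_div_iff₀ (by positivity)]; exact min_le_right _ _
  have hB3 : B ≤ B ^ 3 := le_self_pow₀ hB1 (by norm_num)
  have hμB : 10 * (μ * B) ≤ τ := by nlinarith
  set vt : (Fin d → ℝ) → Fin k → ℝ :=
    fun y l => v y l + if l = l₀ then fastOsc μ 1 L α y else 0 with hvt
  set wt : (Fin d → ℝ) → Fin d → ℝ :=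
    fun y i => w y i + (-fastOsc μ 1 L (β i) y - fastOsc μ 2 L (γ i) y) with hwt
  have dα := fun x => hasFDerivAt_fastOsc hμ0.ne' 1 L
    (hαs.differentiable (by simp) : Differentiable ℝ α).differentiableAt (x := x)
  have dW := fun i x => (hasFDerivAt_fastOsc hμ0.ne' 1 L ((hβs i).differentiable
      (by simp)).differentiableAt (x := x)).neg.sub
    (hasFDerivAt_fastOsc hμ0.ne' 2 L ((hγs i).differentiable
      (by simp)).differentiableAt (x := x))
  have dV : ∀ l x, HasFDerivAt (fun y => if l = l₀ then fastOsc μ 1 L α y else 0)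
      (if l = l₀ then ((1 * α x * cos (1 / μ * L x)) • L
        + (μ * sin (1 / μ * L x)) • fderiv ℝ α x) else 0) x := by
    intro l x
    split_ifs
    · exact dα x
    · exact hasFDerivAt_const _ _
  have dv : ∀ l x, HasFDerivAt (fun y => v y l) (fderiv ℝ (fun y => v y l) x) x := fun l x =>
    ((hvl l).differentiable (by simp)).differentiableAt.hasFDerivAt
  have dw : ∀ l x, HasFDerivAt (fun y => w y l) (fderiv ℝ (fun y => w y l) x) x := fun l x =>
    ((hwl l).differentiable (by simp)).differentiableAt.hasFDerivAt
  refine ⟨vt, wt, ?_, ?_, fun x hx => ?_⟩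
  · refine contDiff_pi.2 fun l => (hvl l).add ?_
    split_ifs
    · exact contDiff_fastOsc _ _ _ hαs
    · exact contDiff_const
  · exact contDiff_pi.2 fun i => (hwl i).add
      ((contDiff_fastOsc _ _ _ (hβs i)).neg.sub (contDiff_fastOsc _ _ _ (hγs i)))
  obtain ⟨hBa, hBα, hBL, hBi⟩ := hB x hx
  have hs1 := abs_sin_le_one (1 / μ * L x)
  have hc1 := abs_cos_le_one (1 / μ * L x)
  have hs2 := abs_sin_le_one (2 / μ * L x)
  have hc2 := abs_cos_le_one (2 / μ * L x)
  have hL0 := norm_nonneg L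
  have ha0 := abs_nonneg (a x)
  have hosc : ∀ (s : ℝ) (T : (Fin d → ℝ) →L[ℝ] ℝ), |s| ≤ 1 → ‖T‖ ≤ B →
      ‖(μ * s) • T‖ ≤ μ * B := by
    intro s T hs hT
    rw [norm_smul, norm_mul, Real.norm_of_nonneg hμ0.le, Real.norm_eq_abs]
    calc μ * |s| * ‖T‖ ≤ μ * 1 * B := by gcongr
      _ = μ * B := by ring
  have hlead : ∀ (b c : ℝ), |c| ≤ 1 → ‖(b * c) • L‖ ≤ |b| * ‖L‖ := by
    intro b c hc
    rw [norm_smul, norm_mul, Real.norm_eq_abs, Real.norm_eq_abs]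
    gcongr
    exact mul_le_of_le_one_right (abs_nonneg _) hc
  have hα2 : |α x| = 2 * |a x| := by simp [hα, abs_mul]
  have hPv : ∀ i, |P i x| ≤ ‖fderiv ℝ v x‖ := fun i =>
    (abs_apply_single_le (fderiv ℝ (fun y => v y l₀) x) i).trans
      (norm_fderiv_apply_le (hv.differentiable (by simp)).differentiableAt l₀)
  refine ⟨?_, ?_, ?_, ?_, fun i j => ?_⟩
  · rw [pi_norm_le_iff_of_nonneg hτ.le]
    intro l
    simp only [hvt, Pi.sub_apply, add_sub_cancel_left]
    split_ifs
    · refine (abs_fastOsc_le hμ0.le _ _ _ _).trans ?_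
      rw [hα2]
      nlinarith
    · simpa using hτ.le
  · rw [pi_norm_le_iff_of_nonneg hτ.le]
    intro i
    simp only [hwt, Pi.sub_apply, add_sub_cancel_left]
    obtain ⟨-, h1, h2, -, -⟩ := hBi i
    refine (norm_sub_le _ _).trans ?_
    rw [norm_neg]
    have h3 := abs_fastOsc_le hμ0.le 1 L (β i) x
    have h4 := abs_fastOsc_le hμ0.le 2 L (γ i) x
    rw [Real.norm_eq_abs, Real.norm_eq_abs]
    nlinarith
  · refine norm_fderiv_pi_le (by positivity) (fun l => ?_) (f' := fun l => if l = l₀ then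
      ((1 * α x * cos (1 / μ * L x)) • L + (μ * sin (1 / μ * L x)) • fderiv ℝ α x) else 0)
      fun l => ?_
    · simpa only [hvt, Pi.sub_apply, add_sub_cancel_left] using dV l x
    · split_ifs
      · refine (norm_add_le _ _).trans (add_le_add ?_ ?_)
        · simpa [hα2] using hlead (1 * α x) _ hc1
        · exact (hosc _ _ hs1 hBα).trans (by nlinarith)
      · rw [norm_zero]; positivity
  · have dW' : ∀ i, HasFDerivAt (fun y => (wt y - w y) i) _ x := fun i => by
      simp only [hwt, Pi.sub_apply, add_sub_cancel_left]
      exact dW i x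
    refine norm_fderiv_pi_le (by positivity) dW' fun i => ?_
    · obtain ⟨-, -, -, h1, h2⟩ := hBi i
      refine (norm_sub_le _ _).trans ?_
      rw [norm_neg]
      have k1 := norm_add_le ((1 * β i x * cos (1 / μ * L x)) • L)
        ((μ * sin (1 / μ * L x)) • fderiv ℝ (β i) x)
      have k2 := norm_add_le ((2 * γ i x * cos (2 / μ * L x)) • L)
        ((μ * sin (2 / μ * L x)) • fderiv ℝ (γ i) x)
      have k3 := hlead (1 * β i x) _ hc1
      have k4 := hlead (2 * γ i x) _ hc2
      have k5 := hosc _ _ hs1 h1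
      have k6 := hosc _ _ hs2 h2
      have k7 : |1 * β i x| * ‖L‖ ≤ 2 * |a x| * ‖L‖ * ‖fderiv ℝ v x‖ := by
        rw [one_mul, abs_mul, hα2, mul_right_comm]
        gcongr
        exact hPv i
      have k8 : |2 * γ i x| * ‖L‖ ≤ 2 * |a x| * ‖L‖ * (2 * |a x| * ‖L‖) := by
        have : |2 * γ i x| = |a x| ^ 2 * |L (Pi.single i 1)| := by
          rw [← abs_pow, ← abs_mul]; congr 1; simp only [hγ]; ring
        rw [this]
        have hh := abs_apply_single_le L i
        have : |a x| ^ 2 * |L (Pi.single i 1)| * ‖L‖ ≤ |a x| ^ 2 * ‖L‖ * ‖L‖ := by gcongr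
        nlinarith [mul_nonneg ha0 hL0]
      linarith
  · have e1 : ∀ (i : Fin d) (l : Fin k), pd i (fun y => vt y l) x = pd i (fun y => v y l) x
        + if l = l₀ then (2 * a x * cos (1 / μ * L x) * L (Pi.single i 1)
          + μ * sin (1 / μ * L x) * fderiv ℝ α x (Pi.single i 1)) else 0 := by
      intro i l
      have h : HasFDerivAt (fun y => vt y l) _ x := (dv l x).add (dV l x)
      rw [pd, h.fderiv]
      split_ifs <;> simp [pd, hα]
    have e2 : ∀ i j : Fin d, pd i (fun y => wt y j) x = pd i (fun y => w y j) x
        + (-(2 * a x * P j x * cos (1 / μ * L x) * L (Pi.single i 1)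
            + μ * sin (1 / μ * L x) * fderiv ℝ (β j) x (Pi.single i 1))
          - (2 * (a x ^ 2 * L (Pi.single j 1) / 2) * cos (2 / μ * L x) * L (Pi.single i 1)
            + μ * sin (2 / μ * L x) * fderiv ℝ (γ j) x (Pi.single i 1))) := by
      intro i j
      have h : HasFDerivAt (fun y => wt y j) _ x := (dw j x).add (dW j x)
      rw [pd, h.fderiv]
      simp [pd, hβ, hγ]
    have hg : gradTgrad vt x i j = gradTgrad v x i j +
        ((P i x + (2 * a x * cos (1 / μ * L x) * L (Pi.single i 1)
          + μ * sin (1 / μ * L x) * fderiv ℝ α x (Pi.single i 1)))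
        * (P j x + (2 * a x * cos (1 / μ * L x) * L (Pi.single j 1)
          + μ * sin (1 / μ * L x) * fderiv ℝ α x (Pi.single j 1))) - P i x * P j x) := by
      unfold gradTgrad
      rw [← sub_eq_iff_eq_add', ← Finset.sum_sub_distrib, Finset.sum_eq_single l₀]
      · simp only [e1, if_true, hP]
      · intro l _ hl
        simp [e1, hl]
      · simp
    have hcos : cos (2 / μ * L x) = 2 * cos (1 / μ * L x) ^ 2 - 1 := by
      rw [← cos_two_mul]; congr 1; ring
    have hap : ∀ {T : (Fin d → ℝ) →L[ℝ] ℝ} (i : Fin d), ‖T‖ ≤ B → |T (Pi.single i 1)| ≤ B :=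
      fun i hT => (abs_apply_single_le _ i).trans hT
    have hap2 : ∀ {T : (Fin d → ℝ) →L[ℝ] ℝ} (i : Fin d), ‖T‖ ≤ B → |T (Pi.single i 1)| ≤ 2 * B :=
      fun i hT => (hap i hT).trans (by linarith)
    have key := corrugation_identity (P i x) (P j x) (a x) (L (Pi.single i 1))
      (L (Pi.single j 1)) (sin (1 / μ * L x)) (cos (1 / μ * L x)) (sin (2 / μ * L x))
      (cos (2 / μ * L x)) μ (fderiv ℝ α x (Pi.single i 1)) (fderiv ℝ α x (Pi.single j 1))
      (deficit A v w x i j) B (fderiv ℝ (β j) x (Pi.single i 1))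
      (fderiv ℝ (β i) x (Pi.single j 1)) (fderiv ℝ (γ j) x (Pi.single i 1))
      (fderiv ℝ (γ i) x (Pi.single j 1)) hcos hB1 hμ0.le hμ1 (hBi i).1 (hBi j).1 hBa
      (hap i hBL) (hap j hBL) hs1 hc1 hs2 (hap2 i hBα) (hap2 j hBα)
      (hap i (hBi j).2.2.2.1) (hap j (hBi i).2.2.2.1) (hap i (hBi j).2.2.2.2)
      (hap j (hBi i).2.2.2.2)
    refine le_trans (le_of_eq ?_) (key.trans hμτ)
    congr 1
    simp only [deficit, symGrad, hg, e2]
    ring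

lemma corrugation_iterate {d k : ℕ} {K : Set (Fin d → ℝ)} (hK : IsCompact K) (l₀ : Fin k)
    (A : (Fin d → ℝ) → Fin d → Fin d → ℝ) {ι : Type*} (s : Finset ι)
    {a : ι → (Fin d → ℝ) → ℝ} (ha : ∀ n, ContDiff ℝ (⊤ : ℕ∞) (a n))
    (L : ι → (Fin d → ℝ) →L[ℝ] ℝ) {v : (Fin d → ℝ) → Fin k → ℝ}
    {w : (Fin d → ℝ) → Fin d → ℝ} (hv : ContDiff ℝ (⊤ : ℕ∞) v) (hw : ContDiff ℝ (⊤ : ℕ∞) w)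
    {τ : ℝ} (hτ : 0 < τ) :
    ∃ (vt : (Fin d → ℝ) → Fin k → ℝ) (wt : (Fin d → ℝ) → Fin d → ℝ),
      ContDiff ℝ (⊤ : ℕ∞) vt ∧ ContDiff ℝ (⊤ : ℕ∞) wt ∧ ∀ x ∈ K,
        ‖vt x - v x‖ ≤ τ ∧ ‖wt x - w x‖ ≤ τ ∧
        ‖fderiv ℝ (fun y => vt y - v y) x‖ ≤ (∑ n ∈ s, 2 * |a n x| * ‖L n‖) + τ ∧
        ‖fderiv ℝ (fun y => wt y - w y) x‖
          ≤ (∑ n ∈ s, 2 * |a n x| * ‖L n‖)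
            * (‖fderiv ℝ v x‖ + ∑ n ∈ s, 2 * |a n x| * ‖L n‖) + τ ∧
        ∀ i j, |deficit A vt wt x i j - (deficit A v w x i j
          - ∑ n ∈ s, a n x ^ 2 * (L n (Pi.single i 1) * L n (Pi.single j 1)))| ≤ τ := by
  classical
  induction s using Finset.induction_on generalizing v w τ with
  | empty => exact ⟨v, w, hv, hw, fun x _ => by simp [hτ.le]⟩
  | insert m s hm ih =>
    set S : (Fin d → ℝ) → ℝ := fun x => ∑ n ∈ s, 2 * |a n x| * ‖L n‖ with hS
    have hS0 : ∀ x, 0 ≤ S x := fun x => Finset.sum_nonneg fun n _ => by positivity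
    have hSc : Continuous S := by
      have h := fun n => (ha n).continuous
      fun_prop
    obtain ⟨B, hB⟩ := hK.exists_bound_of_continuousOn hSc.continuousOn
    have hB1 : 0 < 2 * (1 + |B|) := by positivity
    set τ₁ := τ / (2 * (1 + |B|)) with hτ₁
    have hτ₁0 : 0 < τ₁ := by positivity
    have hτ₁B : τ₁ + |B| * τ₁ = τ / 2 := by rw [hτ₁]; field_simp
    have hτ₁' : τ₁ ≤ τ / 2 := by nlinarith [abs_nonneg B]
    obtain ⟨v₁, w₁, hv₁, hw₁, h₁⟩ := corrugation_step hK l₀ A hv hw (ha m) (L m) hτ₁0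
    obtain ⟨v₂, w₂, hv₂, hw₂, h₂⟩ := ih hv₁ hw₁ (half_pos hτ)
    refine ⟨v₂, w₂, hv₂, hw₂, fun x hx => ?_⟩
    obtain ⟨a₁, b₁, c₁, d₁, e₁⟩ := h₁ x hx
    obtain ⟨a₂, b₂, c₂, d₂, e₂⟩ := h₂ x hx
    have df : ∀ {n : ℕ} {f : (Fin d → ℝ) → Fin n → ℝ}, ContDiff ℝ (⊤ : ℕ∞) f →
        DifferentiableAt ℝ f x := fun hf => (hf.differentiable (by simp)).differentiableAt
    have split : ∀ {n : ℕ} {f g h : (Fin d → ℝ) → Fin n → ℝ}, ContDiff ℝ (⊤ : ℕ∞) f →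
        ContDiff ℝ (⊤ : ℕ∞) g → ContDiff ℝ (⊤ : ℕ∞) h →
        ‖fderiv ℝ (fun y => f y - h y) x‖ ≤
          ‖fderiv ℝ (fun y => f y - g y) x‖ + ‖fderiv ℝ (fun y => g y - h y) x‖ := by
      intro n f g h hf hg hh
      rw [fderiv_fun_sub (df hf) (df hh), fderiv_fun_sub (df hf) (df hg),
        fderiv_fun_sub (df hg) (df hh)]
      exact norm_sub_le_norm_sub_add_norm_sub _ _ _
    have hv₁n : ‖fderiv ℝ v₁ x‖ ≤ ‖fderiv ℝ v x‖ + ‖fderiv ℝ (fun y => v₁ y - v y) x‖ := by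
      rw [fderiv_fun_sub (df hv₁) (df hv)]
      exact norm_le_norm_add_norm_sub' _ _
    have hSB : S x ≤ |B| := (le_abs_self _).trans ((hB x hx).trans (le_abs_self _))
    simp_rw [Finset.sum_insert hm]
    change _ ≤ S x * (_ + S x) + _ at d₂
    change _ ≤ S x + _ at c₂
    change _ ∧ _ ∧ _ ≤ 2 * |a m x| * ‖L m‖ + S x + τ ∧
      _ ≤ (2 * |a m x| * ‖L m‖ + S x) * (_ + (2 * |a m x| * ‖L m‖ + S x)) + τ ∧ _
    have hσ : 0 ≤ 2 * |a m x| * ‖L m‖ := by positivity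
    generalize 2 * |a m x| * ‖L m‖ = σ at *
    have hSx := hS0 x
    refine ⟨?_, ?_, ?_, ?_, fun i j => ?_⟩
    · have := norm_sub_le_norm_sub_add_norm_sub (v₂ x) (v₁ x) (v x)
      linarith
    · have := norm_sub_le_norm_sub_add_norm_sub (w₂ x) (w₁ x) (w x)
      linarith
    · have := split hv₂ hv₁ hv
      linarith
    · have h0 := split hw₂ hw₁ hw
      have h1 : S x * ‖fderiv ℝ v₁ x‖ ≤ S x * (‖fderiv ℝ v x‖ + (σ + τ₁)) := by
        gcongr; linarith
      have h2 : S x * τ₁ ≤ |B| * τ₁ := by gcongr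
      nlinarith [mul_nonneg hσ hSx]
    · have h := abs_le.1 (e₁ i j)
      have h' := abs_le.1 (e₂ i j)
      rw [abs_le]
      constructor <;> linarith

/-! ### Decomposition of the deficit -/

/-- The functional with coefficients `u`. -/
def dotCLM {d : ℕ} (u : Fin d → ℝ) : (Fin d → ℝ) →L[ℝ] ℝ :=
  ∑ i, u i • ContinuousLinearMap.proj i

lemma dotCLM_single {d : ℕ} (u : Fin d → ℝ) (i : Fin d) : dotCLM u (Pi.single i 1) = u i := by
  simp [dotCLM, Pi.single_apply]

lemma norm_dotCLM_le {d : ℕ} (u : Fin d → ℝ) : ‖dotCLM u‖ ≤ ∑ i, |u i| := by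
  refine ContinuousLinearMap.opNorm_le_bound _ (Finset.sum_nonneg fun i _ => abs_nonneg _)
    fun y => ?_
  simp only [dotCLM, _root_.sum_apply, _root_.smul_apply,
    ContinuousLinearMap.proj_apply, smul_eq_mul, Finset.sum_mul]
  refine (norm_sum_le _ _).trans (Finset.sum_le_sum fun i _ => ?_)
  rw [norm_mul, Real.norm_eq_abs]
  gcongr
  exact norm_le_pi_norm y i

open scoped MatrixOrder in
lemma exists_sum_rankOne {d : ℕ} {M : Fin d → Fin d → ℝ} (hs : ∀ i j, M i j = M j i)
    (hM : ∀ ξ : Fin d → ℝ, 0 ≤ ∑ i, ∑ j, M i j * ξ i * ξ j) :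
    ∃ B : Fin d → Fin d → ℝ, ∀ i j, M i j = ∑ m, B m i * B m j := by
  have hp : (Matrix.of M).PosSemidef := by
    refine Matrix.PosSemidef.of_dotProduct_mulVec_nonneg ?_ fun ξ => ?_
    · ext i j
      simp [hs i j]
    · refine (hM ξ).trans (le_of_eq ?_)
      simp only [dotProduct, Matrix.mulVec, Matrix.of_apply, Finset.mul_sum, star_trivial]
      exact Finset.sum_congr rfl fun i _ => Finset.sum_congr rfl fun j _ => by ring
  obtain ⟨B, hB⟩ := CStarAlgebra.nonneg_iff_eq_star_mul_self.1 hp.nonneg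
  refine ⟨B, fun i j => ?_⟩
  have := congrFun (congrFun hB i) j
  simpa [Matrix.mul_apply, Matrix.star_eq_conjTranspose] using this

/-- Near multiples of the identity, a symmetric matrix is a combination with controlled
coefficients of the squares of `eₚ + e_q` and `eₚ - e_q`. -/
lemma sum_rankOne_near_id {d : ℕ} {E : Fin d → Fin d → ℝ} (hE : ∀ i j, E i j = E j i) (κ : ℝ)
    (i j : Fin d) :
    ∑ p, ∑ q, ((κ + E p q / 4) * ((Pi.single p (1 : ℝ) + Pi.single q 1 : Fin d → ℝ) i
        * (Pi.single p (1 : ℝ) + Pi.single q 1 : Fin d → ℝ) j)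
      + (κ - E p q / 4) * ((Pi.single p (1 : ℝ) - Pi.single q 1 : Fin d → ℝ) i
        * (Pi.single p (1 : ℝ) - Pi.single q 1 : Fin d → ℝ) j))
      = (if i = j then 4 * d * κ else 0) + E i j := by
  have h : ∀ p q : Fin d, ((κ + E p q / 4) * ((Pi.single p (1 : ℝ) + Pi.single q 1 : Fin d → ℝ) i
        * (Pi.single p (1 : ℝ) + Pi.single q 1 : Fin d → ℝ) j)
      + (κ - E p q / 4) * ((Pi.single p (1 : ℝ) - Pi.single q 1 : Fin d → ℝ) i
        * (Pi.single p (1 : ℝ) - Pi.single q 1 : Fin d → ℝ) j))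
      = 2 * κ * ((if i = p then 1 else 0) * (if j = p then 1 else 0)
          + (if i = q then 1 else 0) * (if j = q then 1 else 0))
        + E p q / 2 * ((if i = p then 1 else 0) * (if j = q then 1 else 0)
          + (if i = q then 1 else 0) * (if j = p then 1 else 0)) := by
    intro p q
    simp only [Pi.add_apply, Pi.sub_apply, Pi.single_apply]
    ring
  simp_rw [h, mul_add, Finset.sum_add_distrib]
  have hEij := hE j i
  by_cases hij : i = j
  · subst hij
    simp
    ring
  · simp [hij]
    linarith

lemma abs_entry_le_norm {d : ℕ} (M : Fin d → Fin d → ℝ) (i j : Fin d) : |M i j| ≤ ‖M‖ :=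
  (norm_le_pi_norm (M i) j).trans (norm_le_pi_norm M i)

lemma MatGt.lt_diag {d : ℕ} {M : Fin d → Fin d → ℝ} {c : ℝ} (h : MatGt M c) (i : Fin d) :
    c < M i i := by
  simpa [Pi.single_apply] using h (Pi.single i 1) (by simp)

lemma exists_corrugation_decomposition {d : ℕ} (hd : 1 ≤ d) {K : Set (Fin d → ℝ)}
    (hK : IsCompact K) (hKne : K.Nonempty) {D : (Fin d → ℝ) → Fin d → Fin d → ℝ}
    (hDs : ∀ i j, ContDiff ℝ (⊤ : ℕ∞) fun x => D x i j) (hsymm : ∀ x i j, D x i j = D x j i)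
    {c N δ : ℝ} (hc : 0 < c) (hD : ∀ x ∈ K, MatGt (D x) c) (hN : ∀ x ∈ K, ‖D x‖ ≤ N)
    (hδ : 0 < δ) (hδc : δ ≤ c / (8 * d)) :
    ∃ (ι : Type) (_ : Fintype ι) (a : ι → (Fin d → ℝ) → ℝ) (L : ι → (Fin d → ℝ) →L[ℝ] ℝ),
      (∀ n, ContDiff ℝ (⊤ : ℕ∞) (a n)) ∧ ∀ x ∈ K,
        (∀ i j, D x i j - ∑ n, a n x ^ 2 * (L n (Pi.single i 1) * L n (Pi.single j 1))
          = if i = j then δ else 0) ∧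
        ∑ n, 2 * |a n x| * ‖L n‖ ≤ (2 * 3 ^ d * d ^ 2 + 8 * d ^ 2) * √N := by
  have hd0 : (0 : ℝ) < d := by exact_mod_cast hd
  have hd1 : (1 : ℝ) ≤ d := by exact_mod_cast hd
  obtain ⟨x₀, hx₀⟩ := hKne
  have hcN : c ≤ N := by
    let i₀ : Fin d := ⟨0, hd⟩
    exact ((hD x₀ hx₀).lt_diag i₀).le.trans ((le_abs_self _).trans
      ((abs_entry_le_norm _ _ _).trans (hN x₀ hx₀)))
  set κ : ℝ := c / (8 * d) with hκ
  have hκ0 : 0 < κ := by positivity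
  have hκc : 4 * d * κ = c / 2 := by rw [hκ]; field_simp; norm_num
  have hκN : 2 * κ ≤ N := by nlinarith
  have hDc : Continuous D := continuous_pi fun i => continuous_pi fun j => (hDs i j).continuous
  obtain ⟨ρ, hρ, hosc⟩ := Metric.uniformContinuousOn_iff.1
    (hK.uniformContinuousOn_of_continuous hDc.continuousOn) κ hκ0
  obtain ⟨R, hR⟩ := hK.isBounded.exists_norm_le
  obtain ⟨M, χ, hχs, hχ0, hχ1, hχ3, hχρ⟩ := exists_smooth_sq_partition d R hρ
  have hz : ∀ j, ∃ z ∈ K, ∀ x ∈ K, χ j x ≠ 0 → dist x z < ρ := by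
    intro j
    by_cases h : ∃ z ∈ K, χ j z ≠ 0
    · obtain ⟨z, hzK, hz⟩ := h
      exact ⟨z, hzK, fun x _ hx => hχρ j x z hx hz⟩
    · push Not at h
      exact ⟨x₀, hx₀, fun x hx hne => absurd (h x hx) hne⟩
  choose z hzK hz using hz
  have hB : ∀ j, ∃ B : Fin d → Fin d → ℝ, ∀ p q,
      D (z j) p q - (if p = q then c / 2 else 0) = ∑ m, B m p * B m q := by
    intro j
    refine exists_sum_rankOne (fun p q => ?_) fun ξ => ?_
    · rw [hsymm]
      simp only [eq_comm]
    · have h1 : ∑ p, ∑ q, (D (z j) p q - if p = q then c / 2 else 0) * ξ p * ξ q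
          = ∑ p, ∑ q, D (z j) p q * ξ p * ξ q - c / 2 * ∑ p, ξ p ^ 2 := by
        simp_rw [sub_mul, Finset.sum_sub_distrib, Finset.mul_sum]
        congr 1
        simp [ite_mul]
        exact Finset.sum_congr rfl fun p _ => by ring
      rw [h1]
      by_cases hξ : ξ = 0
      · simp [hξ]
      · have h2 := hD _ (hzK j) ξ hξ
        have h3 : 0 ≤ ∑ p, ξ p ^ 2 := Finset.sum_nonneg fun p _ => sq_nonneg _
        nlinarith
  choose B hB using hB
  have hBN : ∀ j m p, |B j m p| ≤ √N := by
    intro j m p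
    refine abs_le_sqrt ?_
    have h1 := hB j p p
    have h2 := Finset.single_le_sum (fun m _ => mul_self_nonneg (B j m p)) (Finset.mem_univ m)
    have h3 := (abs_entry_le_norm (D (z j)) p p).trans (hN _ (hzK j))
    have h4 := le_abs_self (D (z j) p p)
    simp only [if_true] at h1 h2
    nlinarith
  set E : (Fin d → ℝ) → Fin d → Fin d → ℝ := fun x p q =>
    ∑ j, χ j x ^ 2 * (D x p q - D (z j) p q) - if p = q then δ else 0 with hE
  have hEs : ∀ p q, ContDiff ℝ (⊤ : ℕ∞) fun x => E x p q := fun p q =>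
    (ContDiff.sum fun j _ => ((hχs j).pow 2).mul ((hDs p q).sub contDiff_const)).sub
      contDiff_const
  have hEsymm : ∀ x p q, E x p q = E x q p := by
    intro x p q
    simp only [hE, hsymm _ p q, eq_comm (a := p)]
  have hEκ : ∀ x ∈ K, ∀ p q, |E x p q| ≤ 2 * κ := by
    intro x hx p q
    have h1 : |∑ j, χ j x ^ 2 * (D x p q - D (z j) p q)| ≤ κ := by
      calc _ ≤ ∑ j, |χ j x ^ 2 * (D x p q - D (z j) p q)| := Finset.abs_sum_le_sum_abs _ _
        _ ≤ ∑ j, χ j x ^ 2 * κ := by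
          refine Finset.sum_le_sum fun j _ => ?_
          rw [abs_mul, abs_of_nonneg (sq_nonneg (χ j x))]
          by_cases h : χ j x = 0
          · simp [h]
          · gcongr
            have h2 := hosc x hx (z j) (hzK j) (hz j x hx h)
            rw [dist_eq_norm] at h2
            exact (abs_entry_le_norm (D x - D (z j)) p q).trans h2.le
        _ = κ := by rw [← Finset.sum_mul, hχ1 x (hR x hx), one_mul]
    have h2 : |if p = q then δ else 0| ≤ κ := by
      split_ifs
      · rwa [abs_of_pos hδ]
      · simpa using hκ0.le
    exact (abs_sub _ _).trans (by linarith)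
  obtain ⟨g, hgs, hg⟩ := exists_smooth_sqrt (half_pos hκ0)
  have hgK : ∀ t, |t| ≤ 2 * κ → g (κ + t / 4) ^ 2 = κ + t / 4 ∧ |g (κ + t / 4)| ≤ √N := by
    intro t ht
    rw [abs_le] at ht
    rw [hg _ (by linarith), sq_sqrt (by linarith), abs_of_nonneg (sqrt_nonneg _)]
    exact ⟨rfl, sqrt_le_sqrt (by linarith)⟩
  have hgK' : ∀ t, |t| ≤ 2 * κ → g (κ - t / 4) ^ 2 = κ - t / 4 ∧ |g (κ - t / 4)| ≤ √N := by
    intro t ht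
    have := hgK (-t) (by rwa [abs_neg])
    rwa [neg_div, ← sub_eq_add_neg] at this
  have hsingle : ∀ p : Fin d, ∑ i, |(Pi.single p (1 : ℝ) : Fin d → ℝ) i| = 1 := by
    intro p
    simp [Pi.single_apply, apply_ite abs]
  refine ⟨((Fin d → Fin M) × Fin d) ⊕ ((Fin d × Fin d) ⊕ (Fin d × Fin d)), inferInstance,
    Sum.elim (fun n => χ n.1) (Sum.elim (fun n x => g (κ + E x n.1 n.2 / 4))
      (fun n x => g (κ - E x n.1 n.2 / 4))),
    Sum.elim (fun n => dotCLM (B n.1 n.2)) (Sum.elim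
      (fun n => dotCLM (Pi.single n.1 1 + Pi.single n.2 1))
      (fun n => dotCLM (Pi.single n.1 1 - Pi.single n.2 1))), ?_, fun x hx => ⟨fun i j => ?_, ?_⟩⟩
  · rintro (n | n | n)
    · exact hχs _
    · exact hgs.comp (contDiff_const.add ((hEs _ _).div_const _))
    · exact hgs.comp (contDiff_const.sub ((hEs _ _).div_const _))
  · simp only [Fintype.sum_sum_type, Fintype.sum_prod_type, Sum.elim_inl, Sum.elim_inr,
      dotCLM_single, (hgK _ (hEκ x hx _ _)).1, (hgK' _ (hEκ x hx _ _)).1]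
    have h1 := sum_rankOne_near_id (hEsymm x) κ i j
    simp_rw [Finset.sum_add_distrib] at h1
    rw [h1]
    simp_rw [← Finset.mul_sum, ← hB]
    have h2 := hχ1 x (hR x hx)
    simp only [hE, hκc, mul_sub, Finset.sum_sub_distrib, ← Finset.sum_mul, h2]
    split_ifs <;> ring
  · simp only [Fintype.sum_sum_type, Fintype.sum_prod_type, Sum.elim_inl, Sum.elim_inr]
    have hsN := sqrt_nonneg N
    have h1 : ∑ j, ∑ m, 2 * |χ j x| * ‖dotCLM (B j m)‖ ≤ 2 * 3 ^ d * d ^ 2 * √N := by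
      calc _ ≤ ∑ j, ∑ _m : Fin d, 2 * χ j x * (d * √N) := by
            refine Finset.sum_le_sum fun j _ => Finset.sum_le_sum fun m _ => ?_
            rw [abs_of_nonneg (hχ0 j x)]
            have := hχ0 j x
            gcongr
            refine (norm_dotCLM_le _).trans ((Finset.sum_le_sum fun p _ => hBN j m p).trans ?_)
            simp
        _ = (∑ j, χ j x) * (2 * d * (d * √N)) := by
            rw [Finset.sum_mul]
            refine Finset.sum_congr rfl fun j _ => ?_
            simp
            ring
        _ ≤ 3 ^ d * (2 * d * (d * √N)) := by
            gcongr
            exact hχ3 x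
        _ = _ := by ring
    have h2 : ∀ (f : Fin d → Fin d → ℝ) (u : Fin d → Fin d → Fin d → ℝ),
        (∀ p q, |f p q| ≤ √N) →
        (∀ p q i, |u p q i| ≤ |(Pi.single p (1 : ℝ) : Fin d → ℝ) i|
          + |(Pi.single q (1 : ℝ) : Fin d → ℝ) i|) →
        ∑ p, ∑ q, 2 * |f p q| * ‖dotCLM (u p q)‖ ≤ 4 * d ^ 2 * √N := by
      intro f u hf hu
      calc _ ≤ ∑ _p : Fin d, ∑ _q : Fin d, 2 * √N * 2 := by
            refine Finset.sum_le_sum fun p _ => Finset.sum_le_sum fun q _ => ?_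
            gcongr
            · exact hf p q
            · refine (norm_dotCLM_le _).trans ((Finset.sum_le_sum fun i _ => hu p q i).trans ?_)
              rw [Finset.sum_add_distrib, hsingle, hsingle]
              norm_num
        _ = _ := by
            simp
            ring
    have h3 := h2 (fun p q => g (κ + E x p q / 4)) (fun p q => Pi.single p 1 + Pi.single q 1)
      (fun p q => (hgK _ (hEκ x hx _ _)).2) fun p q i => abs_add_le _ _
    have h4 := h2 (fun p q => g (κ - E x p q / 4)) (fun p q => Pi.single p 1 - Pi.single q 1)
      (fun p q => (hgK' _ (hEκ x hx _ _)).2) fun p q i => abs_sub _ _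
    linarith

lemma matGt_of_near_id {d : ℕ} {M : Fin d → Fin d → ℝ} {δ τ : ℝ} (hδ : 0 < δ)
    (hτ : τ * d ≤ δ / 2) (hM : ∀ i j, |M i j - if i = j then δ else 0| ≤ τ) :
    MatGt M (δ / 4) := by
  intro ξ hξ
  have hpos : 0 < ∑ i, ξ i ^ 2 := by
    obtain ⟨i, hi⟩ := Function.ne_iff.1 hξ
    have hi' : ξ i ≠ 0 := hi
    exact Finset.sum_pos' (fun i _ => sq_nonneg _) ⟨i, Finset.mem_univ i, by positivity⟩
  have h1 : ∀ i j, (if i = j then δ * ξ i ^ 2 else 0) - τ * ((ξ i ^ 2 + ξ j ^ 2) / 2)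
      ≤ M i j * ξ i * ξ j := by
    intro i j
    have h2 : |(M i j - if i = j then δ else 0) * (ξ i * ξ j)|
        ≤ τ * ((ξ i ^ 2 + ξ j ^ 2) / 2) := by
      have hτ0 := (abs_nonneg _).trans (hM i j)
      rw [abs_mul]
      refine mul_le_mul (hM i j) ?_ (abs_nonneg _) hτ0
      rw [abs_le]
      constructor <;> nlinarith [sq_nonneg (ξ i - ξ j), sq_nonneg (ξ i + ξ j)]
    have h3 := (abs_le.1 h2).1
    split_ifs at h3 ⊢ with hij
    · subst hij
      linarith
    · linarith
  have h2 := Finset.sum_le_sum fun i (_ : i ∈ Finset.univ) =>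
    Finset.sum_le_sum fun j (_ : j ∈ Finset.univ) => h1 i j
  have h3 : ∑ i, ∑ j, ((if i = j then δ * ξ i ^ 2 else 0) - τ * ((ξ i ^ 2 + ξ j ^ 2) / 2))
      = (δ - τ * d) * ∑ i, ξ i ^ 2 := by
    simp only [Finset.sum_sub_distrib, ← Finset.mul_sum, ← Finset.sum_div, Finset.sum_add_distrib,
      Finset.sum_ite_eq, Finset.mem_univ, if_true, Finset.sum_const, Finset.card_univ,
      Fintype.card_fin, nsmul_eq_mul]
    ring
  rw [h3] at h2
  nlinarith

lemma norm_le_iSup_closure {d : ℕ} {E : Type*} [NormedAddCommGroup E] {ω : Set (Fin d → ℝ)}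
    (hω : IsCompact (closure ω)) {f : (Fin d → ℝ) → E} (hf : Continuous f) {x : Fin d → ℝ}
    (hx : x ∈ closure ω) : ‖f x‖ ≤ ⨆ x : closure ω, ‖f x.1‖ := by
  obtain ⟨B, hB⟩ := hω.exists_bound_of_continuousOn hf.continuousOn
  exact le_ciSup (f := fun x : closure ω => ‖f x.1‖)
    ⟨B, by rintro _ ⟨y, rfl⟩; exact hB y.1 y.2⟩ ⟨x, hx⟩

/-- Theorem 5.2: approximation of strict smooth subsolutions by smooth subsolutions
with arbitrarily small (still positive definite) deficit, with `C⁰` closeness and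
gradient increment bounds. Constants `C` depend only on `d`, `k` and `ω`. -/
theorem approx_subsolutions_smooth
    {d k : ℕ} (hd : 1 ≤ d) (hk : 1 ≤ k)
    (ω : Set (Fin d → ℝ)) (hω : IsOpen ω) (hωbd : Bornology.IsBounded ω)
    (hωne : ω.Nonempty) :
    ∃ C : ℝ, 0 < C ∧
      ∀ (v : (Fin d → ℝ) → Fin k → ℝ) (w : (Fin d → ℝ) → Fin d → ℝ)
        (A : (Fin d → ℝ) → Fin d → Fin d → ℝ),
        ContDiff ℝ (⊤ : ℕ∞) v → ContDiff ℝ (⊤ : ℕ∞) w → ContDiff ℝ (⊤ : ℕ∞) A →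
        (∀ x i j, A x i j = A x j i) →
        ∀ c : ℝ, 0 < c →
        (∀ x ∈ closure ω, MatGt (deficit A v w x) c) →
        ∀ ε : ℝ, 0 < ε →
        ∃ (vt : (Fin d → ℝ) → Fin k → ℝ) (wt : (Fin d → ℝ) → Fin d → ℝ),
          ContDiff ℝ (⊤ : ℕ∞) vt ∧ ContDiff ℝ (⊤ : ℕ∞) wt ∧
          supNorm ω (fun x => vt x - v x) ≤ ε ∧
          supNorm ω (fun x => wt x - w x) ≤ ε ∧
          grad1Norm ω (fun x => vt x - v x)
              ≤ C * supNorm ω (deficit A v w) ^ (1/2 : ℝ) ∧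
          grad1Norm ω (fun x => wt x - w x)
              ≤ C * supNorm ω (deficit A v w) ^ (1/2 : ℝ)
                * (supNorm ω (deficit A v w) ^ (1/2 : ℝ) + grad1Norm ω v) ∧
          supNorm ω (deficit A vt wt) ≤ ε ∧
          ∃ ct : ℝ, 0 < ct ∧ ∀ x ∈ closure ω, MatGt (deficit A vt wt x) ct := by
  have hK : IsCompact (closure ω) := hωbd.isCompact_closure
  have hKne : (closure ω).Nonempty := hωne.closure
  have : Nonempty (closure ω) := hKne.to_subtype
  have hd0 : (0 : ℝ) < d := by exact_mod_cast hd
  set C₀ : ℝ := 2 * 3 ^ d * d ^ 2 + 8 * d ^ 2 with hC₀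
  have hC₀0 : 0 ≤ C₀ := by positivity
  refine ⟨(C₀ + 1) ^ 2, by positivity, fun v w A hv hw hA hsymm c hc hD ε hε => ?_⟩
  have hDs := contDiff_deficit_apply hA hv hw
  have hDc : Continuous (deficit A v w) :=
    continuous_pi fun i => continuous_pi fun j => (hDs i j).continuous
  set N := supNorm ω (deficit A v w) with hNdef
  have hN : ∀ x ∈ closure ω, ‖deficit A v w x‖ ≤ N := fun x hx => norm_le_iSup_closure hK hDc hx
  have hN0 : 0 < N := by
    obtain ⟨x, hx⟩ := hKne
    exact hc.trans (((hD x hx).lt_diag ⟨0, hd⟩).trans_le ((le_abs_self _).trans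
      ((abs_entry_le_norm _ _ _).trans (hN x hx))))
  rw [← sqrt_eq_rpow]
  have hs0 : 0 < √N := sqrt_pos.2 hN0
  set δ := min (ε / 2) (c / (8 * d)) with hδ
  have hδ0 : 0 < δ := lt_min (by positivity) (by positivity)
  obtain ⟨ι, _, a, L, has, hdec⟩ := exists_corrugation_decomposition hd hK hKne hDs
    (deficit_symm hsymm v w) hc hD hN hδ0 (min_le_right _ _)
  set τ := min (min (ε / 2) (δ / (2 * d))) (min √N N) with hτ
  have hτ0 : 0 < τ := lt_min (lt_min (by positivity) (by positivity)) (lt_min hs0 hN0)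
  have hτε : τ ≤ ε / 2 := (min_le_left _ _).trans (min_le_left _ _)
  have hτδ : τ * d ≤ δ / 2 := by
    have : τ ≤ δ / (2 * d) := (min_le_left _ _).trans (min_le_right _ _)
    rw [le_div_iff₀ (by positivity)] at this
    linarith
  have hτs : τ ≤ √N := (min_le_right _ _).trans (min_le_left _ _)
  have hτN : τ ≤ √N * √N := by
    rw [mul_self_sqrt hN0.le]
    exact (min_le_right _ _).trans (min_le_right _ _)
  obtain ⟨vt, wt, hvt, hwt, h⟩ := corrugation_iterate hK ⟨0, hk⟩ A Finset.univ has L hv hw hτ0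
  have herr : ∀ x ∈ closure ω, ∀ i j,
      |deficit A vt wt x i j - if i = j then δ else 0| ≤ τ := by
    intro x hx i j
    rw [← (hdec x hx).1 i j]
    exact (h x hx).2.2.2.2 i j
  refine ⟨vt, wt, hvt, hwt, ?_, ?_, ?_, ?_, ?_, δ / 4, by positivity, fun x hx =>
    matGt_of_near_id hδ0 hτδ (herr x hx)⟩
  · exact ciSup_le fun x => (h x x.2).1.trans (by linarith)
  · exact ciSup_le fun x => (h x x.2).2.1.trans (by linarith)
  · refine ciSup_le fun x => (h x x.2).2.2.1.trans ?_
    have := (hdec x x.2).2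
    nlinarith [mul_nonneg hC₀0 hs0.le, mul_nonneg (mul_nonneg hC₀0 hC₀0) hs0.le]
  · refine ciSup_le fun x => (h x x.2).2.2.2.1.trans ?_
    have hS := (hdec x x.2).2
    have hg : ‖fderiv ℝ v x‖ ≤ grad1Norm ω v :=
      norm_le_iSup_closure hK (hv.continuous_fderiv (by simp)) x.2
    have hg0 := (norm_nonneg _).trans hg
    have hS0 : 0 ≤ ∑ n, 2 * |a n x| * ‖L n‖ := Finset.sum_nonneg fun n _ => by positivity
    calc _ ≤ C₀ * √N * (grad1Norm ω v + C₀ * √N) + √N * √N := by gcongr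
      _ ≤ (C₀ + 1) ^ 2 * √N * (√N + grad1Norm ω v) := by
        nlinarith [mul_nonneg hC₀0 (mul_nonneg hs0.le hs0.le), mul_nonneg hs0.le hg0,
          mul_nonneg hC₀0 (mul_nonneg hs0.le hg0),
          mul_nonneg (mul_nonneg hC₀0 hC₀0) (mul_nonneg hs0.le hg0)]
  · refine ciSup_le fun x => ?_
    rw [pi_norm_le_iff_of_nonneg hε.le]
    intro i
    rw [pi_norm_le_iff_of_nonneg hε.le]
    intro j
    have h1 := herr x x.2 i j
    have h2 : δ ≤ ε / 2 := min_le_left _ _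
    rw [Real.norm_eq_abs]
    rw [abs_le] at h1 ⊢
    split_ifs at h1 <;> constructor <;> linarith
end
end
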